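/- Let δ be a fixed real number, ν > 0 and 0 < ε ≤ 2. Then: (i) the positive zeros of the cylinder functions C_ν and C_{ν+ε} are interlaced on (0,∞); (ii) the positive zeros of J_ν′ and J_{ν+ε}′ are interlaced on (0,∞); and (iii) the positive zeros of Y_ν′ and Y_{ν+ε}′ are interlaced on (0,∞), where primes denote derivatives with respect to x. -/

import Mathlib

open Real Filter Topology Set

/-- Bessel function of the first kind of real order `ν`:
`J_ν(x) = ∑ ((−1)^m / (m! Γ(m+ν+1))) (x/2)^{2m+ν}` (with `1/Γ = 0` at nonpositive
integers, which agrees with Lean's `1/0 = 0` since `Real.Gamma` vanishes there). -/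
noncomputable def besselJ (ν : ℝ) (x : ℝ) : ℝ :=
  ∑' m : ℕ, ((-1 : ℝ) ^ m / (m.factorial * Real.Gamma ((m : ℝ) + ν + 1))) *
    (x / 2) ^ (2 * (m : ℝ) + ν)

/-- Bessel function of the second kind, characterized as the limit
`(J_μ(x) cos(μπ) − J_{−μ}(x)) / sin(μπ) → Y_ν(x)` as `μ → ν` through non-integer reals. -/
noncomputable def besselY (ν : ℝ) (x : ℝ) : ℝ :=
  limUnder (𝓝[{μ : ℝ | ∀ n : ℤ, μ ≠ (n : ℝ)}] ν)
    (fun μ : ℝ => (besselJ μ x * Real.cos (μ * π) - besselJ (-μ) x) / Real.sin (μ * π))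

/-- The cylinder function `C_ν(x) = cos δ · J_ν(x) − sin δ · Y_ν(x)`. -/
noncomputable def cylinder (δ ν : ℝ) (x : ℝ) : ℝ :=
  Real.cos δ * besselJ ν x - Real.sin δ * besselY ν x

/-- One direction of the interlacing property: between any two consecutive zeros of `f`
in `I` there is exactly one zero of `g`. -/
def InterlaceHalf (f g : ℝ → ℝ) (I : Set ℝ) : Prop :=
  ∀ x₁ ∈ I, ∀ x₂ ∈ I, x₁ < x₂ → f x₁ = 0 → f x₂ = 0 →
    (∀ x ∈ Set.Ioo x₁ x₂, f x ≠ 0) →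
    ∃! x, x ∈ Set.Ioo x₁ x₂ ∧ g x = 0

/-- `f` and `g` have interlaced zeros on `I`. -/
def InterlacedOn (f g : ℝ → ℝ) (I : Set ℝ) : Prop :=
  InterlaceHalf f g I ∧ InterlaceHalf g f I



/-! ### Part 1: the power series -/

/-- the reduced series -/
noncomputable def besselS (ν y : ℝ) : ℝ :=
  ∑' m : ℕ, ((-1 : ℝ) ^ m / (m.factorial * Real.Gamma ((m : ℝ) + ν + 1))) * y ^ m

lemma gamma_inv_bound (R : ℝ) : ∃ C : ℝ, 0 < C ∧ ∀ m : ℕ, ∀ s : ℂ, ‖s‖ ≤ R →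
    ‖(Complex.Gamma ((m : ℂ) + s + 1))⁻¹‖ ≤ C := by
  obtain ⟨N, hN⟩ := exists_nat_ge (R + 1)
  have h1 : ∀ m : ℕ, ∃ C : ℝ, ∀ s : ℂ, ‖s‖ ≤ R → ‖(Complex.Gamma ((m : ℂ) + s + 1))⁻¹‖ ≤ C := by
    intro m
    have hc : Continuous fun s : ℂ => (Complex.Gamma ((m : ℂ) + s + 1))⁻¹ :=
      Complex.differentiable_one_div_Gamma.continuous.comp (by fun_prop)
    obtain ⟨C, hC⟩ := (isCompact_closedBall (0 : ℂ) R).exists_bound_of_continuousOn hc.continuousOn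
    exact ⟨C, fun s hs => hC s (by simpa using hs)⟩
  choose C hC using h1
  refine ⟨1 + ∑ m ∈ Finset.range (N + 1), |C m|, by positivity, ?_⟩
  have small : ∀ m : ℕ, m ≤ N → ∀ s : ℂ, ‖s‖ ≤ R →
      ‖(Complex.Gamma ((m : ℂ) + s + 1))⁻¹‖ ≤ 1 + ∑ m ∈ Finset.range (N + 1), |C m| := by
    intro m hm s hs
    have := Finset.single_le_sum (f := fun m => |C m|) (fun i _ => abs_nonneg _)
      (Finset.mem_range.mpr (Nat.lt_succ_of_le hm))
    have h2 := hC m s hs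
    have h3 := le_abs_self (C m)
    linarith
  intro m s hs
  rcases le_total m N with h | h
  · exact small m h s hs
  · induction m, h using Nat.le_induction with
    | base => exact small N le_rfl s hs
    | succ k hk ih =>
      have e := Complex.one_div_Gamma_eq_self_mul_one_div_Gamma_add_one ((k : ℂ) + s + 1)
      rw [e, norm_mul] at ih
      have hk' : (N : ℝ) ≤ k := by exact_mod_cast hk
      have h1 : 1 ≤ ‖(k : ℂ) + s + 1‖ := by
        have h2 : ‖((k : ℂ) + 1)‖ ≤ ‖(k : ℂ) + s + 1‖ + ‖s‖ := by
          have := norm_sub_le ((k : ℂ) + s + 1) s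
          rwa [show (k : ℂ) + s + 1 - s = (k : ℂ) + 1 by ring] at this
        have h3 : ‖((k : ℂ) + 1)‖ = k + 1 := by
          have : ((k : ℂ) + 1) = ((k + 1 : ℕ) : ℂ) := by push_cast; ring
          rw [this, Complex.norm_natCast]; push_cast; ring
        linarith
      have e2 : ((k + 1 : ℕ) : ℂ) + s + 1 = (k : ℂ) + s + 1 + 1 := by push_cast; ring
      rw [e2]
      refine le_trans ?_ ih
      exact le_mul_of_one_le_left (norm_nonneg _) h1

lemma gamma_inv_bound_real (ν : ℝ) : ∃ C : ℝ, 0 < C ∧ ∀ m : ℕ,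
    |(Real.Gamma ((m : ℝ) + ν + 1))⁻¹| ≤ C := by
  obtain ⟨C, hC, h⟩ := gamma_inv_bound |ν|
  refine ⟨C, hC, fun m => ?_⟩
  have := h m (ν : ℂ) (by simp)
  have e : ((m : ℂ) + (ν : ℂ) + 1) = (((m : ℝ) + ν + 1 : ℝ) : ℂ) := by push_cast; ring
  rw [e, Complex.Gamma_ofReal, ← Complex.ofReal_inv, Complex.norm_real] at this
  exact this

lemma real_gamma_inv (s : ℝ) : (Real.Gamma s)⁻¹ = s * (Real.Gamma (s + 1))⁻¹ := by
  by_cases h : s = 0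
  · subst h; simp
  · rw [Real.Gamma_add_one h, mul_inv]
    field_simp

lemma besselS_term_bound {ν C : ℝ} (h : ∀ m : ℕ, |(Real.Gamma ((m : ℝ) + ν + 1))⁻¹| ≤ C)
    (y : ℝ) (m : ℕ) :
    ‖((-1 : ℝ) ^ m / (m.factorial * Real.Gamma ((m : ℝ) + ν + 1))) * y ^ m‖ ≤
      C * (|y| ^ m / m.factorial) := by
  have e : ((-1 : ℝ) ^ m / (m.factorial * Real.Gamma ((m : ℝ) + ν + 1))) * y ^ m =
    (Real.Gamma ((m : ℝ) + ν + 1))⁻¹ * ((-1) ^ m * y ^ m / m.factorial) := by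
    rw [div_eq_mul_inv, mul_inv]; ring
  rw [e, norm_mul, Real.norm_eq_abs, norm_div, norm_mul, norm_pow, norm_pow]
  simp only [norm_neg, norm_one, one_pow, one_mul, Real.norm_eq_abs, Nat.abs_cast]
  exact mul_le_mul_of_nonneg_right (h m) (by positivity)

lemma besselS_summable (ν y : ℝ) :
    Summable fun m : ℕ => ((-1 : ℝ) ^ m / (m.factorial * Real.Gamma ((m : ℝ) + ν + 1))) * y ^ m := by
  obtain ⟨C, hC, h⟩ := gamma_inv_bound_real ν
  exact Summable.of_norm_bounded ((Real.summable_pow_div_factorial |y|).mul_left C)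
    (fun m => besselS_term_bound h y m)

lemma besselS_deriv_series (ν y : ℝ) :
    HasDerivAt (besselS ν) (∑' m : ℕ, ((-1 : ℝ) ^ m / (m.factorial * Real.Gamma ((m : ℝ) + ν + 1)))
      * (m * y ^ (m - 1))) y := by
  obtain ⟨C, hC, h⟩ := gamma_inv_bound_real ν
  have hy : y ∈ Metric.ball (0 : ℝ) (|y| + 1) := by simp
  have hs : Summable fun m : ℕ => C * ((m : ℝ) * (|y| + 1) ^ (m - 1) / m.factorial) := by
    apply Summable.mul_left
    rw [← summable_nat_add_iff 1]
    refine (Real.summable_pow_div_factorial (|y| + 1)).congr fun m => ?_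
    have : ((m : ℝ) + 1) ≠ 0 := by positivity
    rw [Nat.factorial_succ]; push_cast
    have h2 : (m.factorial : ℝ) ≠ 0 := by positivity
    field_simp
  have key := hasDerivAt_tsum_of_isPreconnected (t := Metric.ball (0 : ℝ) (|y| + 1))
    (g := fun (m : ℕ) (z : ℝ) => ((-1 : ℝ) ^ m / (m.factorial * Real.Gamma ((m : ℝ) + ν + 1))) * z ^ m)
    (g' := fun (m : ℕ) (z : ℝ) => ((-1 : ℝ) ^ m / (m.factorial * Real.Gamma ((m : ℝ) + ν + 1)))
      * (m * z ^ (m - 1))) hs Metric.isOpen_ball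
    (convex_ball _ _).isPreconnected ?_ ?_ hy (besselS_summable ν y) hy
  · exact key
  · intro n z _
    exact (hasDerivAt_pow n z).const_mul _
  · intro m z hz
    have hz' : |z| ≤ |y| + 1 := by
      have : |z| < |y| + 1 := by simpa using hz
      exact this.le
    have e : ((-1 : ℝ) ^ m / (m.factorial * Real.Gamma ((m : ℝ) + ν + 1))) * (m * z ^ (m - 1)) =
      (Real.Gamma ((m : ℝ) + ν + 1))⁻¹ * ((-1) ^ m * (m * z ^ (m - 1)) / m.factorial) := by
      rw [div_eq_mul_inv, mul_inv]; ring
    rw [e, norm_mul, Real.norm_eq_abs, norm_div, norm_mul, norm_mul, norm_pow, norm_pow]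
    simp only [norm_neg, norm_one, one_pow, one_mul, Real.norm_eq_abs, Nat.abs_cast]
    gcongr
    exact h m

lemma besselS_deriv (ν y : ℝ) : HasDerivAt (besselS ν) (- besselS (ν + 1) y) y := by
  have h := besselS_deriv_series ν y
  convert h using 1
  have hsum : Summable fun m : ℕ => ((-1 : ℝ) ^ m / (m.factorial * Real.Gamma ((m : ℝ) + ν + 1)))
      * (m * y ^ (m - 1)) := by
    rw [← summable_nat_add_iff 1]
    refine (besselS_summable (ν + 1) y).neg.congr fun m => ?_
    have h2 : (m.factorial : ℝ) ≠ 0 := by positivity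
    have : ((m : ℝ) + 1) ≠ 0 := by positivity
    rw [Nat.factorial_succ]; push_cast
    rw [show (m : ℝ) + (ν + 1) + 1 = m + 1 + ν + 1 by ring]
    simp only [div_eq_mul_inv, mul_inv, pow_succ]
    field_simp
  rw [hsum.tsum_eq_zero_add, besselS, ← tsum_neg]
  simp only [Nat.cast_zero, zero_mul, mul_zero, zero_add]
  refine tsum_congr fun m => ?_
  have h2 : (m.factorial : ℝ) ≠ 0 := by positivity
  have : ((m : ℝ) + 1) ≠ 0 := by positivity
  rw [Nat.factorial_succ]; push_cast
  rw [show (m : ℝ) + (ν + 1) + 1 = m + 1 + ν + 1 by ring]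
  simp only [div_eq_mul_inv, mul_inv, pow_succ]
  field_simp

lemma besselS_rec (ν y : ℝ) : besselS (ν - 1) y = ν * besselS ν y - y * besselS (ν + 1) y := by
  have h1 := (besselS_deriv ν y).unique (besselS_deriv_series ν y)
  have hsum : Summable fun m : ℕ => ((-1 : ℝ) ^ m / (m.factorial * Real.Gamma ((m : ℝ) + ν + 1)))
      * (m * y ^ m) := by
    have : Summable fun m : ℕ => ((-1 : ℝ) ^ m / (m.factorial * Real.Gamma ((m : ℝ) + (ν - 1) + 1))) * y ^ m
      - ν * (((-1 : ℝ) ^ m / (m.factorial * Real.Gamma ((m : ℝ) + ν + 1))) * y ^ m) :=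
      (besselS_summable (ν - 1) y).sub ((besselS_summable ν y).mul_left ν)
    refine this.congr fun m => ?_
    have := real_gamma_inv (m + (ν - 1) + 1)
    simp only [div_eq_mul_inv, mul_inv]
    rw [this, show (m : ℝ) + (ν - 1) + 1 + 1 = m + ν + 1 by ring]
    ring
  have e : - y * besselS (ν + 1) y = ∑' m : ℕ,
      ((-1 : ℝ) ^ m / (m.factorial * Real.Gamma ((m : ℝ) + ν + 1))) * (m * y ^ m) := by
    rw [neg_mul, ← mul_neg, h1, ← tsum_mul_left]
    refine tsum_congr fun m => ?_
    rcases m with _ | m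
    · simp
    · simp only [Nat.add_sub_cancel, pow_succ]; ring
  rw [show ν * besselS ν y - y * besselS (ν + 1) y = ν * besselS ν y + -y * besselS (ν + 1) y by ring,
    e, besselS, besselS, ← tsum_mul_left,
    ← ((besselS_summable ν y).mul_left ν).tsum_add hsum]
  refine tsum_congr fun m => ?_
  have := real_gamma_inv (m + (ν - 1) + 1)
  simp only [div_eq_mul_inv, mul_inv]
  rw [this, show (m : ℝ) + (ν - 1) + 1 + 1 = m + ν + 1 by ring]
  ring

lemma besselS_neg_nat (n : ℕ) (y : ℝ) :
    besselS (-(n : ℝ)) y = (-1) ^ n * y ^ n * besselS n y ∧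
    besselS (-((n : ℝ) + 1)) y = (-1) ^ (n + 1) * y ^ (n + 1) * besselS (n + 1) y := by
  induction n with
  | zero =>
    have := besselS_rec 0 y
    simp at this ⊢
    exact this
  | succ n ih =>
    obtain ⟨h1, h2⟩ := ih
    push_cast
    refine ⟨h2, ?_⟩
    have r1 := besselS_rec (-((n : ℝ) + 1)) y
    have r2 := besselS_rec ((n : ℝ) + 1) y
    rw [show -((n : ℝ) + 1) - 1 = -((n : ℝ) + 1 + 1) by ring, h2,
      show -((n : ℝ) + 1) + 1 = -n by ring, h1] at r1
    rw [show (n : ℝ) + 1 - 1 = n by ring] at r2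
    rw [r1, r2]
    ring

lemma besselJ_eq (ν : ℝ) {x : ℝ} (hx : 0 < x) :
    besselJ ν x = (x / 2) ^ ν * besselS ν ((x / 2) ^ 2) := by
  have h2 : 0 < x / 2 := by positivity
  rw [besselJ, besselS, ← tsum_mul_left]
  refine tsum_congr fun m => ?_
  rw [Real.rpow_add h2, Real.rpow_mul h2.le, Real.rpow_natCast, Real.rpow_ofNat]
  ring

lemma besselJ_rec (ν : ℝ) {x : ℝ} (hx : 0 < x) :
    besselJ (ν - 1) x + besselJ (ν + 1) x = 2 * ν / x * besselJ ν x := by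
  have h2 : 0 < x / 2 := by positivity
  rw [besselJ_eq _ hx, besselJ_eq _ hx, besselJ_eq _ hx, besselS_rec, Real.rpow_sub_one h2.ne',
    Real.rpow_add_one h2.ne']
  field_simp
  ring

lemma besselJ_deriv (ν : ℝ) {x : ℝ} (hx : 0 < x) :
    HasDerivAt (besselJ ν) (ν / x * besselJ ν x - besselJ (ν + 1) x) x := by
  have h2 : 0 < x / 2 := by positivity
  have hd : HasDerivAt (fun x : ℝ => x / 2) (1 / 2) x := (hasDerivAt_id x).div_const 2
  have h3 := ((hd.rpow_const (p := ν) (Or.inl h2.ne')).mul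
    ((besselS_deriv ν ((x / 2) ^ 2)).comp x (hd.pow 2)))
  have h4 : besselJ ν =ᶠ[𝓝 x] fun x : ℝ => (x / 2) ^ ν * besselS ν ((x / 2) ^ 2) := by
    filter_upwards [lt_mem_nhds hx] with z hz using besselJ_eq ν hz
  refine (h3.congr_of_eventuallyEq h4).congr_deriv ?_
  rw [besselJ_eq _ hx, besselJ_eq _ hx, Real.rpow_sub_one h2.ne', Real.rpow_add_one h2.ne']
  simp only [Function.comp, Pi.pow_apply]
  field_simp
  ring

lemma besselJ_deriv' (ν : ℝ) {x : ℝ} (hx : 0 < x) :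
    HasDerivAt (besselJ ν) (besselJ (ν - 1) x - ν / x * besselJ ν x) x := by
  refine (besselJ_deriv ν hx).congr_deriv ?_
  have := besselJ_rec ν hx
  have e : 2 * ν / x = ν / x + ν / x := by ring
  rw [e] at this
  linarith

lemma besselJ_neg_nat (n : ℕ) {x : ℝ} (hx : 0 < x) :
    besselJ (-(n : ℝ)) x = (-1) ^ n * besselJ n x := by
  have h2 : 0 < x / 2 := by positivity
  rw [besselJ_eq _ hx, besselJ_eq _ hx, (besselS_neg_nat n _).1, Real.rpow_neg h2.le,
    Real.rpow_natCast, ← pow_mul, mul_comm 2 n, pow_mul]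
  field_simp

lemma besselJ_zero_lim (ν : ℝ) :
    Tendsto (fun x => (x / 2) ^ (-ν) * besselJ ν x) (𝓝[>] 0) (𝓝 (Real.Gamma (ν + 1))⁻¹) := by
  have h0 : besselS ν 0 = (Real.Gamma (ν + 1))⁻¹ := by
    rw [besselS, tsum_eq_single 0]
    · simp
    · intro m hm; simp [hm]
  have hc : Continuous fun x : ℝ => besselS ν ((x / 2) ^ 2) := by
    have : Continuous (besselS ν) := continuous_iff_continuousAt.mpr
      fun y => (besselS_deriv ν y).continuousAt
    exact this.comp (by fun_prop)
  have := hc.tendsto 0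
  simp only [zero_div, ne_eq, OfNat.ofNat_ne_zero, not_false_eq_true, zero_pow, h0] at this
  refine (this.mono_left nhdsWithin_le_nhds).congr' ?_
  filter_upwards [self_mem_nhdsWithin] with x hx
  have hx : 0 < x := hx
  have h2 : 0 < x / 2 := by positivity
  rw [besselJ_eq _ hx, ← mul_assoc, ← Real.rpow_add h2]
  simp

lemma besselS_differentiable_order (y : ℝ) : Differentiable ℝ fun ν => besselS ν y := by
  let F : ℕ → ℂ → ℂ := fun m s => (-1 : ℂ) ^ m / m.factorial * (Complex.Gamma ((m : ℂ) + s + 1))⁻¹ * (y : ℂ) ^ m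
  intro ν
  obtain ⟨C, hC, hb⟩ := gamma_inv_bound (|ν| + 1)
  have hd : DifferentiableOn ℂ (fun s => ∑' m, F m s) (Metric.ball 0 (|ν| + 1)) := by
    refine Complex.differentiableOn_tsum_of_summable_norm (u := fun m => C * (|y| ^ m / m.factorial))
      ((Real.summable_pow_div_factorial |y|).mul_left C) ?_ Metric.isOpen_ball ?_
    · intro m
      have : Differentiable ℂ fun s : ℂ => (Complex.Gamma ((m : ℂ) + s + 1))⁻¹ :=
        Complex.differentiable_one_div_Gamma.comp (by fun_prop)
      exact ((this.const_mul _).mul_const _).differentiableOn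
    · intro m s hs
      have hs' : ‖s‖ ≤ |ν| + 1 := by
        have : ‖s‖ < |ν| + 1 := by simpa using hs
        exact this.le
      have := hb m s hs'
      simp only [F, norm_mul, norm_div, norm_pow, norm_neg, norm_one, one_pow, Complex.norm_natCast,
        Complex.norm_real, Real.norm_eq_abs]
      calc 1 / (m.factorial : ℝ) * ‖(Complex.Gamma ((m : ℂ) + s + 1))⁻¹‖ * |y| ^ m
          ≤ 1 / (m.factorial : ℝ) * C * |y| ^ m := by gcongr
        _ = _ := by ring
  have hν : (ν : ℂ) ∈ Metric.ball (0 : ℂ) (|ν| + 1) := by simp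
  have h1 := (hd.differentiableAt (Metric.isOpen_ball.mem_nhds hν)).hasDerivAt.real_of_complex
  have e : (fun x : ℝ => (∑' m, F m (x : ℂ)).re) = fun ν => besselS ν y := by
    funext x
    have : ∀ m, F m (x : ℂ) = (((-1 : ℝ) ^ m / (m.factorial * Real.Gamma ((m : ℝ) + x + 1)) * y ^ m : ℝ) : ℂ) := by
      intro m
      simp only [F]
      rw [show ((m : ℂ) + (x : ℂ) + 1) = (((m : ℝ) + x + 1 : ℝ) : ℂ) by push_cast; ring,
        Complex.Gamma_ofReal]
      push_cast
      rw [div_eq_mul_inv, div_eq_mul_inv, mul_inv]; ring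
    simp_rw [this]
    rw [← Complex.ofReal_tsum, Complex.ofReal_re, besselS]
  rw [e] at h1
  exact h1.differentiableAt

lemma besselJ_differentiable_order {x : ℝ} (hx : 0 < x) : Differentiable ℝ fun ν => besselJ ν x := by
  have h2 : 0 < x / 2 := by positivity
  have e : (fun ν => besselJ ν x) = fun ν => (x / 2) ^ ν * besselS ν ((x / 2) ^ 2) := by
    funext ν; exact besselJ_eq ν hx
  rw [e]
  refine Differentiable.mul ?_ (besselS_differentiable_order _)
  intro ν
  exact ((hasDerivAt_id ν).const_rpow h2).differentiableAt


/-! ### Part 2: Poisson integral and asymptotics at infinity -/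

lemma moment_zero {b : ℝ} (hb : 0 < b) :
    ∫ t in (-1 : ℝ)..1, (1 - t ^ 2) ^ b = √π * Real.Gamma (b + 1) / Real.Gamma (b + 3 / 2) := by
  have h1 : ∫ s in (0 : ℝ)..1, (1 - (2 * s - 1) ^ 2) ^ b = (1 / 2) * ∫ t in (-1 : ℝ)..1, (1 - t ^ 2) ^ b := by
    have := intervalIntegral.integral_comp_mul_sub (a := 0) (b := 1) (fun t : ℝ => (1 - t ^ 2) ^ b)
      (c := 2) two_ne_zero 1
    rw [this]; norm_num
  have h2 : ((∫ s in (0 : ℝ)..1, (1 - (2 * s - 1) ^ 2) ^ b : ℝ) : ℂ) =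
      ((4 : ℝ) ^ b : ℝ) * Complex.betaIntegral (b + 1) (b + 1) := by
    rw [Complex.betaIntegral, ← intervalIntegral.integral_ofReal, ← intervalIntegral.integral_const_mul]
    refine intervalIntegral.integral_congr fun s hs => ?_
    rw [uIcc_of_le zero_le_one] at hs
    have hs0 := hs.1
    have hs1 : 0 ≤ 1 - s := by linarith [hs.2]
    simp only [add_sub_cancel_right]
    rw [← Complex.ofReal_one, ← Complex.ofReal_sub, ← Complex.ofReal_cpow hs0, ← Complex.ofReal_cpow hs1,
      ← Complex.ofReal_mul, ← Complex.ofReal_mul, ← Real.mul_rpow hs0 hs1,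
      ← Real.mul_rpow (by norm_num) (mul_nonneg hs0 hs1)]
    congr 2
    ring
  have h3 := Complex.Gamma_mul_Gamma_eq_betaIntegral (s := (b : ℂ) + 1) (t := (b : ℂ) + 1)
    (by simp; linarith) (by simp; linarith)
  have e1 : (b : ℂ) + 1 = ((b + 1 : ℝ) : ℂ) := by push_cast; ring
  have h4 : (Real.Gamma (b + 1) * Real.Gamma (b + 1)) * (4 : ℝ) ^ b = Real.Gamma (2 * (b + 1)) *
      ((1 / 2) * ∫ t in (-1 : ℝ)..1, (1 - t ^ 2) ^ b) := by
    rw [← h1]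
    have : (((Real.Gamma (b + 1) * Real.Gamma (b + 1)) * (4 : ℝ) ^ b : ℝ) : ℂ) = ((Real.Gamma (2 * (b + 1)) *
      (∫ s in (0 : ℝ)..1, (1 - (2 * s - 1) ^ 2) ^ b) : ℝ) : ℂ) := by
      rw [Complex.ofReal_mul, Complex.ofReal_mul, Complex.ofReal_mul, h2, ← Complex.Gamma_ofReal,
        ← Complex.Gamma_ofReal, ← e1, h3,
        show ((2 * (b + 1) : ℝ) : ℂ) = (b : ℂ) + 1 + (b + 1) by push_cast; ring]
      ring
    exact_mod_cast this
  have h5 := Real.Gamma_mul_Gamma_add_half (b + 1)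
  rw [show b + 1 + 1 / 2 = b + 3 / 2 by ring] at h5
  have g1 : 0 < Real.Gamma (b + 1) := Real.Gamma_pos_of_pos (by linarith)
  have g2 : 0 < Real.Gamma (b + 3 / 2) := Real.Gamma_pos_of_pos (by linarith)
  have g3 : 0 < Real.Gamma (2 * (b + 1)) := Real.Gamma_pos_of_pos (by linarith)
  have h6 : (2 : ℝ) ^ (1 - 2 * (b + 1)) * (4 : ℝ) ^ b = 1 / 2 := by
    rw [show (4 : ℝ) = 2 ^ (2 : ℝ) by norm_num, ← Real.rpow_mul (by norm_num), ← Real.rpow_add (by norm_num),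
      show 1 - 2 * (b + 1) + 2 * b = -1 by ring]
    norm_num
  rw [eq_div_iff g2.ne']
  set Q := ∫ t in (-1 : ℝ)..1, (1 - t ^ 2) ^ b
  have h7 : Real.Gamma (2 * (b + 1)) * (Q * Real.Gamma (b + 3 / 2)) =
    Real.Gamma (2 * (b + 1)) * (√π * Real.Gamma (b + 1)) := by
    calc _ = 2 * (Real.Gamma (2 * (b + 1)) * (1 / 2 * Q)) * Real.Gamma (b + 3 / 2) := by ring
      _ = 2 * (4 : ℝ) ^ b * Real.Gamma (b + 1) * (Real.Gamma (b + 1) * Real.Gamma (b + 3 / 2)) := by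
          rw [← h4]; ring
      _ = 2 * ((2 : ℝ) ^ (1 - 2 * (b + 1)) * (4 : ℝ) ^ b) * Real.Gamma (b + 1) * Real.Gamma (2 * (b + 1)) * √π := by
          rw [h5]; ring
      _ = _ := by rw [h6]; ring
  exact mul_left_cancel₀ g3.ne' h7

lemma one_sub_sq_rpow_continuous {b : ℝ} (hb : 0 < b) : Continuous fun t : ℝ => (1 - t ^ 2) ^ b :=
  (by fun_prop : Continuous fun t : ℝ => 1 - t ^ 2).rpow_const (fun _ => Or.inr hb.le)

lemma moment_rec {b : ℝ} (hb : 0 < b) (m : ℕ) :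
    (2 * (m : ℝ) + 2 * b + 3) * ∫ t in (-1 : ℝ)..1, (1 - t ^ 2) ^ b * t ^ (2 * (m + 1)) =
      (2 * m + 1) * ∫ t in (-1 : ℝ)..1, (1 - t ^ 2) ^ b * t ^ (2 * m) := by
  have hc := one_sub_sq_rpow_continuous hb
  have hder : ∀ t ∈ uIcc (-1 : ℝ) 1, HasDerivAt (fun t : ℝ => (1 - t ^ 2) ^ (b + 1) * t ^ (2 * m + 1))
      ((2 * m + 1) * ((1 - t ^ 2) ^ b * t ^ (2 * m)) -
        (2 * (m : ℝ) + 2 * b + 3) * ((1 - t ^ 2) ^ b * t ^ (2 * (m + 1)))) t := by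
    intro t ht
    rw [uIcc_of_le (by norm_num)] at ht
    have hn : 0 ≤ 1 - t ^ 2 := by nlinarith [ht.1, ht.2]
    have h1 : HasDerivAt (fun t : ℝ => 1 - t ^ 2) (-(2 * t)) t := by
      simpa using (hasDerivAt_pow 2 t).const_sub 1
    have h2 := (h1.rpow_const (p := b + 1) (Or.inr (by linarith))).mul (hasDerivAt_pow (2 * m + 1) t)
    refine h2.congr_deriv ?_
    rw [add_sub_cancel_right, Real.rpow_add_one' hn (by linarith)]
    push_cast
    ring
  have hi := intervalIntegral.integral_eq_sub_of_hasDerivAt hder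
    (Continuous.intervalIntegrable (by fun_prop) _ _)
  rw [intervalIntegral.integral_sub (Continuous.intervalIntegrable (by fun_prop) _ _)
    (Continuous.intervalIntegrable (by fun_prop) _ _), intervalIntegral.integral_const_mul,
    intervalIntegral.integral_const_mul] at hi
  norm_num [Real.zero_rpow (show b + 1 ≠ 0 by linarith)] at hi
  linarith

lemma moment_eq {b : ℝ} (hb : 0 < b) (m : ℕ) :
    ∫ t in (-1 : ℝ)..1, (1 - t ^ 2) ^ b * t ^ (2 * m) =
      (2 * m).factorial * √π * Real.Gamma (b + 1) / (4 ^ m * m.factorial * Real.Gamma (m + b + 3 / 2)) := by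
  induction m with
  | zero => simpa using moment_zero hb
  | succ m ih =>
    have h := moment_rec hb m
    rw [ih] at h
    have hp : 0 < (m : ℝ) + b + 3 / 2 := by positivity
    have g : Real.Gamma (((m + 1 : ℕ) : ℝ) + b + 3 / 2) = (m + b + 3 / 2) * Real.Gamma (m + b + 3 / 2) := by
      rw [← Real.Gamma_add_one hp.ne']; congr 1; push_cast; ring
    have g2 : 0 < Real.Gamma (m + b + 3 / 2) := Real.Gamma_pos_of_pos hp
    have h3 : 2 * (m : ℝ) + 2 * b + 3 ≠ 0 := by positivity
    rw [← mul_right_inj' h3, h, g, show 2 * (m + 1) = 2 * m + 1 + 1 by ring, Nat.factorial_succ,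
      Nat.factorial_succ, Nat.factorial_succ]
    push_cast
    field_simp
    ring

lemma poisson {b : ℝ} (hb : 0 < b) (x : ℝ) :
    ∫ t in (-1 : ℝ)..1, (1 - t ^ 2) ^ b * Real.cos (x * t) =
      √π * Real.Gamma (b + 1) * besselS (b + 1 / 2) ((x / 2) ^ 2) := by
  have hc := one_sub_sq_rpow_continuous hb
  have hsb : Summable fun n : ℕ => |x| ^ (2 * n) / (2 * n).factorial :=
    (Real.summable_pow_div_factorial |x|).comp_injective (i := fun n : ℕ => 2 * n)
      (fun a b h => by simpa using h)
  have key := intervalIntegral.hasSum_integral_of_dominated_convergence (μ := MeasureTheory.volume)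
    (a := -1) (b := 1)
    (F := fun (n : ℕ) (t : ℝ) => (1 - t ^ 2) ^ b * ((-1) ^ n * (x * t) ^ (2 * n) / (2 * n).factorial))
    (f := fun t => (1 - t ^ 2) ^ b * Real.cos (x * t))
    (fun n _ => |x| ^ (2 * n) / (2 * n).factorial) ?_ ?_ ?_ ?_ ?_
  · refine (key.unique ?_)
    have e : ∀ n : ℕ, (∫ t in (-1 : ℝ)..1, (1 - t ^ 2) ^ b * ((-1) ^ n * (x * t) ^ (2 * n) / (2 * n).factorial)) =
        √π * Real.Gamma (b + 1) * (((-1 : ℝ) ^ n / (n.factorial * Real.Gamma ((n : ℝ) + (b + 1 / 2) + 1))) *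
          ((x / 2) ^ 2) ^ n) := by
      intro n
      have : ∀ t : ℝ, (1 - t ^ 2) ^ b * ((-1) ^ n * (x * t) ^ (2 * n) / (2 * n).factorial) =
          ((-1) ^ n * x ^ (2 * n) / (2 * n).factorial) * ((1 - t ^ 2) ^ b * t ^ (2 * n)) := by
        intro t; rw [mul_pow]; ring
      simp_rw [this]
      rw [intervalIntegral.integral_const_mul, moment_eq hb,
        show (n : ℝ) + (b + 1 / 2) + 1 = n + b + 3 / 2 by ring]
      have hf : ((2 * n).factorial : ℝ) ≠ 0 := by positivity
      have g2 : 0 < Real.Gamma (n + b + 3 / 2) := Real.Gamma_pos_of_pos (by positivity)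
      rw [div_pow, div_pow, ← pow_mul, show ((2 : ℝ) ^ 2) ^ n = 4 ^ n by norm_num]
      field_simp
    simp_rw [e]
    exact (besselS_summable (b + 1 / 2) ((x / 2) ^ 2)).hasSum.mul_left _
  · intro n
    exact (by fun_prop : Continuous _).aestronglyMeasurable
  · intro n
    refine Eventually.of_forall fun t ht => ?_
    rw [uIoc_of_le (by norm_num)] at ht
    have h1 : |t| ≤ 1 := abs_le.mpr ⟨ht.1.le, ht.2⟩
    have hn : 0 ≤ 1 - t ^ 2 := by nlinarith [ht.1, ht.2]
    have h2 : (1 - t ^ 2) ^ b ≤ 1 := Real.rpow_le_one hn (by nlinarith) hb.le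
    have h3 : 0 ≤ (1 - t ^ 2) ^ b := Real.rpow_nonneg hn b
    rw [norm_mul, norm_div, norm_mul, norm_pow, norm_pow, norm_mul]
    simp only [norm_neg, norm_one, one_pow, one_mul, Real.norm_eq_abs, Nat.abs_cast, abs_of_nonneg h3]
    calc (1 - t ^ 2) ^ b * ((|x| * |t|) ^ (2 * n) / (2 * n).factorial)
        ≤ 1 * ((|x| * 1) ^ (2 * n) / (2 * n).factorial) := by gcongr
      _ = _ := by simp
  · exact Eventually.of_forall fun t _ => hsb
  · simp
  · refine Eventually.of_forall fun t _ => ?_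
    exact (Real.hasSum_cos (x * t)).mul_left _

lemma besselJ_poisson {ν : ℝ} (hν : 1 / 2 < ν) {x : ℝ} (hx : 0 < x) :
    besselJ ν x = (x / 2) ^ ν / (√π * Real.Gamma (ν + 1 / 2)) *
      ∫ t in (-1 : ℝ)..1, (1 - t ^ 2) ^ (ν - 1 / 2) * Real.cos (x * t) := by
  rw [poisson (by linarith), besselJ_eq _ hx, sub_add_cancel, show ν - 1 / 2 + 1 = ν + 1 / 2 by ring]
  have : 0 < Real.Gamma (ν + 1 / 2) := Real.Gamma_pos_of_pos (by linarith)
  have : 0 < √π := by positivity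
  field_simp



lemma cpow_real_mul_pos {r : ℝ} (hr : 0 < r) (z : ℂ) {b : ℝ} (hb : 0 < b) :
    ((r : ℂ) * z) ^ (b : ℂ) = ((r ^ b : ℝ) : ℂ) * z ^ (b : ℂ) := by
  have hb' : (b : ℂ) ≠ 0 := by exact_mod_cast hb.ne'
  rcases eq_or_ne z 0 with rfl | hz
  · simp [Complex.zero_cpow hb']
  have hr' : (r : ℂ) ≠ 0 := by exact_mod_cast hr.ne'
  rw [Complex.cpow_def_of_ne_zero (mul_ne_zero hr' hz), Complex.cpow_def_of_ne_zero hz,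
    Complex.log_ofReal_mul hr hz, Complex.ofReal_cpow hr.le, Complex.cpow_def_of_ne_zero hr',
    Complex.ofReal_log hr.le, add_mul, Complex.exp_add]

lemma norm_cpow_real (z : ℂ) {b : ℝ} (hb : 0 < b) : ‖z ^ (b : ℂ)‖ = ‖z‖ ^ b := by
  rcases eq_or_ne z 0 with rfl | hz
  · have hb' : (b : ℂ) ≠ 0 := by exact_mod_cast hb.ne'
    rw [Complex.zero_cpow hb', norm_zero, Real.zero_rpow hb.ne']
  · rw [Complex.norm_cpow_of_ne_zero hz]; simp

lemma contour_cont {b : ℝ} (hb : 0 < b) {z : ℂ} (h1 : -1 ≤ z.re) (h2 : z.re ≤ 1) :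
    ContinuousAt (fun z : ℂ => (1 - z ^ 2) ^ (b : ℂ)) z := by
  refine (Complex.continuousAt_cpow_const_of_re_pos (z := 1 - z ^ 2) (w := (b : ℂ)) (Or.inl ?_) (by simpa using hb)).comp
    (f := fun z : ℂ => 1 - z ^ 2) (by fun_prop)
  simp [pow_two]; nlinarith

/-- rectangle contour identity -/
lemma contour_rect {b : ℝ} (hb : 0 < b) (x : ℝ) {R : ℝ} (hR : 0 ≤ R) :
    (∫ t in (-1 : ℝ)..1, (1 - t ^ 2) ^ b * Real.cos (x * t)) =
      (∫ t in (-1 : ℝ)..1, (1 - ((t : ℂ) + R * Complex.I) ^ 2) ^ (b : ℂ) *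
        Complex.exp (Complex.I * x * (t + R * Complex.I))).re +
      2 * (Complex.exp (Complex.I * x) * ∫ y in (0 : ℝ)..R,
        Complex.exp (-(x * y)) * ((y : ℂ) ^ 2 - 2 * Complex.I * y) ^ (b : ℂ)).im := by
  set f : ℂ → ℂ := fun z => (1 - z ^ 2) ^ (b : ℂ) * Complex.exp (Complex.I * x * z) with hf
  have H := Complex.integral_boundary_rect_eq_zero_of_continuousOn_of_differentiableOn f (-1 : ℂ)
    (1 + R * Complex.I) ?_ ?_
  · simp only [Complex.neg_re, Complex.one_re, Complex.add_re, Complex.mul_re, Complex.ofReal_re,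
      Complex.I_re, mul_zero, Complex.ofReal_im, Complex.I_im, mul_one, sub_self, add_zero,
      Complex.neg_im, Complex.one_im, neg_zero, Complex.ofReal_zero, zero_mul, Complex.add_im,
      Complex.mul_im, zero_add, smul_eq_mul, Complex.ofReal_one, Complex.ofReal_neg] at H
    set T := ∫ t in (-1 : ℝ)..1, f ((t : ℂ) + R * Complex.I) with hT
    set S := Complex.exp (Complex.I * x) * ∫ y in (0 : ℝ)..R,
        Complex.exp (-(x * y)) * ((y : ℂ) ^ 2 - 2 * Complex.I * y) ^ (b : ℂ) with hS
    have e1 : ∫ y in (0 : ℝ)..R, f (1 + y * Complex.I) = S := by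
      rw [hS, ← intervalIntegral.integral_const_mul]
      refine intervalIntegral.integral_congr fun y _ => ?_
      simp only [hf]
      rw [show (1 : ℂ) - (1 + y * Complex.I) ^ 2 = (y : ℂ) ^ 2 - 2 * Complex.I * y by
          linear_combination (- (y : ℂ) ^ 2) * Complex.I_sq,
        show Complex.I * x * (1 + y * Complex.I) = Complex.I * x + (-(x * y)) by
          linear_combination ((x : ℂ) * y) * Complex.I_sq, Complex.exp_add]
      ring
    have e2 : ∫ y in (0 : ℝ)..R, f (-1 + y * Complex.I) = (starRingEnd ℂ) S := by
      rw [← e1, ← intervalIntegral.intervalIntegral_conj]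
      refine intervalIntegral.integral_congr fun y hy => ?_
      rw [uIcc_of_le hR] at hy
      simp only [hf]
      rw [map_mul, ← Complex.exp_conj]
      congr 1
      · have : (1 : ℂ) - (-1 + y * Complex.I) ^ 2 = (starRingEnd ℂ) (1 - (1 + y * Complex.I) ^ 2) := by
          simp; ring
        rw [this, Complex.conj_cpow]
        · simp
        · intro h
          rw [Complex.arg_eq_pi_iff] at h
          have := h.1
          simp [pow_two] at this
          nlinarith
      · congr 1; simp; ring
    rw [e1, e2] at H
    have e3 : ∫ t in (-1 : ℝ)..1, (1 - t ^ 2) ^ b * Real.cos (x * t) =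
        (∫ t in (-1 : ℝ)..1, f t).re := by
      have h0 : ∀ t : ℝ, t ∈ uIcc (-1 : ℝ) 1 → (1 - t ^ 2) ^ b * Real.cos (x * t) = (f t).re := by
        intro t ht
        rw [uIcc_of_le (by norm_num)] at ht
        have hn : 0 ≤ 1 - t ^ 2 := by nlinarith [ht.1, ht.2]
        simp only [hf]
        rw [show (1 : ℂ) - (t : ℂ) ^ 2 = ((1 - t ^ 2 : ℝ) : ℂ) by push_cast; ring,
          ← Complex.ofReal_cpow hn, Complex.re_ofReal_mul,
          show Complex.I * x * t = ((x * t : ℝ) : ℂ) * Complex.I by push_cast; ring,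
          Complex.exp_ofReal_mul_I_re]
      rw [intervalIntegral.integral_congr h0]
      have hfi : IntervalIntegrable (fun t : ℝ => f t) MeasureTheory.volume (-1) 1 := by
        refine ContinuousOn.intervalIntegrable ?_
        intro t ht
        rw [uIcc_of_le (by norm_num)] at ht
        refine ContinuousAt.continuousWithinAt ?_
        refine ContinuousAt.comp (f := fun t : ℝ => (t : ℂ)) (g := f) ?_ (by fun_prop)
        exact (contour_cont hb (by simpa using ht.1) (by simpa using ht.2)).mul (by fun_prop)
      have := Complex.reCLM.intervalIntegral_comp_comm hfi
      simpa using this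
    rw [e3]
    have := congrArg Complex.re H
    simp at this
    linarith
  · intro z hz
    rw [Complex.mem_reProdIm] at hz
    simp at hz
    refine ContinuousAt.continuousWithinAt ?_
    exact (contour_cont hb hz.1.1 hz.1.2).mul (by fun_prop)
  · intro z hz
    rw [Complex.mem_reProdIm] at hz
    simp [hR] at hz
    refine DifferentiableAt.differentiableWithinAt ?_
    refine DifferentiableAt.mul ?_ (by fun_prop)
    refine DifferentiableAt.cpow_const (by fun_prop) ?_
    rw [Complex.mem_slitPlane_iff]
    left
    simp [pow_two]; nlinarith [hz.1.1, hz.1.2]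

lemma gfun_cont {b : ℝ} (hb : 0 < b) (c d : ℝ) (hc : 0 ≤ c) : ContinuousOn
    (fun y : ℝ => ((c * y ^ 2 : ℝ) - 2 * Complex.I * (d * y : ℝ) : ℂ) ^ (b : ℂ)) univ := by
  intro y _
  refine ContinuousAt.continuousWithinAt ?_
  refine (Complex.continuousAt_cpow_const_of_re_pos (z := ((c * y ^ 2 : ℝ) - 2 * Complex.I * (d * y : ℝ) : ℂ)) (w := (b : ℂ)) (Or.inl ?_) (by simpa using hb)).comp
    (f := fun y : ℝ => ((c * y ^ 2 : ℝ) - 2 * Complex.I * (d * y : ℝ) : ℂ)) (by fun_prop)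
  have e : ((c * y ^ 2 : ℝ) - 2 * Complex.I * (d * y : ℝ) : ℂ).re = c * y ^ 2 := by simp [pow_two]
  rw [e]; positivity

lemma gfun_norm {b : ℝ} (hb : 0 < b) (c d : ℝ) (hc : 0 ≤ c) (hd : 0 ≤ d) (hc1 : c ≤ 1) (hd1 : d ≤ 1) (y : ℝ) (hy : 0 ≤ y) :
    ‖((c * y ^ 2 : ℝ) - 2 * Complex.I * (d * y : ℝ) : ℂ) ^ (b : ℂ)‖ ≤ (y ^ 2 + 2 * y) ^ b := by
  rw [norm_cpow_real _ hb]
  refine Real.rpow_le_rpow (norm_nonneg _) ?_ hb.le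
  refine (norm_sub_le _ _).trans ?_
  rw [norm_mul, norm_mul, Complex.norm_real, Complex.norm_real, Complex.norm_I]
  simp only [Complex.norm_ofNat, mul_one, Real.norm_eq_abs]
  rw [abs_of_nonneg (by positivity), abs_of_nonneg (by positivity)]
  have : c * y ^ 2 ≤ 1 * y ^ 2 := by gcongr
  have : d * y ≤ 1 * y := by gcongr
  linarith

lemma poly_exp_isBigO (b : ℝ) (hb : 0 < b) {x : ℝ} (hx : 0 < x) :
    (fun y : ℝ => Real.exp (-(x * y)) * (y ^ 2 + 2 * y) ^ b) =O[atTop] fun y => Real.exp (-(x / 2) * y) := by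
  have h1 := (isLittleO_rpow_exp_pos_mul_atTop (2 * b) (b := x / 2) (by linarith)).isBigO
  obtain ⟨C, hC⟩ := h1.bound
  refine Asymptotics.IsBigO.of_bound (3 ^ b * C) ?_
  filter_upwards [hC, eventually_ge_atTop 1] with y hy hy1
  rw [Real.norm_eq_abs, Real.norm_eq_abs, abs_of_pos (Real.exp_pos _), abs_of_nonneg (by positivity)] at hy ⊢
  have h2 : (y ^ 2 + 2 * y) ^ b ≤ (3 * y ^ 2) ^ b := Real.rpow_le_rpow (by positivity) (by nlinarith) hb.le
  rw [Real.mul_rpow (by norm_num) (by positivity), ← Real.rpow_natCast y 2, ← Real.rpow_mul (by linarith)] at h2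
  calc Real.exp (-(x * y)) * (y ^ 2 + 2 * y) ^ b ≤ Real.exp (-(x * y)) * (3 ^ b * (C * Real.exp (x / 2 * y))) := by
        gcongr
        refine (by simpa using h2 : _ ≤ _).trans ?_
        gcongr
    _ = 3 ^ b * C * (Real.exp (-(x * y)) * Real.exp (x / 2 * y)) := by ring
    _ = _ := by rw [← Real.exp_add]; congr 2; ring

lemma poly_exp_integrable (b : ℝ) (hb : 0 < b) {x : ℝ} (hx : 0 < x) :
    MeasureTheory.IntegrableOn (fun y : ℝ => Real.exp (-(x * y)) * (y ^ 2 + 2 * y) ^ b) (Ioi 0) := by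
  refine integrable_of_isBigO_exp_neg (b := x / 2) (by linarith) ?_ (poly_exp_isBigO b hb hx)
  have : Continuous fun y : ℝ => (y ^ 2 + 2 * y) ^ b := Continuous.rpow_const (by fun_prop) (fun _ => Or.inr hb.le)
  exact (by fun_prop : Continuous _).continuousOn

lemma contour_inf {b : ℝ} (hb : 0 < b) {x : ℝ} (hx : 0 < x) :
    (∫ t in (-1 : ℝ)..1, (1 - t ^ 2) ^ b * Real.cos (x * t)) =
      2 * (Complex.exp (Complex.I * x) * ∫ y in Ioi (0 : ℝ),
        Complex.exp (-(x * y)) * ((y : ℂ) ^ 2 - 2 * Complex.I * y) ^ (b : ℂ)).im := by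
  have e : ∀ y : ℝ, ((y : ℂ) ^ 2 - 2 * Complex.I * y) = ((1 * y ^ 2 : ℝ) - 2 * Complex.I * (1 * y : ℝ) : ℂ) := by
    intro y; push_cast; ring
  have en : ∀ y : ℝ, ‖Complex.exp (-(x * y : ℂ))‖ = Real.exp (-(x * y)) := by
    intro y; rw [Complex.norm_exp]; simp
  have h_intg : MeasureTheory.IntegrableOn (fun y : ℝ =>
      Complex.exp (-(x * y)) * ((y : ℂ) ^ 2 - 2 * Complex.I * y) ^ (b : ℂ)) (Ioi 0) := by
    simp_rw [e]
    refine MeasureTheory.Integrable.mono' (poly_exp_integrable b hb hx) ?_ ?_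
    · have := continuousOn_univ.mp (gfun_cont hb 1 1 (by norm_num))
      exact (by fun_prop : Continuous _).aestronglyMeasurable
    · filter_upwards [MeasureTheory.ae_restrict_mem measurableSet_Ioi] with y hy
      rw [norm_mul, en]
      gcongr
      exact gfun_norm hb 1 1 (by norm_num) (by norm_num) (by norm_num) (by norm_num) y (le_of_lt hy)
  have L1 := MeasureTheory.intervalIntegral_tendsto_integral_Ioi 0 h_intg tendsto_id
  have L2 : Tendsto (fun R : ℝ => 2 * (Complex.exp (Complex.I * x) * ∫ y in (0 : ℝ)..R,
        Complex.exp (-(x * y)) * ((y : ℂ) ^ 2 - 2 * Complex.I * y) ^ (b : ℂ)).im) atTop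
      (𝓝 (2 * (Complex.exp (Complex.I * x) * ∫ y in Ioi (0 : ℝ),
        Complex.exp (-(x * y)) * ((y : ℂ) ^ 2 - 2 * Complex.I * y) ^ (b : ℂ)).im)) :=
    ((Complex.continuous_im.tendsto _).comp (L1.const_mul _)).const_mul _
  have L3 : Tendsto (fun R : ℝ => (∫ t in (-1 : ℝ)..1, (1 - ((t : ℂ) + R * Complex.I) ^ 2) ^ (b : ℂ) *
        Complex.exp (Complex.I * x * (t + R * Complex.I)))) atTop (𝓝 0) := by
    have hz : Tendsto (fun R : ℝ => 2 ^ b * 2 * Real.exp (-(x / 2) * R)) atTop (𝓝 0) := by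
      have : Tendsto (fun R : ℝ => Real.exp (-(x / 2) * R)) atTop (𝓝 0) := by
        refine Real.tendsto_exp_atBot.comp ?_
        exact tendsto_id.const_mul_atTop_of_neg (by linarith)
      simpa using this.const_mul (2 ^ b * 2)
    obtain ⟨C, hC⟩ := (poly_exp_isBigO b hb hx).bound
    have hz : Tendsto (fun R : ℝ => 2 ^ b * C * Real.exp (-(x / 2) * R) * 2) atTop (𝓝 0) := by
      have : Tendsto (fun R : ℝ => Real.exp (-(x / 2) * R)) atTop (𝓝 0) := by
        refine Real.tendsto_exp_atBot.comp ?_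
        exact tendsto_id.const_mul_atTop_of_neg (by linarith)
      simpa using (this.const_mul (2 ^ b * C)).mul_const 2
    refine squeeze_zero_norm' ?_ hz
    filter_upwards [hC, eventually_ge_atTop 1] with R hR hR1
    rw [Real.norm_eq_abs, Real.norm_eq_abs, abs_of_pos (Real.exp_pos _), abs_of_nonneg (by positivity)] at hR
    have := intervalIntegral.norm_integral_le_of_norm_le_const (a := -1) (b := 1) (C := 2 ^ b * C * Real.exp (-(x / 2) * R))
      (f := fun t : ℝ => (1 - ((t : ℂ) + R * Complex.I) ^ 2) ^ (b : ℂ) *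
        Complex.exp (Complex.I * x * (t + R * Complex.I))) ?_
    · refine this.trans (le_of_eq ?_)
      norm_num
    intro t ht
    rw [uIoc_of_le (by norm_num)] at ht
    rw [norm_mul, norm_cpow_real _ hb, Complex.norm_exp]
    have e1 : (Complex.I * x * (t + R * Complex.I)).re = -(x * R) := by simp
    rw [e1]
    have hn : ‖(1 : ℂ) - ((t : ℂ) + R * Complex.I) ^ 2‖ ≤ 2 * (R ^ 2 + 2 * R) := by
      refine (norm_sub_le _ _).trans ?_
      rw [norm_pow, norm_one]
      have : ‖(t : ℂ) + R * Complex.I‖ ≤ 1 + R := by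
        refine (norm_add_le _ _).trans ?_
        rw [norm_mul, Complex.norm_I, Complex.norm_real, Complex.norm_real, Real.norm_eq_abs, Real.norm_eq_abs,
          abs_of_pos (by linarith : 0 < R), mul_one]
        have := abs_le.mpr ⟨ht.1.le, ht.2⟩
        linarith
      have h0 := norm_nonneg ((t : ℂ) + R * Complex.I)
      nlinarith
    have h2 : ‖(1 : ℂ) - ((t : ℂ) + R * Complex.I) ^ 2‖ ^ b ≤ 2 ^ b * (R ^ 2 + 2 * R) ^ b := by
      rw [← Real.mul_rpow (by norm_num) (by positivity)]
      exact Real.rpow_le_rpow (norm_nonneg _) hn hb.le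
    calc _ ≤ 2 ^ b * (R ^ 2 + 2 * R) ^ b * Real.exp (-(x * R)) := by gcongr
      _ = 2 ^ b * (Real.exp (-(x * R)) * (R ^ 2 + 2 * R) ^ b) := by ring
      _ ≤ 2 ^ b * (C * Real.exp (-(x / 2) * R)) := by gcongr
      _ = _ := by ring
  have L4 := ((Complex.continuous_re.tendsto _).comp L3).add L2
  rw [Complex.zero_re, zero_add] at L4
  refine tendsto_nhds_unique (tendsto_const_nhds.congr' ?_) L4
  filter_upwards [eventually_ge_atTop 0] with R hR
  exact contour_rect hb x hR

lemma G_asymp {b : ℝ} (hb : 0 < b) :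
    Tendsto (fun x : ℝ => ((x ^ (b + 1) : ℝ) : ℂ) * ∫ y in Ioi (0 : ℝ),
        Complex.exp (-(x * y)) * ((y : ℂ) ^ 2 - 2 * Complex.I * y) ^ (b : ℂ)) atTop
      (𝓝 (((2 ^ b * Real.Gamma (b + 1) : ℝ) : ℂ) * Complex.exp (-(π * b / 2) * Complex.I))) := by
  have h1 : Tendsto (fun x : ℝ => ∫ v in Ioi (0 : ℝ),
      Complex.exp (-v) * ((x⁻¹ * v ^ 2 : ℝ) - 2 * Complex.I * (1 * v : ℝ) : ℂ) ^ (b : ℂ)) atTop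
      (𝓝 (∫ v in Ioi (0 : ℝ), Complex.exp (-v) * ((0 * v ^ 2 : ℝ) - 2 * Complex.I * (1 * v : ℝ) : ℂ) ^ (b : ℂ))) := by
    refine MeasureTheory.tendsto_integral_filter_of_dominated_convergence
      (fun y : ℝ => Real.exp (-(1 * y)) * (y ^ 2 + 2 * y) ^ b) ?_ ?_ (poly_exp_integrable b hb one_pos) ?_
    · filter_upwards [eventually_ge_atTop 1] with x hx
      have := continuousOn_univ.mp (gfun_cont hb x⁻¹ 1 (by positivity))
      exact (by fun_prop : Continuous _).aestronglyMeasurable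
    · filter_upwards [eventually_ge_atTop 1] with x hx
      filter_upwards [MeasureTheory.ae_restrict_mem measurableSet_Ioi] with y hy
      rw [norm_mul, Complex.norm_exp]
      have := gfun_norm hb x⁻¹ 1 (by positivity) (by norm_num) (inv_le_one_of_one_le₀ hx) (by norm_num) y (le_of_lt hy)
      simp only [Complex.neg_re, Complex.ofReal_re, one_mul] at this ⊢
      gcongr
    · filter_upwards [MeasureTheory.ae_restrict_mem measurableSet_Ioi] with y hy
      refine Tendsto.const_mul _ ?_
      refine (Complex.continuousAt_cpow_const_of_re_pos (z := ((0 * y ^ 2 : ℝ) - 2 * Complex.I * (1 * y : ℝ) : ℂ)) (w := (b : ℂ)) (Or.inl ?_) (by simpa using hb)).tendsto.comp ?_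
      · simp
      · refine Tendsto.sub_const ?_ _
        refine (Complex.continuous_ofReal.tendsto _).comp ?_
        exact tendsto_inv_atTop_zero.mul_const _
  have h2 : (∫ v in Ioi (0 : ℝ), Complex.exp (-v) * ((0 * v ^ 2 : ℝ) - 2 * Complex.I * (1 * v : ℝ) : ℂ) ^ (b : ℂ)) =
      ((2 ^ b * Real.Gamma (b + 1) : ℝ) : ℂ) * Complex.exp (-(π * b / 2) * Complex.I) := by
    have e : ∀ v ∈ Ioi (0 : ℝ), Complex.exp (-v) * ((0 * v ^ 2 : ℝ) - 2 * Complex.I * (1 * v : ℝ) : ℂ) ^ (b : ℂ) =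
        (2 ^ b : ℝ) * Complex.exp (-(π * b / 2) * Complex.I) * ((Real.exp (-v) * v ^ (b + 1 - 1) : ℝ) : ℂ) := by
      intro v hv
      have hv' : (0 : ℝ) < v := hv
      rw [show ((0 * v ^ 2 : ℝ) - 2 * Complex.I * (1 * v : ℝ) : ℂ) = ((2 * v : ℝ) : ℂ) * (-Complex.I) by
        push_cast; ring, cpow_real_mul_pos (by positivity) _ hb, Real.mul_rpow (by norm_num) hv'.le,
        Complex.cpow_def_of_ne_zero (by simp), Complex.log_neg_I]
      push_cast
      rw [show (-((π : ℂ) / 2) * Complex.I * b) = -(π * b / 2) * Complex.I by ring, add_sub_cancel_right]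
      ring
    rw [MeasureTheory.setIntegral_congr_fun measurableSet_Ioi e, MeasureTheory.integral_const_mul,
      integral_complex_ofReal, ← Real.Gamma_eq_integral (by linarith)]
    push_cast; ring
  rw [h2] at h1
  refine h1.congr' ?_
  filter_upwards [eventually_gt_atTop 0] with x hx
  have h3 := MeasureTheory.integral_comp_mul_left_Ioi (fun v : ℝ => Complex.exp (-v) * ((x⁻¹ * v ^ 2 : ℝ) - 2 * Complex.I * (1 * v : ℝ) : ℂ) ^ (b : ℂ)) 0 hx
  rw [mul_zero] at h3
  have h4 : ∀ y : ℝ, Complex.exp (-(x * y : ℝ)) * ((x⁻¹ * (x * y) ^ 2 : ℝ) - 2 * Complex.I * (1 * (x * y) : ℝ) : ℂ) ^ (b : ℂ)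
      = (x ^ b : ℝ) * (Complex.exp (-(x * y)) * ((y : ℂ) ^ 2 - 2 * Complex.I * y) ^ (b : ℂ)) := by
    intro y
    have hx' : (x : ℂ) ≠ 0 := by exact_mod_cast hx.ne'
    rw [show ((x⁻¹ * (x * y) ^ 2 : ℝ) - 2 * Complex.I * (1 * (x * y) : ℝ) : ℂ) = (x : ℂ) * ((y : ℂ) ^ 2 - 2 * Complex.I * y) by
      push_cast; field_simp, cpow_real_mul_pos hx _ hb]
    push_cast; ring
  simp_rw [h4] at h3
  rw [MeasureTheory.integral_const_mul] at h3
  rw [Real.rpow_add hx, Real.rpow_one]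
  push_cast at h3 ⊢
  rw [mul_comm _ (x : ℂ), mul_assoc, h3]
  have hx' : (x : ℂ) ≠ 0 := by exact_mod_cast hx.ne'
  simp only [Complex.real_smul]
  push_cast
  rw [← mul_assoc, mul_inv_cancel₀ hx', one_mul]

lemma besselJ_asymp_big {ν : ℝ} (hν : 1 / 2 < ν) :
    Tendsto (fun x => √x * besselJ ν x - √(2 / π) * Real.cos (x - ν * π / 2 - π / 4)) atTop (𝓝 0) := by
  have hb : 0 < ν - 1 / 2 := by linarith
  have h := G_asymp hb
  set L := (((2 ^ (ν - 1 / 2) * Real.Gamma (ν - 1 / 2 + 1) : ℝ) : ℂ) * Complex.exp (-(π * (ν - 1 / 2 : ℝ) / 2) * Complex.I)) with hL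
  have hg : 0 < Real.Gamma (ν + 1 / 2) := Real.Gamma_pos_of_pos (by linarith)
  set K : ℝ := 2 * (1 / 2) ^ ν / (√π * Real.Gamma (ν + 1 / 2)) with hK
  have h1 : Tendsto (fun x : ℝ => K * (Complex.exp (Complex.I * x) * (((x ^ (ν - 1 / 2 + 1) : ℝ) : ℂ) * (∫ y in Ioi (0 : ℝ),
        Complex.exp (-(x * y)) * ((y : ℂ) ^ 2 - 2 * Complex.I * y) ^ ((ν - 1 / 2 : ℝ) : ℂ)) - L)).im) atTop (𝓝 0) := by
    have h0 := (tendsto_sub_nhds_zero_iff.mpr h).norm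
    rw [norm_zero] at h0
    have : Tendsto (fun x : ℝ => (Complex.exp (Complex.I * x) * (((x ^ (ν - 1 / 2 + 1) : ℝ) : ℂ) * (∫ y in Ioi (0 : ℝ),
        Complex.exp (-(x * y)) * ((y : ℂ) ^ 2 - 2 * Complex.I * y) ^ ((ν - 1 / 2 : ℝ) : ℂ)) - L)).im) atTop (𝓝 0) := by
      refine squeeze_zero_norm (fun x => ?_) h0
      refine (Complex.abs_im_le_norm _).trans ?_
      rw [norm_mul, mul_comm Complex.I, Complex.norm_exp_ofReal_mul_I, one_mul]
    simpa using this.const_mul K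
  refine h1.congr' ?_
  filter_upwards [eventually_gt_atTop 0] with x hx
  rw [mul_sub, Complex.sub_im, mul_sub]
  congr 1
  · rw [besselJ_poisson hν hx, contour_inf hb hx, mul_left_comm, Complex.im_ofReal_mul,
      show ν - 1 / 2 + 1 = 1 / 2 + ν by ring, Real.rpow_add hx, div_eq_mul_inv x 2, Real.mul_rpow hx.le (by norm_num),
      Real.sqrt_eq_rpow, hK]
    ring
  · have e : Complex.exp (Complex.I * x) * L = ((2 ^ (ν - 1 / 2) * Real.Gamma (ν - 1 / 2 + 1) : ℝ) : ℂ) *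
        Complex.exp (((x - π * (ν - 1 / 2) / 2 : ℝ) : ℂ) * Complex.I) := by
      rw [hL, mul_left_comm, ← Complex.exp_add]
      congr 2
      push_cast; ring
    rw [e, Complex.im_ofReal_mul, Complex.exp_ofReal_mul_I_im, ← mul_assoc]
    congr 1
    · rw [hK, show ν - 1 / 2 + 1 = ν + 1 / 2 by ring, Real.rpow_sub (by norm_num), ← Real.sqrt_eq_rpow,
        Real.sqrt_div (by norm_num), Real.div_rpow (by norm_num) (by norm_num), Real.one_rpow]
      have : (0 : ℝ) < 2 ^ ν := by positivity
      have : 0 < √π := by positivity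
      have : (√2) ^ 2 = 2 := Real.sq_sqrt (by norm_num)
      field_simp
      linarith
    · rw [← Real.cos_sub_pi_div_two]; congr 1; ring

lemma besselJ_asymp_aux (n : ℕ) : ∀ ν : ℝ, 1 / 2 < ν + n →
    Tendsto (fun x => √x * besselJ ν x - √(2 / π) * Real.cos (x - ν * π / 2 - π / 4)) atTop (𝓝 0) := by
  induction n using Nat.strong_induction_on with
  | _ n ih =>
    intro ν hν
    by_cases h : 1 / 2 < ν
    · exact besselJ_asymp_big h
    have hn : 1 ≤ n := by
      rcases Nat.eq_zero_or_pos n with rfl | h'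
      · simp at hν; exact absurd (by linarith) h
      · exact h'
    have h1 := ih (n - 1) (by omega) (ν + 1) (by push_cast [Nat.cast_sub hn]; linarith)
    have h2 := ih (n - 1) (by omega) (ν + 1 + 1) (by push_cast [Nat.cast_sub hn]; linarith)
    have hd : Tendsto (fun x : ℝ => 2 * (ν + 1) / x) atTop (𝓝 0) := tendsto_const_nhds.div_atTop tendsto_id
    have h3 : Tendsto (fun x : ℝ => 2 * (ν + 1) / x * (√(2 / π) * Real.cos (x - (ν + 1) * π / 2 - π / 4))) atTop (𝓝 0) := by
      have := (hd.mul_const (√(2 / π))).norm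
      rw [zero_mul, norm_zero] at this
      refine squeeze_zero_norm (fun x => ?_) this
      rw [← mul_assoc, norm_mul _ (Real.cos _)]
      exact mul_le_of_le_one_right (norm_nonneg _) (Real.abs_cos_le_one _)
    have h4 := ((hd.mul h1).add h3).sub h2
    simp only [mul_zero, add_zero, sub_zero] at h4
    refine h4.congr' ?_
    filter_upwards [eventually_gt_atTop 0] with x hx
    have := besselJ_rec (ν + 1) hx
    rw [add_sub_cancel_right] at this
    have hc : Real.cos (x - (ν + 1 + 1) * π / 2 - π / 4) = - Real.cos (x - ν * π / 2 - π / 4) := by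
      rw [← Real.cos_sub_pi]; congr 1; ring
    rw [hc]
    linear_combination (-√x) * this

lemma besselJ_asymp (ν : ℝ) :
    Tendsto (fun x => √x * besselJ ν x - √(2 / π) * Real.cos (x - ν * π / 2 - π / 4)) atTop (𝓝 0) := by
  obtain ⟨n, hn⟩ := exists_nat_gt (1 / 2 - ν)
  exact besselJ_asymp_aux n ν (by linarith)



lemma const_Ioi {E : Type*} [NormedAddCommGroup E] [NormedSpace ℝ E] {f : ℝ → E}
    (h : ∀ x > 0, HasDerivAt f 0 x) {x y : ℝ} (hx : 0 < x) (hy : 0 < y) : f x = f y := by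
  refine isOpen_Ioi.is_const_of_deriv_eq_zero (s := Ioi (0 : ℝ)) (𝕜 := ℝ) isPreconnected_Ioi
    (fun z hz => (h z hz).differentiableAt.differentiableWithinAt) (fun z hz => (h z hz).deriv) hx hy

lemma const_Ioi_lim {E : Type*} [NormedAddCommGroup E] [NormedSpace ℝ E] {f : ℝ → E} {L : E}
    (h : ∀ x > 0, HasDerivAt f 0 x) (hL : Tendsto f atTop (𝓝 L)) {x : ℝ} (hx : 0 < x) : f x = L := by
  refine tendsto_nhds_unique (tendsto_const_nhds.congr' ?_) hL
  filter_upwards [eventually_gt_atTop 0] with y hy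
  exact const_Ioi h hx hy

/-- non-integer -/
def NI (ν : ℝ) : Prop := ∀ n : ℤ, ν ≠ (n : ℝ)

lemma NI.sin_ne {ν : ℝ} (h : NI ν) : Real.sin (ν * π) ≠ 0 := by
  intro h0
  obtain ⟨n, hn⟩ := Real.sin_eq_zero_iff.mp h0
  exact h n (mul_right_cancel₀ Real.pi_ne_zero hn.symm)

lemma NI.add_one {ν : ℝ} (h : NI ν) : NI (ν + 1) := by
  intro n hn
  apply h (n - 1); push_cast; linarith

instance NI_neBot (ν : ℝ) : (𝓝[{μ : ℝ | ∀ n : ℤ, μ ≠ (n : ℝ)}] ν).NeBot := by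
  have hd : Dense ({μ : ℝ | ∀ n : ℤ, μ ≠ (n : ℝ)}) := by
    have h1 : {μ : ℝ | ∀ n : ℤ, μ ≠ (n : ℝ)} = (range (fun n : ℤ => (n : ℝ)))ᶜ := by
      ext μ; simp [eq_comm]
    rw [h1]
    exact (countable_range _).dense_compl ℝ
  exact mem_closure_iff_nhdsWithin_neBot.mp (hd ν)

lemma besselY_eq {ν : ℝ} (h : NI ν) {x : ℝ} (hx : 0 < x) :
    besselY ν x = (besselJ ν x * Real.cos (ν * π) - besselJ (-ν) x) / Real.sin (ν * π) := by
  refine Tendsto.limUnder_eq ?_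
  have hc := (besselJ_differentiable_order hx).continuous
  have hc2 : Continuous fun μ => besselJ (-μ) x := hc.comp continuous_neg
  have : ContinuousAt (fun μ : ℝ => (besselJ μ x * Real.cos (μ * π) - besselJ (-μ) x) / Real.sin (μ * π)) ν := by
    refine ContinuousAt.div ?_ (by fun_prop) h.sin_ne
    exact (by fun_prop : Continuous _).continuousAt
  exact this.tendsto.mono_left nhdsWithin_le_nhds

lemma besselY_eq1 {ν : ℝ} (h : NI ν) {x : ℝ} (hx : 0 < x) :
    besselY (ν + 1) x = (besselJ (ν + 1) x * Real.cos (ν * π) + besselJ (-ν - 1) x) / Real.sin (ν * π) := by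
  rw [besselY_eq h.add_one hx, add_mul, one_mul, Real.cos_add_pi, Real.sin_add_pi, neg_add', div_neg, ← neg_div]
  congr 1; ring

lemma besselY_eq2 {ν : ℝ} (h : NI ν) {x : ℝ} (hx : 0 < x) :
    besselY (ν + 2) x = (besselJ (ν + 2) x * Real.cos (ν * π) - besselJ (-ν - 2) x) / Real.sin (ν * π) := by
  rw [show ν + 2 = ν + 1 + 1 by ring, besselY_eq1 h.add_one hx, add_mul, one_mul, Real.cos_add_pi, Real.sin_add_pi, div_neg, ← neg_div,
    show -(ν + 1) - 1 = -ν - 2 by ring]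
  congr 1; ring

lemma besselJ_rec2 (ν : ℝ) {x : ℝ} (hx : 0 < x) :
    besselJ ν x + besselJ (ν + 2) x = 2 * (ν + 1) / x * besselJ (ν + 1) x := by
  have := besselJ_rec (ν + 1) hx
  rwa [add_sub_cancel_right, show ν + 1 + 1 = ν + 2 by ring] at this

lemma besselY_rec_NI {ν : ℝ} (h : NI ν) {x : ℝ} (hx : 0 < x) :
    besselY ν x + besselY (ν + 2) x = 2 * (ν + 1) / x * besselY (ν + 1) x := by
  rw [besselY_eq h hx, besselY_eq1 h hx, besselY_eq2 h hx]
  have h1 := besselJ_rec2 ν hx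
  have h2 := besselJ_rec2 (-ν - 2) hx
  rw [show -ν - 2 + 2 = -ν by ring, show -ν - 2 + 1 = -ν - 1 by ring] at h2
  rw [← add_div, ← mul_div_assoc]
  congr 1
  linear_combination (Real.cos (ν * π)) * h1 - h2

lemma besselY_deriv_NI {ν : ℝ} (h : NI ν) {x : ℝ} (hx : 0 < x) :
    HasDerivAt (besselY ν) (ν / x * besselY ν x - besselY (ν + 1) x) x := by
  have h1 := (((besselJ_deriv ν hx).mul_const (Real.cos (ν * π))).sub (besselJ_deriv' (-ν) hx)).div_const (Real.sin (ν * π))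
  have h2 : HasDerivAt (besselY ν) _ x := h1.congr_of_eventuallyEq (by
    filter_upwards [eventually_gt_nhds hx] with y hy
    simpa using besselY_eq h hy)
  convert h2 using 1
  rw [besselY_eq h hx, besselY_eq1 h hx]
  ring

lemma besselY_asymp_NI {ν : ℝ} (h : NI ν) :
    Tendsto (fun x => √x * besselY ν x - √(2 / π) * Real.sin (x - ν * π / 2 - π / 4)) atTop (𝓝 0) := by
  have h1 := (((besselJ_asymp ν).mul_const (Real.cos (ν * π))).sub (besselJ_asymp (-ν))).div_const (Real.sin (ν * π))
  simp only [zero_mul, sub_zero, zero_div] at h1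
  refine h1.congr' ?_
  filter_upwards [eventually_gt_atTop 0] with x hx
  rw [besselY_eq h hx]
  have hc : Real.cos (x - -ν * π / 2 - π / 4) = Real.cos (x - ν * π / 2 - π / 4) * Real.cos (ν * π) -
      Real.sin (x - ν * π / 2 - π / 4) * Real.sin (ν * π) := by
    rw [← Real.cos_add]; congr 1; ring
  rw [hc]
  have := h.sin_ne
  generalize Real.sin (ν * π) = S at *
  generalize Real.cos (x - ν * π / 2 - π / 4) = C1
  generalize Real.sin (x - ν * π / 2 - π / 4) = S1
  generalize √(2 / π) = q
  field_simp
  ring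

lemma asymp_mul {u v α β : ℝ → ℝ} {c : ℝ} (hu : Tendsto (fun x => u x - α x) atTop (𝓝 0))
    (hv : Tendsto (fun x => v x - β x) atTop (𝓝 0)) (hα : ∀ x, |α x| ≤ c) (hβ : ∀ x, |β x| ≤ c) :
    Tendsto (fun x => u x * v x - α x * β x) atTop (𝓝 0) := by
  have h1 : Tendsto (fun x => (u x - α x) * β x) atTop (𝓝 0) := by
    have := (hu.norm.mul_const c); rw [norm_zero, zero_mul] at this
    refine squeeze_zero_norm (fun x => ?_) this
    rw [norm_mul]; gcongr; exact hβ x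
  have h2 : Tendsto (fun x => (v x - β x) * α x) atTop (𝓝 0) := by
    have := (hv.norm.mul_const c); rw [norm_zero, zero_mul] at this
    refine squeeze_zero_norm (fun x => ?_) this
    rw [norm_mul]; gcongr; exact hα x
  have h3 := ((hu.mul hv).add h1).add h2
  simp only [mul_zero, add_zero] at h3
  refine h3.congr fun x => ?_
  ring

lemma wronskian_NI {ν : ℝ} (h : NI ν) {x : ℝ} (hx : 0 < x) :
    besselJ (ν + 1) x * besselY ν x - besselJ ν x * besselY (ν + 1) x = 2 / (π * x) := by
  have hY1 : ∀ x > 0, HasDerivAt (besselY (ν + 1)) (besselY ν x - (ν + 1) / x * besselY (ν + 1) x) x := by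
    intro x hx
    convert besselY_deriv_NI h.add_one hx using 1
    rw [show ν + 1 + 1 = ν + 2 by ring]
    linear_combination besselY_rec_NI h hx
  have hJ1 : ∀ x > 0, HasDerivAt (besselJ (ν + 1)) (besselJ ν x - (ν + 1) / x * besselJ (ν + 1) x) x := by
    intro x hx
    have := besselJ_deriv' (ν + 1) hx
    rwa [add_sub_cancel_right] at this
  have hd : ∀ x > 0, HasDerivAt (fun x => x * (besselJ (ν + 1) x * besselY ν x - besselJ ν x * besselY (ν + 1) x)) 0 x := by
    intro x hx
    have := (hasDerivAt_id x).mul (((hJ1 x hx).mul (besselY_deriv_NI h hx)).sub ((besselJ_deriv ν hx).mul (hY1 x hx)))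
    refine this.congr_deriv ?_
    simp only [id, Pi.sub_apply, Pi.mul_apply]
    field_simp
    ring
  have hl : Tendsto (fun x => x * (besselJ (ν + 1) x * besselY ν x - besselJ ν x * besselY (ν + 1) x)) atTop (𝓝 (2 / π)) := by
    have bc : ∀ x : ℝ, |√(2 / π) * Real.cos x| ≤ √(2 / π) := fun x => by
      rw [abs_mul, abs_of_nonneg (Real.sqrt_nonneg _)]
      exact mul_le_of_le_one_right (Real.sqrt_nonneg _) (Real.abs_cos_le_one _)
    have bs : ∀ x : ℝ, |√(2 / π) * Real.sin x| ≤ √(2 / π) := fun x => by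
      rw [abs_mul, abs_of_nonneg (Real.sqrt_nonneg _)]
      exact mul_le_of_le_one_right (Real.sqrt_nonneg _) (Real.abs_sin_le_one _)
    have h1 := asymp_mul (besselJ_asymp (ν + 1)) (besselY_asymp_NI h) (fun x => bc _) (fun x => bs _)
    have h2 := asymp_mul (besselJ_asymp ν) (besselY_asymp_NI h.add_one) (fun x => bc _) (fun x => bs _)
    have h3 := (h1.sub h2).add_const (2 / π)
    simp only [sub_zero, zero_add] at h3
    refine h3.congr' ?_
    filter_upwards [eventually_gt_atTop 0] with x hx
    have e : x - (ν + 1) * π / 2 - π / 4 = (x - ν * π / 2 - π / 4) - π / 2 := by ring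
    rw [e, Real.cos_sub_pi_div_two, Real.sin_sub_pi_div_two]
    have s1 := Real.sin_sq_add_cos_sq (x - ν * π / 2 - π / 4)
    have s2 : √(2 / π) ^ 2 = 2 / π := Real.sq_sqrt (by positivity)
    have s3 : √x ^ 2 = x := Real.sq_sqrt hx.le
    linear_combination (besselJ (ν + 1) x * besselY ν x - besselJ ν x * besselY (ν + 1) x) * s3 - (2 / π) * s1 -
      (Real.sin (x - ν * π / 2 - π / 4) ^ 2 + Real.cos (x - ν * π / 2 - π / 4) ^ 2) * s2
  have := const_Ioi_lim hd hl hx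
  field_simp
  field_simp at this
  linarith



/-- phase -/
noncomputable def ph (p : ℝ × ℝ) : ℝ := 2 * Real.sinh p.1 * Real.cosh p.2

/-- product of the two restricted Lebesgue measures -/
noncomputable def muN : MeasureTheory.Measure (ℝ × ℝ) :=
  ((MeasureTheory.volume : MeasureTheory.Measure ℝ).restrict (Ioi 0)).prod
    ((MeasureTheory.volume : MeasureTheory.Measure ℝ).restrict (Ioi 0))

@[fun_prop] lemma ph_cont : Continuous ph := by unfold ph; fun_prop

lemma muN_ae : ∀ᵐ p ∂muN, 0 < p.1 ∧ 0 < p.2 := by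
  unfold muN
  rw [MeasureTheory.Measure.prod_restrict]
  filter_upwards [MeasureTheory.ae_restrict_mem (measurableSet_Ioi.prod measurableSet_Ioi)] with p hp
  exact hp

lemma ph_pos {p : ℝ × ℝ} (h : 0 < p.1 ∧ 0 < p.2) : 0 < ph p := by
  unfold ph
  have := Real.sinh_pos_iff.mpr h.1
  have := Real.cosh_pos p.2
  positivity

lemma sinh_ge_sq {t : ℝ} (ht : 0 ≤ t) : t ^ 2 / 4 ≤ Real.sinh t := by
  rw [Real.sinh_eq]
  have h1 := Real.quadratic_le_exp_of_nonneg ht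
  have h2 : Real.exp (-t) ≤ 1 := Real.exp_le_one_iff.mpr (by linarith)
  nlinarith

lemma base_bound {x : ℝ} (hx : 0 < x) (a : ℝ) {p : ℝ × ℝ} (h : 0 < p.1 ∧ 0 < p.2) :
    Real.exp (a * p.1) * Real.exp (-(x * ph p)) ≤
      (x ^ (-(1 / 2) : ℝ) * Real.exp ((|a| + 1) ^ 2 / x * 2)) *
      ((Real.exp (-p.1) * p.1 ^ ((1 / 2 : ℝ) - 1)) * Real.exp (-(1 / 2) * p.2)) := by
  obtain ⟨t, w⟩ := p
  simp only at h ⊢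
  obtain ⟨ht, hw⟩ := h
  have hs : t ≤ Real.sinh t := Real.self_le_sinh_iff.mpr ht.le
  have hs2 := sinh_ge_sq ht.le
  have hc1 := Real.one_le_cosh w
  have hc : Real.exp w / 2 ≤ Real.cosh w := by
    rw [Real.cosh_eq]; have := Real.exp_pos (-w); linarith
  have hphi : ph (t, w) = Real.sinh t * Real.cosh w + Real.sinh t * Real.cosh w := by
    simp only [ph]; ring
  have hs0 : 0 < Real.sinh t := by linarith
  -- first factor
  have h1 : Real.exp (-(x * (Real.sinh t * Real.cosh w))) ≤ x ^ (-(1 / 2) : ℝ) * t ^ ((1 / 2 : ℝ) - 1) * Real.exp (-(1 / 2) * w) := by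
    have hu : x * t * Real.exp w ≤ 2 * (x * (Real.sinh t * Real.cosh w)) := by
      have : t * (Real.exp w / 2) ≤ Real.sinh t * Real.cosh w := by gcongr
      nlinarith
    have h2 : x * t * Real.exp w ≤ Real.exp (2 * (x * (Real.sinh t * Real.cosh w))) := by
      have := Real.add_one_le_exp (2 * (x * (Real.sinh t * Real.cosh w)))
      linarith
    have h3 := Real.rpow_le_rpow_of_nonpos (z := -(1 / 2 : ℝ)) (by positivity) h2 (by norm_num)
    rw [← Real.exp_mul, Real.mul_rpow (by positivity) (by positivity), Real.mul_rpow hx.le ht.le, ← Real.exp_mul] at h3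
    calc _ = Real.exp (2 * (x * (Real.sinh t * Real.cosh w)) * -(1 / 2)) := by congr 1; ring
      _ ≤ _ := h3
      _ = _ := by norm_num; left; ring_nf
  have h2 : Real.exp (a * t) * Real.exp (-(x * (Real.sinh t * Real.cosh w))) ≤
      Real.exp ((|a| + 1) ^ 2 / x * 2) * Real.exp (-t) := by
    rw [← Real.exp_add, ← Real.exp_add]
    apply Real.exp_le_exp.mpr
    have k1 : x * (t ^ 2 / 4) ≤ x * (Real.sinh t * Real.cosh w) := by
      gcongr
      nlinarith
    have k2 : a * t ≤ |a| * t := by gcongr; exact le_abs_self a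
    have k3 : (|a| + 1) * t ≤ (|a| + 1) ^ 2 / x * 2 + x * (t ^ 2 / 4) := by
      have e : (|a| + 1) ^ 2 / x * 2 + x * (t ^ 2 / 4) - (|a| + 1) * t =
        (((|a| + 1) - x * t / 2) ^ 2 + (|a| + 1) ^ 2) / x := by field_simp; ring
      have : 0 ≤ (((|a| + 1) - x * t / 2) ^ 2 + (|a| + 1) ^ 2) / x := by positivity
      linarith
    linarith
  calc Real.exp (a * t) * Real.exp (-(x * ph (t, w)))
      = (Real.exp (a * t) * Real.exp (-(x * (Real.sinh t * Real.cosh w)))) * Real.exp (-(x * (Real.sinh t * Real.cosh w))) := by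
        simp only [hphi, ← Real.exp_add]; congr 1; ring
    _ ≤ (Real.exp ((|a| + 1) ^ 2 / x * 2) * Real.exp (-t)) * (x ^ (-(1 / 2) : ℝ) * t ^ ((1 / 2 : ℝ) - 1) * Real.exp (-(1 / 2) * w)) := by
        gcongr
    _ = _ := by ring

lemma base_integrable {x : ℝ} (hx : 0 < x) (a : ℝ) :
    MeasureTheory.Integrable (fun p : ℝ × ℝ => Real.exp (a * p.1) * Real.exp (-(x * ph p))) muN := by
  have h1 : MeasureTheory.Integrable (fun p : ℝ × ℝ => (Real.exp (-p.1) * p.1 ^ ((1 / 2 : ℝ) - 1)) * Real.exp (-(1 / 2) * p.2)) muN := by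
    refine MeasureTheory.Integrable.mul_prod (f := fun t : ℝ => Real.exp (-t) * t ^ ((1 / 2 : ℝ) - 1)) (g := fun w : ℝ => Real.exp (-(1 / 2) * w)) ?_ ?_
    · exact Real.GammaIntegral_convergent (by norm_num)
    · exact integrableOn_exp_mul_Ioi (by norm_num) 0
  refine (h1.const_mul (x ^ (-(1 / 2) : ℝ) * Real.exp ((|a| + 1) ^ 2 / x * 2))).mono' ?_ ?_
  · exact (by fun_prop : Continuous _).aestronglyMeasurable
  · filter_upwards [muN_ae] with p hp
    rw [Real.norm_eq_abs, abs_of_pos (by positivity)]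
    exact base_bound hx a hp

lemma pow_exp_bound {x : ℝ} (hx : 0 < x) (n : ℕ) {y : ℝ} (hy : 0 ≤ y) :
    y ^ n * Real.exp (-(x * y)) ≤ n.factorial * (2 / x) ^ n * Real.exp (-(x / 2 * y)) := by
  have h := Real.pow_div_factorial_le_exp (x / 2 * y) (by positivity) n
  have hf : (0 : ℝ) < n.factorial := by positivity
  rw [div_le_iff₀ hf, mul_pow] at h
  have e : y ^ n = (2 / x) ^ n * ((x / 2) ^ n * y ^ n) := by
    rw [← mul_assoc, ← mul_pow]; field_simp; simp
  calc y ^ n * Real.exp (-(x * y)) = (2 / x) ^ n * ((x / 2) ^ n * y ^ n) * Real.exp (-(x * y)) := by rw [← e]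
    _ ≤ (2 / x) ^ n * (Real.exp (x / 2 * y) * n.factorial) * Real.exp (-(x * y)) := by gcongr
    _ = n.factorial * (2 / x) ^ n * (Real.exp (x / 2 * y) * Real.exp (-(x * y))) := by ring
    _ = _ := by rw [← Real.exp_add]; congr 2; ring

lemma pow_integrable {x : ℝ} (hx : 0 < x) (a : ℝ) (n : ℕ) :
    MeasureTheory.Integrable (fun p : ℝ × ℝ => ph p ^ n * Real.exp (a * p.1) * Real.exp (-(x * ph p))) muN := by
  refine ((base_integrable (half_pos hx) a).const_mul (n.factorial * (2 / x) ^ n)).mono' ?_ ?_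
  · exact (by fun_prop : Continuous _).aestronglyMeasurable
  · filter_upwards [muN_ae] with p hp
    have := ph_pos hp
    rw [Real.norm_eq_abs, abs_of_pos (by positivity)]
    have := pow_exp_bound hx n this.le
    calc _ = Real.exp (a * p.1) * (ph p ^ n * Real.exp (-(x * ph p))) := by ring
      _ ≤ Real.exp (a * p.1) * (n.factorial * (2 / x) ^ n * Real.exp (-(x / 2 * ph p))) := by gcongr
      _ = _ := by ring

/-- general integrability criterion -/
lemma dom_integrable {x : ℝ} (hx : 0 < x) (a K : ℝ) {f : ℝ × ℝ → ℝ} (hf : Continuous f)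
    (hb : ∀ p : ℝ × ℝ, 0 < p.1 ∧ 0 < p.2 → |f p| ≤ K * ((1 + ph p ^ 3) * Real.exp (a * p.1) * Real.exp (-(x * ph p)))) :
    MeasureTheory.Integrable f muN := by
  have h1 := ((pow_integrable hx a 0).add (pow_integrable hx a 3)).const_mul K
  refine h1.mono' hf.aestronglyMeasurable ?_
  filter_upwards [muN_ae] with p hp
  rw [Real.norm_eq_abs]
  refine (hb p hp).trans (le_of_eq ?_)
  simp only [Pi.add_apply]; ring

lemma cosh_le_exp_abs (ν : ℝ) {t : ℝ} (ht : 0 < t) : Real.cosh (2 * ν * t) ≤ Real.exp (2 * |ν| * t) := by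
  rw [← Real.cosh_abs, abs_mul, abs_mul, abs_of_pos ht, abs_of_pos (by norm_num : (0 : ℝ) < 2)]
  rw [Real.cosh_eq]
  have : Real.exp (-(2 * |ν| * t)) ≤ Real.exp (2 * |ν| * t) := by
    apply Real.exp_le_exp.mpr
    have : 0 ≤ 2 * |ν| * t := by positivity
    linarith
  linarith

/-- moments of the Nicholson integrand -/
noncomputable def nicF (n : ℕ) (ν x : ℝ) : ℝ :=
  ∫ p, (-ph p) ^ n * Real.exp (-(x * ph p)) * Real.cosh (2 * ν * p.1) ∂muN

lemma nic_integrable (n : ℕ) (ν : ℝ) {x : ℝ} (hx : 0 < x) :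
    MeasureTheory.Integrable (fun p : ℝ × ℝ => (-ph p) ^ n * Real.exp (-(x * ph p)) * Real.cosh (2 * ν * p.1)) muN := by
  refine (pow_integrable hx (2 * |ν|) n).mono' ?_ ?_
  · exact (by fun_prop : Continuous _).aestronglyMeasurable
  · filter_upwards [muN_ae] with p hp
    have := ph_pos hp
    rw [norm_mul, norm_mul, norm_pow, norm_neg]
    simp only [Real.norm_eq_abs]
    rw [abs_of_pos this, abs_of_pos (Real.exp_pos _), abs_of_pos (Real.cosh_pos _)]
    have := cosh_le_exp_abs ν hp.1
    calc _ ≤ ph p ^ n * Real.exp (-(x * ph p)) * Real.exp (2 * |ν| * p.1) := by gcongr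
      _ = _ := by ring

lemma nicF_deriv (n : ℕ) (ν : ℝ) {x : ℝ} (hx : 0 < x) :
    HasDerivAt (nicF n ν) (nicF (n + 1) ν x) x := by
  have h := hasDerivAt_integral_of_dominated_loc_of_deriv_le (μ := muN) (𝕜 := ℝ)
    (F := fun (x : ℝ) (p : ℝ × ℝ) => (-ph p) ^ n * Real.exp (-(x * ph p)) * Real.cosh (2 * ν * p.1))
    (F' := fun (x : ℝ) (p : ℝ × ℝ) => (-ph p) ^ (n + 1) * Real.exp (-(x * ph p)) * Real.cosh (2 * ν * p.1))
    (x₀ := x) (s := Metric.ball x (x / 2))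
    (bound := fun p => ph p ^ (n + 1) * Real.exp (2 * |ν| * p.1) * Real.exp (-(x / 2 * ph p)))
    (Metric.ball_mem_nhds x (half_pos hx)) ?_ (nic_integrable n ν hx) ?_ ?_ (pow_integrable (half_pos hx) _ _) ?_
  · exact h.2
  · filter_upwards with y
    exact (by fun_prop : Continuous _).aestronglyMeasurable
  · exact (by fun_prop : Continuous _).aestronglyMeasurable
  · filter_upwards [muN_ae] with p hp y hy
    have := ph_pos hp
    rw [norm_mul, norm_mul, norm_pow, norm_neg]
    simp only [Real.norm_eq_abs]
    rw [abs_of_pos this, abs_of_pos (Real.exp_pos _), abs_of_pos (Real.cosh_pos _)]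
    have h1 := cosh_le_exp_abs ν hp.1
    have h2 : x / 2 ≤ y := by
      rw [Metric.mem_ball, Real.dist_eq, abs_lt] at hy; linarith
    calc _ ≤ ph p ^ (n + 1) * Real.exp (-(x / 2 * ph p)) * Real.exp (2 * |ν| * p.1) := by gcongr
      _ = _ := by ring
  · filter_upwards with p y hy
    have := ((((hasDerivAt_id y).mul_const (ph p)).neg.exp).const_mul ((-ph p) ^ n)).mul_const (Real.cosh (2 * ν * p.1))
    refine this.congr_deriv ?_
    simp only [id, Pi.neg_apply]
    ring



lemma parts_t {F F' : ℝ × ℝ → ℝ} (hF : MeasureTheory.Integrable F muN) (hF' : MeasureTheory.Integrable F' muN)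
    (hd : ∀ t w, HasDerivAt (fun t => F (t, w)) (F' (t, w)) t) (h0 : ∀ w, F (0, w) = 0) : ∫ p, F' p ∂muN = 0 := by
  unfold muN at *
  rw [MeasureTheory.integral_prod_symm _ hF']
  refine MeasureTheory.integral_eq_zero_of_ae ?_
  filter_upwards [hF.prod_left_ae, hF'.prod_left_ae] with w h1 h2
  have h3 := MeasureTheory.tendsto_zero_of_hasDerivAt_of_integrableOn_Ioi (a := 0) (fun t _ => hd t w) h2 h1
  have := MeasureTheory.integral_Ioi_of_hasDerivAt_of_tendsto (a := 0) (hd 0 w).continuousAt.continuousWithinAt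
    (fun t _ => hd t w) h2 h3
  simpa [h0] using this

lemma parts_w {F F' : ℝ × ℝ → ℝ} (hF : MeasureTheory.Integrable F muN) (hF' : MeasureTheory.Integrable F' muN)
    (hd : ∀ t w, HasDerivAt (fun w => F (t, w)) (F' (t, w)) w) (h0 : ∀ t, F (t, 0) = 0) : ∫ p, F' p ∂muN = 0 := by
  unfold muN at *
  rw [MeasureTheory.integral_prod _ hF']
  refine MeasureTheory.integral_eq_zero_of_ae ?_
  filter_upwards [hF.prod_right_ae, hF'.prod_right_ae] with t h1 h2
  have h3 := MeasureTheory.tendsto_zero_of_hasDerivAt_of_integrableOn_Ioi (a := 0) (fun w _ => hd t w) h2 h1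
  have := MeasureTheory.integral_Ioi_of_hasDerivAt_of_tendsto (a := 0) (hd t 0).continuousAt.continuousWithinAt
    (fun w _ => hd t w) h2 h3
  simpa [h0] using this

lemma cosh_le_exp' {t : ℝ} (ht : 0 ≤ t) : Real.cosh t ≤ Real.exp t := by
  rw [Real.cosh_eq]
  have : Real.exp (-t) ≤ Real.exp t := Real.exp_le_exp.mpr (by linarith)
  linarith

lemma sinh_le_mul_exp {u : ℝ} (hu : 0 ≤ u) : Real.sinh u ≤ u * Real.exp u := by
  have h1 : Real.sinh u = Real.exp u * (1 - Real.exp (-(2 * u))) / 2 := by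
    rw [Real.sinh_eq, mul_sub, ← Real.exp_add, mul_one]; congr 3; ring
  have h2 := Real.add_one_le_exp (-(2 * u))
  have h3 := Real.exp_pos u
  rw [h1]; nlinarith

/-- integrability of monomials -/
lemma mono_integrable {x ν : ℝ} (hx : 0 < x) (hν : 0 ≤ ν) (K : ℝ) {f : ℝ × ℝ → ℝ} (hf : Continuous f)
    (hb : ∀ t w s c S C h g T Q : ℝ, s = Real.sinh t → c = Real.cosh t → S = Real.sinh w → C = Real.cosh w →
      h = Real.cosh (2 * ν * t) → g = Real.sinh (2 * ν * t) →
      0 < s → 0 < c → 0 < S → 0 < C → 0 < h → 0 ≤ g → s ≤ T → c ≤ T → 1 ≤ T → S ≤ C → h ≤ Q → g ≤ Q → 1 ≤ Q →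
      g ≤ 2 * ν * s * Q → |f (t, w)| ≤ K * ((1 + (2 * s * C) ^ 3) * (T ^ 2 * Q))) :
    MeasureTheory.Integrable (fun p => f p * Real.exp (-(x * ph p))) muN := by
  refine dom_integrable hx (2 * ν + 2) K (by fun_prop) ?_
  rintro ⟨t, w⟩ ⟨ht, hw⟩
  simp only at ht hw
  have u0 : 0 ≤ 2 * ν * t := by positivity
  have hT : Real.sinh t ≤ Real.exp t := by
    rw [← Real.sinh_add_cosh]; have := Real.cosh_pos t; linarith
  have hg : Real.sinh (2 * ν * t) ≤ Real.exp (2 * ν * t) := by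
    rw [← Real.sinh_add_cosh]; have := Real.cosh_pos (2 * ν * t); linarith
  have := hb t w _ _ _ _ _ _ (Real.exp t) (Real.exp (2 * ν * t)) rfl rfl rfl rfl rfl rfl
    (Real.sinh_pos_iff.mpr ht) (Real.cosh_pos _) (Real.sinh_pos_iff.mpr hw) (Real.cosh_pos _) (Real.cosh_pos _)
    (Real.sinh_nonneg_iff.mpr u0) hT (cosh_le_exp' ht.le) (Real.one_le_exp ht.le) (Real.sinh_lt_cosh w).le
    (cosh_le_exp' u0) hg (Real.one_le_exp u0) (by
      refine (sinh_le_mul_exp u0).trans ?_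
      gcongr
      exact Real.self_le_sinh_iff.mpr ht.le)
  rw [abs_mul, abs_of_pos (Real.exp_pos _)]
  have e : Real.exp ((2 * ν + 2) * t) = Real.exp t ^ 2 * Real.exp (2 * ν * t) := by
    rw [← Real.exp_nat_mul, ← Real.exp_add]; congr 1; push_cast; ring
  have e2 : ph (t, w) = 2 * Real.sinh t * Real.cosh w := rfl
  rw [show Real.exp ((2 * ν + 2) * (t, w).1) = _ from e, e2]
  calc _ ≤ _ := mul_le_mul_of_nonneg_right this (Real.exp_pos _).le
    _ = _ := by ring

lemma pow1 {y : ℝ} (hy : 0 ≤ y) : y ≤ 1 + y ^ 3 := by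
  nlinarith [sq_nonneg (y - 1), mul_nonneg hy (sq_nonneg (y - 1))]
lemma pow2 {y : ℝ} (hy : 0 ≤ y) : y ^ 2 ≤ 1 + y ^ 3 := by
  nlinarith [sq_nonneg (y - 1), mul_nonneg hy (sq_nonneg (y - 1))]

/-- final bound helper: i = 0 -/
lemma fb0 {y B k T Q : ℝ} (hy : 0 ≤ y) (hB : 0 ≤ B) (hk : 0 ≤ k) (h : B ≤ k * (T ^ 2 * Q)) (hTQ : 0 ≤ T ^ 2 * Q) :
    |B| ≤ k * ((1 + y ^ 3) * (T ^ 2 * Q)) := by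
  rw [abs_of_nonneg hB]
  refine h.trans ?_
  have : 0 ≤ y ^ 3 := by positivity
  refine mul_le_mul_of_nonneg_left ?_ hk
  nlinarith

lemma fb1 {y B k T Q : ℝ} (hy : 0 ≤ y) (hB : 0 ≤ B) (hk : 0 ≤ k) (h : B ≤ k * (y * (T ^ 2 * Q))) (hTQ : 0 ≤ T ^ 2 * Q) :
    |B| ≤ k * ((1 + y ^ 3) * (T ^ 2 * Q)) := by
  rw [abs_of_nonneg hB]
  refine h.trans ?_
  gcongr
  exact pow1 hy

lemma fb2 {y B k T Q : ℝ} (hy : 0 ≤ y) (hB : 0 ≤ B) (hk : 0 ≤ k) (h : B ≤ k * (y ^ 2 * (T ^ 2 * Q))) (hTQ : 0 ≤ T ^ 2 * Q) :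
    |B| ≤ k * ((1 + y ^ 3) * (T ^ 2 * Q)) := by
  rw [abs_of_nonneg hB]
  refine h.trans ?_
  gcongr
  exact pow2 hy

lemma fb3 {y B k T Q : ℝ} (hy : 0 ≤ y) (hB : 0 ≤ B) (hk : 0 ≤ k) (h : B ≤ k * (y ^ 3 * (T ^ 2 * Q))) (hTQ : 0 ≤ T ^ 2 * Q) :
    |B| ≤ k * ((1 + y ^ 3) * (T ^ 2 * Q)) := by
  rw [abs_of_nonneg hB]
  refine h.trans ?_
  gcongr
  linarith

lemma im0 {x ν : ℝ} (hx : 0 < x) (hν : 0 ≤ ν) : MeasureTheory.Integrable (fun p : ℝ × ℝ => ((Real.cosh p.1 ^ 2 + Real.sinh p.1 ^ 2) * Real.cosh (2 * ν * p.1)) * Real.exp (-(x * ph p))) muN := by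
  refine mono_integrable hx hν 2 (by fun_prop) ?_
  rintro t w s c S C h g T Q rfl rfl rfl rfl rfl rfl h1 h2 h3 h4 h5 h6 h7 h8 h9 h10 h11 h12 h13 h14
  refine fb0 (by positivity) (by positivity) (by norm_num) ?_ (by positivity)
  calc _ ≤ (T ^ 2 + T ^ 2) * Q := by gcongr
    _ = _ := by ring

lemma im1 {x ν : ℝ} (hx : 0 < x) (hν : 0 ≤ ν) : MeasureTheory.Integrable (fun p : ℝ × ℝ => (Real.sinh p.1 * Real.cosh p.1 * Real.sinh (2 * ν * p.1)) * Real.exp (-(x * ph p))) muN := by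
  refine mono_integrable hx hν 1 (by fun_prop) ?_
  rintro t w s c S C h g T Q rfl rfl rfl rfl rfl rfl h1 h2 h3 h4 h5 h6 h7 h8 h9 h10 h11 h12 h13 h14
  refine fb0 (by positivity) (by positivity) (by norm_num) ?_ (by positivity)
  calc _ ≤ T * T * Q := by gcongr
    _ = _ := by ring

lemma im2 {x ν : ℝ} (hx : 0 < x) (hν : 0 ≤ ν) : MeasureTheory.Integrable (fun p : ℝ × ℝ => (Real.sinh p.1 * Real.cosh p.2 * Real.cosh p.1 ^ 2 * Real.cosh (2 * ν * p.1)) * Real.exp (-(x * ph p))) muN := by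
  refine mono_integrable hx hν (1 / 2) (by fun_prop) ?_
  rintro t w s c S C h g T Q rfl rfl rfl rfl rfl rfl h1 h2 h3 h4 h5 h6 h7 h8 h9 h10 h11 h12 h13 h14
  refine fb1 (by positivity) (by positivity) (by norm_num) ?_ (by positivity)
  calc _ ≤ Real.sinh t * Real.cosh w * T ^ 2 * Q := by simp only; gcongr
    _ = _ := by ring

lemma im3 {x ν : ℝ} (hx : 0 < x) (hν : 0 ≤ ν) : MeasureTheory.Integrable (fun p : ℝ × ℝ => (Real.cosh p.1 * Real.cosh p.2 * Real.sinh (2 * ν * p.1)) * Real.exp (-(x * ph p))) muN := by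
  refine mono_integrable hx hν ν (by fun_prop) ?_
  rintro t w s c S C h g T Q rfl rfl rfl rfl rfl rfl h1 h2 h3 h4 h5 h6 h7 h8 h9 h10 h11 h12 h13 h14
  refine fb1 (by positivity) (by positivity) hν ?_ (by positivity)
  calc _ ≤ T * Real.cosh w * (2 * ν * Real.sinh t * Q) := by simp only; gcongr
    _ = ν * (2 * Real.sinh t * Real.cosh w * (T ^ 1 * Q)) := by ring
    _ ≤ _ := by gcongr; norm_num

lemma im4 {x ν : ℝ} (hx : 0 < x) (hν : 0 ≤ ν) : MeasureTheory.Integrable (fun p : ℝ × ℝ => (Real.sinh p.1 * Real.cosh p.2 * Real.cosh (2 * ν * p.1)) * Real.exp (-(x * ph p))) muN := by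
  refine mono_integrable hx hν (1 / 2) (by fun_prop) ?_
  rintro t w s c S C h g T Q rfl rfl rfl rfl rfl rfl h1 h2 h3 h4 h5 h6 h7 h8 h9 h10 h11 h12 h13 h14
  refine fb1 (by positivity) (by positivity) (by norm_num) ?_ (by positivity)
  calc _ ≤ Real.sinh t * Real.cosh w * Q := by simp only; gcongr
    _ = 1 / 2 * (2 * Real.sinh t * Real.cosh w * (1 ^ 2 * Q)) := by ring
    _ ≤ _ := by gcongr

lemma im5 {x ν : ℝ} (hx : 0 < x) (hν : 0 ≤ ν) : MeasureTheory.Integrable (fun p : ℝ × ℝ => (Real.sinh p.1 * Real.cosh p.1 * Real.cosh p.2 ^ 2 * Real.sinh (2 * ν * p.1)) * Real.exp (-(x * ph p))) muN := by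
  refine mono_integrable hx hν (ν / 2) (by fun_prop) ?_
  rintro t w s c S C h g T Q rfl rfl rfl rfl rfl rfl h1 h2 h3 h4 h5 h6 h7 h8 h9 h10 h11 h12 h13 h14
  refine fb2 (by positivity) (by positivity) (by positivity) ?_ (by positivity)
  calc _ ≤ Real.sinh t * T * Real.cosh w ^ 2 * (2 * ν * Real.sinh t * Q) := by simp only; gcongr
    _ = ν / 2 * ((2 * Real.sinh t * Real.cosh w) ^ 2 * (T ^ 1 * Q)) := by ring
    _ ≤ _ := by gcongr; norm_num

lemma im6 {x ν : ℝ} (hx : 0 < x) (hν : 0 ≤ ν) : MeasureTheory.Integrable (fun p : ℝ × ℝ => (Real.sinh p.1 ^ 2 * Real.cosh p.2 ^ 2 * Real.cosh (2 * ν * p.1)) * Real.exp (-(x * ph p))) muN := by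
  refine mono_integrable hx hν (1 / 4) (by fun_prop) ?_
  rintro t w s c S C h g T Q rfl rfl rfl rfl rfl rfl h1 h2 h3 h4 h5 h6 h7 h8 h9 h10 h11 h12 h13 h14
  refine fb2 (by positivity) (by positivity) (by positivity) ?_ (by positivity)
  calc _ ≤ Real.sinh t ^ 2 * Real.cosh w ^ 2 * Q := by simp only; gcongr
    _ = 1 / 4 * ((2 * Real.sinh t * Real.cosh w) ^ 2 * (1 ^ 2 * Q)) := by ring
    _ ≤ _ := by gcongr

lemma im7 {x ν : ℝ} (hx : 0 < x) (hν : 0 ≤ ν) : MeasureTheory.Integrable (fun p : ℝ × ℝ => (Real.sinh p.1 ^ 2 * Real.sinh p.2 ^ 2 * Real.cosh (2 * ν * p.1)) * Real.exp (-(x * ph p))) muN := by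
  refine mono_integrable hx hν (1 / 4) (by fun_prop) ?_
  rintro t w s c S C h g T Q rfl rfl rfl rfl rfl rfl h1 h2 h3 h4 h5 h6 h7 h8 h9 h10 h11 h12 h13 h14
  refine fb2 (by positivity) (by positivity) (by positivity) ?_ (by positivity)
  calc _ ≤ Real.sinh t ^ 2 * Real.cosh w ^ 2 * Q := by simp only; gcongr
    _ = 1 / 4 * ((2 * Real.sinh t * Real.cosh w) ^ 2 * (1 ^ 2 * Q)) := by ring
    _ ≤ _ := by gcongr

lemma im8 {x ν : ℝ} (hx : 0 < x) (hν : 0 ≤ ν) : MeasureTheory.Integrable (fun p : ℝ × ℝ => (Real.sinh p.1 ^ 3 * (Real.sinh p.2 ^ 2 * Real.cosh p.2) * Real.cosh (2 * ν * p.1)) * Real.exp (-(x * ph p))) muN := by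
  refine mono_integrable hx hν (1 / 8) (by fun_prop) ?_
  rintro t w s c S C h g T Q rfl rfl rfl rfl rfl rfl h1 h2 h3 h4 h5 h6 h7 h8 h9 h10 h11 h12 h13 h14
  refine fb3 (by positivity) (by positivity) (by positivity) ?_ (by positivity)
  calc _ ≤ Real.sinh t ^ 3 * (Real.cosh w ^ 2 * Real.cosh w) * Q := by simp only; gcongr
    _ = 1 / 8 * ((2 * Real.sinh t * Real.cosh w) ^ 3 * (1 ^ 2 * Q)) := by ring
    _ ≤ _ := by gcongr

lemma im9 {x ν : ℝ} (hx : 0 < x) (hν : 0 ≤ ν) : MeasureTheory.Integrable (fun p : ℝ × ℝ => (Real.sinh p.1 * Real.cosh p.1 * Real.sinh p.2 ^ 2 * Real.sinh (2 * ν * p.1)) * Real.exp (-(x * ph p))) muN := by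
  refine mono_integrable hx hν (ν / 2) (by fun_prop) ?_
  rintro t w s c S C h g T Q rfl rfl rfl rfl rfl rfl h1 h2 h3 h4 h5 h6 h7 h8 h9 h10 h11 h12 h13 h14
  refine fb2 (by positivity) (by positivity) (by positivity) ?_ (by positivity)
  calc _ ≤ Real.sinh t * T * Real.cosh w ^ 2 * (2 * ν * Real.sinh t * Q) := by simp only; gcongr
    _ = ν / 2 * ((2 * Real.sinh t * Real.cosh w) ^ 2 * (T ^ 1 * Q)) := by ring
    _ ≤ _ := by gcongr; norm_num

lemma im10 {x ν : ℝ} (hx : 0 < x) (hν : 0 ≤ ν) : MeasureTheory.Integrable (fun p : ℝ × ℝ => (Real.sinh p.1 * Real.cosh p.1 * Real.cosh (2 * ν * p.1)) * Real.exp (-(x * ph p))) muN := by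
  refine mono_integrable hx hν 1 (by fun_prop) ?_
  rintro t w s c S C h g T Q rfl rfl rfl rfl rfl rfl h1 h2 h3 h4 h5 h6 h7 h8 h9 h10 h11 h12 h13 h14
  refine fb0 (by positivity) (by positivity) (by norm_num) ?_ (by positivity)
  calc _ ≤ T * T * Q := by gcongr
    _ = _ := by ring

lemma im11 {x ν : ℝ} (hx : 0 < x) (hν : 0 ≤ ν) : MeasureTheory.Integrable (fun p : ℝ × ℝ => (Real.sinh p.1 * Real.cosh p.2 * Real.sinh (2 * ν * p.1)) * Real.exp (-(x * ph p))) muN := by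
  refine mono_integrable hx hν (1 / 2) (by fun_prop) ?_
  rintro t w s c S C h g T Q rfl rfl rfl rfl rfl rfl h1 h2 h3 h4 h5 h6 h7 h8 h9 h10 h11 h12 h13 h14
  refine fb1 (by positivity) (by positivity) (by norm_num) ?_ (by positivity)
  calc _ ≤ Real.sinh t * Real.cosh w * Q := by simp only; gcongr
    _ = 1 / 2 * (2 * Real.sinh t * Real.cosh w * (1 ^ 2 * Q)) := by ring
    _ ≤ _ := by gcongr

lemma im12 {x ν : ℝ} (hx : 0 < x) (hν : 0 ≤ ν) : MeasureTheory.Integrable (fun p : ℝ × ℝ => (Real.sinh p.1 ^ 2 * (Real.sinh p.2 * Real.cosh p.2) * Real.cosh (2 * ν * p.1)) * Real.exp (-(x * ph p))) muN := by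
  refine mono_integrable hx hν (1 / 4) (by fun_prop) ?_
  rintro t w s c S C h g T Q rfl rfl rfl rfl rfl rfl h1 h2 h3 h4 h5 h6 h7 h8 h9 h10 h11 h12 h13 h14
  refine fb2 (by positivity) (by positivity) (by positivity) ?_ (by positivity)
  calc _ ≤ Real.sinh t ^ 2 * (Real.cosh w * Real.cosh w) * Q := by simp only; gcongr
    _ = 1 / 4 * ((2 * Real.sinh t * Real.cosh w) ^ 2 * (1 ^ 2 * Q)) := by ring
    _ ≤ _ := by gcongr

lemma im13 {x ν : ℝ} (hx : 0 < x) (hν : 0 ≤ ν) : MeasureTheory.Integrable (fun p : ℝ × ℝ => (Real.sinh p.1 * Real.sinh p.2 * Real.cosh (2 * ν * p.1)) * Real.exp (-(x * ph p))) muN := by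
  refine mono_integrable hx hν (1 / 2) (by fun_prop) ?_
  rintro t w s c S C h g T Q rfl rfl rfl rfl rfl rfl h1 h2 h3 h4 h5 h6 h7 h8 h9 h10 h11 h12 h13 h14
  refine fb1 (by positivity) (by positivity) (by norm_num) ?_ (by positivity)
  calc _ ≤ Real.sinh t * Real.cosh w * Q := by simp only; gcongr
    _ = 1 / 2 * (2 * Real.sinh t * Real.cosh w * (1 ^ 2 * Q)) := by ring
    _ ≤ _ := by gcongr

lemma im14 {x ν : ℝ} (hx : 0 < x) (hν : 0 ≤ ν) : MeasureTheory.Integrable (fun p : ℝ × ℝ => (Real.cosh p.1 * Real.sinh p.2 * Real.sinh (2 * ν * p.1)) * Real.exp (-(x * ph p))) muN := by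
  refine mono_integrable hx hν ν (by fun_prop) ?_
  rintro t w s c S C h g T Q rfl rfl rfl rfl rfl rfl h1 h2 h3 h4 h5 h6 h7 h8 h9 h10 h11 h12 h13 h14
  refine fb1 (by positivity) (by positivity) hν ?_ (by positivity)
  calc _ ≤ T * Real.cosh w * (2 * ν * Real.sinh t * Q) := by simp only; gcongr
    _ = ν * (2 * Real.sinh t * Real.cosh w * (T ^ 1 * Q)) := by ring
    _ ≤ _ := by gcongr; norm_num


lemma nic_ode {x ν : ℝ} (hx : 0 < x) (hν : 0 ≤ ν) :
    x ^ 3 * nicF 3 ν x + 3 * x ^ 2 * nicF 2 ν x + x * nicF 1 ν x +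
      4 * (x ^ 2 - ν ^ 2) * (x * nicF 1 ν x) + 4 * x ^ 2 * nicF 0 ν x = 0 := by
  set U : ℝ × ℝ → ℝ := fun p => 4 * x ^ 2 * (Real.sinh p.1 * Real.cosh p.1 * Real.cosh (2 * ν * p.1) * Real.exp (-(x * ph p))) +
    4 * ν * x * (Real.sinh p.1 * Real.cosh p.2 * Real.sinh (2 * ν * p.1) * Real.exp (-(x * ph p))) with hU
  set U' : ℝ × ℝ → ℝ := fun p =>
    4 * x ^ 2 * ((Real.cosh p.1 ^ 2 + Real.sinh p.1 ^ 2) * Real.cosh (2 * ν * p.1) * Real.exp (-(x * ph p))) +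
    8 * ν * x ^ 2 * (Real.sinh p.1 * Real.cosh p.1 * Real.sinh (2 * ν * p.1) * Real.exp (-(x * ph p))) +
    -8 * x ^ 3 * (Real.sinh p.1 * Real.cosh p.2 * Real.cosh p.1 ^ 2 * Real.cosh (2 * ν * p.1) * Real.exp (-(x * ph p))) +
    4 * ν * x * (Real.cosh p.1 * Real.cosh p.2 * Real.sinh (2 * ν * p.1) * Real.exp (-(x * ph p))) +
    8 * ν ^ 2 * x * (Real.sinh p.1 * Real.cosh p.2 * Real.cosh (2 * ν * p.1) * Real.exp (-(x * ph p))) +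
    -8 * ν * x ^ 2 * (Real.sinh p.1 * Real.cosh p.1 * Real.cosh p.2 ^ 2 * Real.sinh (2 * ν * p.1) * Real.exp (-(x * ph p))) with hU'
  set V : ℝ × ℝ → ℝ := fun p => 4 * x ^ 2 * (Real.sinh p.1 ^ 2 * (Real.sinh p.2 * Real.cosh p.2) * Real.cosh (2 * ν * p.1) * Real.exp (-(x * ph p))) +
    -2 * x * (Real.sinh p.1 * Real.sinh p.2 * Real.cosh (2 * ν * p.1) * Real.exp (-(x * ph p))) +
    -4 * x * ν * (Real.cosh p.1 * Real.sinh p.2 * Real.sinh (2 * ν * p.1) * Real.exp (-(x * ph p))) with hV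
  set V' : ℝ × ℝ → ℝ := fun p =>
    4 * x ^ 2 * (Real.sinh p.1 ^ 2 * Real.cosh p.2 ^ 2 * Real.cosh (2 * ν * p.1) * Real.exp (-(x * ph p))) +
    8 * x ^ 2 * (Real.sinh p.1 ^ 2 * Real.sinh p.2 ^ 2 * Real.cosh (2 * ν * p.1) * Real.exp (-(x * ph p))) +
    -2 * x * (Real.sinh p.1 * Real.cosh p.2 * Real.cosh (2 * ν * p.1) * Real.exp (-(x * ph p))) +
    -4 * x * ν * (Real.cosh p.1 * Real.cosh p.2 * Real.sinh (2 * ν * p.1) * Real.exp (-(x * ph p))) +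
    -8 * x ^ 3 * (Real.sinh p.1 ^ 3 * (Real.sinh p.2 ^ 2 * Real.cosh p.2) * Real.cosh (2 * ν * p.1) * Real.exp (-(x * ph p))) +
    8 * x ^ 2 * ν * (Real.sinh p.1 * Real.cosh p.1 * Real.sinh p.2 ^ 2 * Real.sinh (2 * ν * p.1) * Real.exp (-(x * ph p))) with hV'
  have iU : MeasureTheory.Integrable U muN :=
    ((im10 hx hν).const_mul _).add ((im11 hx hν).const_mul _)
  have iU' : MeasureTheory.Integrable U' muN :=
    ((((((im0 hx hν).const_mul _).add ((im1 hx hν).const_mul _)).add ((im2 hx hν).const_mul _)).add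
      ((im3 hx hν).const_mul _)).add ((im4 hx hν).const_mul _)).add ((im5 hx hν).const_mul _)
  have iV : MeasureTheory.Integrable V muN :=
    (((im12 hx hν).const_mul _).add ((im13 hx hν).const_mul _)).add ((im14 hx hν).const_mul _)
  have iV' : MeasureTheory.Integrable V' muN :=
    ((((((im6 hx hν).const_mul _).add ((im7 hx hν).const_mul _)).add ((im4 hx hν).const_mul _)).add
      ((im3 hx hν).const_mul _)).add ((im8 hx hν).const_mul _)).add ((im9 hx hν).const_mul _)
  have dU : ∫ p, U' p ∂muN = 0 := by
    refine parts_t iU iU' ?_ (by intro w; simp [hU])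
    intro t w
    simp only [hU, hU', ph]
    have hE : HasDerivAt (fun t => Real.exp (-(x * (2 * Real.sinh t * Real.cosh w))))
        (Real.exp (-(x * (2 * Real.sinh t * Real.cosh w))) * (-(x * (2 * Real.cosh t * Real.cosh w)))) t :=
      ((((Real.hasDerivAt_sinh t).const_mul 2).mul_const _).const_mul x).fun_neg.exp
    have hl : HasDerivAt (fun t : ℝ => 2 * ν * t) (2 * ν) t := by simpa using (hasDerivAt_id t).const_mul (2 * ν)
    have hh := hl.cosh
    have hg := hl.sinh
    have hs := Real.hasDerivAt_sinh t
    have hc := Real.hasDerivAt_cosh t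
    have := ((((hs.fun_mul hc).fun_mul hh).fun_mul hE).const_mul (4 * x ^ 2)).fun_add ((((hs.mul_const (Real.cosh w)).fun_mul hg).fun_mul hE).const_mul (4 * ν * x))
    refine this.congr_deriv ?_
    ring
  have dV : ∫ p, V' p ∂muN = 0 := by
    refine parts_w iV iV' ?_ (by intro w; simp [hV])
    intro t w
    simp only [hV, hV', ph]
    have hE : HasDerivAt (fun w => Real.exp (-(x * (2 * Real.sinh t * Real.cosh w))))
        (Real.exp (-(x * (2 * Real.sinh t * Real.cosh w))) * (-(x * (2 * Real.sinh t * Real.sinh w)))) w :=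
      (((Real.hasDerivAt_cosh w).const_mul (2 * Real.sinh t)).const_mul x).fun_neg.exp
    have hs := Real.hasDerivAt_sinh w
    have hc := Real.hasDerivAt_cosh w
    have := ((((((hs.fun_mul hc).const_mul (Real.sinh t ^ 2)).mul_const (Real.cosh (2 * ν * t))).fun_mul hE).const_mul (4 * x ^ 2)).fun_add
      ((((hs.const_mul (Real.sinh t)).mul_const (Real.cosh (2 * ν * t))).fun_mul hE).const_mul (-2 * x))).fun_add
      ((((hs.const_mul (Real.cosh t)).mul_const (Real.sinh (2 * ν * t))).fun_mul hE).const_mul (-4 * x * ν))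
    refine this.congr_deriv ?_
    ring
  have i0 := nic_integrable 0 ν hx
  have i1 := nic_integrable 1 ν hx
  have i2 := nic_integrable 2 ν hx
  have i3 := nic_integrable 3 ν hx
  have key : x ^ 3 * nicF 3 ν x + 3 * x ^ 2 * nicF 2 ν x + (x + 4 * (x ^ 2 - ν ^ 2) * x) * nicF 1 ν x + 4 * x ^ 2 * nicF 0 ν x
      = (∫ p, U' p ∂muN) + ∫ p, V' p ∂muN := by
    rw [← MeasureTheory.integral_add iU' iV']
    have j1 : MeasureTheory.Integrable (fun p => x ^ 3 * ((-ph p) ^ 3 * Real.exp (-(x * ph p)) * Real.cosh (2 * ν * p.1)) +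
        3 * x ^ 2 * ((-ph p) ^ 2 * Real.exp (-(x * ph p)) * Real.cosh (2 * ν * p.1))) muN := (i3.const_mul _).add (i2.const_mul _)
    have j2 : MeasureTheory.Integrable (fun p => x ^ 3 * ((-ph p) ^ 3 * Real.exp (-(x * ph p)) * Real.cosh (2 * ν * p.1)) +
        3 * x ^ 2 * ((-ph p) ^ 2 * Real.exp (-(x * ph p)) * Real.cosh (2 * ν * p.1)) +
        (x + 4 * (x ^ 2 - ν ^ 2) * x) * ((-ph p) ^ 1 * Real.exp (-(x * ph p)) * Real.cosh (2 * ν * p.1))) muN := j1.add (i1.const_mul _)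
    unfold nicF
    rw [← MeasureTheory.integral_const_mul, ← MeasureTheory.integral_const_mul, ← MeasureTheory.integral_const_mul,
      ← MeasureTheory.integral_const_mul, ← MeasureTheory.integral_add (i3.const_mul _) (i2.const_mul _),
      ← MeasureTheory.integral_add j1 (i1.const_mul _),
      ← MeasureTheory.integral_add j2 (i0.const_mul _)]
    congr 1
    ext ⟨t, w⟩
    simp only [hU', hV']
    have e1 := Real.cosh_sq t
    have e2 := Real.cosh_sq w
    generalize Real.exp (-(x * ph (t, w))) = E
    simp only [ph]
    generalize Real.sinh (2 * ν * t) = g at *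
    generalize Real.cosh (2 * ν * t) = h at *
    generalize Real.sinh t = s at *
    generalize Real.cosh t = c at *
    generalize Real.sinh w = S at *
    generalize Real.cosh w = C at *
    linear_combination E * h * (8 * x ^ 3 * s * C - 4 * x ^ 2) * e1 +
      E * (h * (-8 * x ^ 3 * s ^ 3 * C + 8 * x ^ 2 * s ^ 2) + 8 * ν * x ^ 2 * s * c * g) * e2
  rw [dU, dV] at key
  linarith



instance muN_neBot : (MeasureTheory.ae muN).NeBot := by
  rw [MeasureTheory.ae_neBot]
  unfold muN
  intro h
  have h2 := congrArg (fun m => m univ) h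
  simp only [MeasureTheory.Measure.coe_zero, Pi.zero_apply] at h2
  rw [← Set.univ_prod_univ, MeasureTheory.Measure.prod_prod] at h2
  simp at h2

lemma nic0_pos (ν : ℝ) {x : ℝ} (hx : 0 < x) : 0 < nicF 0 ν x := by
  unfold nicF
  rw [MeasureTheory.integral_pos_iff_support_of_nonneg_ae _ (nic_integrable 0 ν hx)]
  · have : Function.support (fun p : ℝ × ℝ => (-ph p) ^ 0 * Real.exp (-(x * ph p)) * Real.cosh (2 * ν * p.1)) = univ := by
      ext p
      have := Real.cosh_pos (2 * ν * p.1)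
      simp [this.ne']
    rw [this, pos_iff_ne_zero, Ne, MeasureTheory.Measure.measure_univ_eq_zero]
    exact MeasureTheory.ae_neBot.mp inferInstance
  · filter_upwards with p
    have := Real.cosh_pos (2 * ν * p.1)
    simp only [Pi.zero_apply]
    positivity

lemma nic0_strict {ν μ x : ℝ} (hν : 0 ≤ ν) (h : ν < μ) (hx : 0 < x) : nicF 0 ν x < nicF 0 μ x := by
  have hi := (nic_integrable 0 μ hx).sub (nic_integrable 0 ν hx)
  rw [← sub_pos]
  unfold nicF
  rw [← MeasureTheory.integral_sub (nic_integrable 0 μ hx) (nic_integrable 0 ν hx)]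
  have hp : ∀ᵐ p ∂muN, 0 < (-ph p) ^ 0 * Real.exp (-(x * ph p)) * Real.cosh (2 * μ * p.1) -
      (-ph p) ^ 0 * Real.exp (-(x * ph p)) * Real.cosh (2 * ν * p.1) := by
    filter_upwards [muN_ae] with p hp
    have : Real.cosh (2 * ν * p.1) < Real.cosh (2 * μ * p.1) := by
      rw [Real.cosh_lt_cosh, abs_of_nonneg (by have := hp.1; positivity), abs_of_nonneg (by have := hp.1; have : 0 < μ := by linarith
                                                                                            positivity)]
      have := hp.1
      gcongr
    have he := Real.exp_pos (-(x * ph p))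
    simp only [pow_zero, one_mul]
    nlinarith
  have h0 := MeasureTheory.integral_nonneg_of_ae (μ := muN) (hp.mono fun p h => h.le)
  refine lt_of_le_of_ne h0 fun h1 => ?_
  have := (MeasureTheory.integral_eq_zero_iff_of_nonneg_ae (hp.mono fun p h => h.le) hi).mp h1.symm
  obtain ⟨p, h1, h2⟩ := (hp.and this).exists
  simp only [Pi.zero_apply, Pi.sub_apply] at h2
  exact h1.ne' h2

lemma nic0_mono {ν μ x : ℝ} (hν : 0 ≤ ν) (h : ν ≤ μ) (hx : 0 < x) : nicF 0 ν x ≤ nicF 0 μ x := by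
  rcases h.eq_or_lt with rfl | h
  · rfl
  · exact (nic0_strict hν h hx).le

lemma nic0_anti (ν : ℝ) {x y : ℝ} (hx : 0 < x) (h : x ≤ y) : nicF 0 ν y ≤ nicF 0 ν x := by
  unfold nicF
  apply MeasureTheory.integral_mono_ae (nic_integrable 0 ν (hx.trans_le h)) (nic_integrable 0 ν hx)
  filter_upwards [muN_ae] with p hp
  have := ph_pos hp
  have := Real.cosh_pos (2 * ν * p.1)
  gcongr

lemma nic0_cont {x : ℝ} (hx : 0 < x) : Continuous fun ν => nicF 0 ν x := by
  rw [continuous_iff_continuousAt]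
  intro ν
  unfold nicF
  refine MeasureTheory.continuousAt_of_dominated (bound := fun p => (-ph p) ^ 0 * Real.exp (-(x * ph p)) * Real.cosh (2 * (|ν| + 1) * p.1)) ?_ ?_ (nic_integrable 0 _ hx) ?_
  · filter_upwards with y
    exact (by fun_prop : Continuous _).aestronglyMeasurable
  · filter_upwards [Metric.ball_mem_nhds ν one_pos] with y hy
    filter_upwards [muN_ae] with p hp
    have h0 := Real.cosh_pos (2 * y * p.1)
    rw [Real.norm_eq_abs, abs_of_pos (by simp only [pow_zero]; positivity)]
    have : Real.cosh (2 * y * p.1) ≤ Real.cosh (2 * (|ν| + 1) * p.1) := by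
      rw [Real.cosh_le_cosh]
      rw [abs_mul, abs_mul (2 * (|ν| + 1)), abs_mul, abs_mul 2 (|ν| + 1)]
      rw [Metric.mem_ball, Real.dist_eq] at hy
      have h3 : |y| ≤ |(|ν| + 1)| := by
        rw [abs_of_pos (by positivity : 0 < |ν| + 1)]
        have := abs_sub_abs_le_abs_sub y ν
        linarith
      exact mul_le_mul_of_nonneg_right (mul_le_mul_of_nonneg_left h3 (abs_nonneg _)) (abs_nonneg _)
    simp only [pow_zero, one_mul]
    gcongr
  · filter_upwards with p
    exact (by fun_prop : Continuous _).continuousAt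

lemma nic_bound (n : ℕ) (ν : ℝ) {x : ℝ} (hx : 0 < x) :
    |nicF n ν x| ≤ n.factorial * (2 / x) ^ n * nicF 0 ν (x / 2) := by
  have h := MeasureTheory.norm_integral_le_of_norm_le (μ := muN)
    (f := fun p => (-ph p) ^ n * Real.exp (-(x * ph p)) * Real.cosh (2 * ν * p.1))
    ((nic_integrable 0 ν (half_pos hx)).const_mul (n.factorial * (2 / x) ^ n)) ?_
  · rw [MeasureTheory.integral_const_mul] at h
    exact h
  · filter_upwards [muN_ae] with p hp
    have := ph_pos hp
    rw [norm_mul, norm_mul, norm_pow, norm_neg]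
    simp only [Real.norm_eq_abs]
    rw [abs_of_pos this, abs_of_pos (Real.exp_pos _), abs_of_pos (Real.cosh_pos _)]
    have h1 := pow_exp_bound hx n this.le
    have := Real.cosh_pos (2 * ν * p.1)
    calc _ ≤ (n.factorial * (2 / x) ^ n * Real.exp (-(x / 2 * ph p))) * Real.cosh (2 * ν * p.1) := by gcongr
      _ = _ := by simp only [pow_zero]; ring

lemma cosh_sub_one_bound {ν : ℝ} (hν : 0 ≤ ν) {p : ℝ × ℝ} (hp : 0 < p.1 ∧ 0 < p.2) :
    Real.cosh (2 * ν * p.1) - 1 ≤ ν ^ 2 / 2 * (ph p ^ 2 * Real.exp (2 * ν * p.1)) := by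
  have h1 : Real.cosh (2 * ν * p.1) - 1 = 2 * Real.sinh (ν * p.1) ^ 2 := by
    rw [mul_assoc, Real.cosh_two_mul, Real.cosh_sq]; ring
  have h2 : Real.sinh (ν * p.1) ≤ (ν * p.1) * Real.exp (ν * p.1) := sinh_le_mul_exp (by have := hp.1; positivity)
  have h0 : 0 ≤ Real.sinh (ν * p.1) := Real.sinh_nonneg_iff.mpr (by have := hp.1; positivity)
  have h3 : p.1 ≤ ph p / 2 := by
    unfold ph
    have := Real.self_le_sinh_iff.mpr hp.1.le
    have := Real.one_le_cosh p.2
    nlinarith [hp.1]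
  rw [h1]
  have hp1 := hp.1
  calc 2 * Real.sinh (ν * p.1) ^ 2 ≤ 2 * ((ν * p.1) * Real.exp (ν * p.1)) ^ 2 := by gcongr
    _ ≤ 2 * ((ν * (ph p / 2)) * Real.exp (ν * p.1)) ^ 2 := by gcongr
    _ = ν ^ 2 / 2 * (ph p ^ 2 * (Real.exp (ν * p.1) * Real.exp (ν * p.1))) := by ring
    _ = _ := by rw [← Real.exp_add]; congr 4; ring

lemma nic_diff_lim {ν : ℝ} (hν : 0 ≤ ν) :
    Tendsto (fun x => x * (nicF 0 ν x - nicF 0 0 x)) atTop (𝓝 0) := by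
  set C : ℝ := 4 * ν ^ 2 * ∫ p, Real.exp (2 * ν * p.1) * Real.exp (-(1 / 2 * ph p)) ∂muN with hC
  have hb : ∀ x : ℝ, 1 ≤ x → x * (nicF 0 ν x - nicF 0 0 x) ≤ C / x := by
    intro x hx
    have hx0 : 0 < x := by linarith
    have : nicF 0 ν x - nicF 0 0 x ≤ C / x ^ 2 := by
      unfold nicF
      rw [← MeasureTheory.integral_sub (nic_integrable 0 ν hx0) (nic_integrable 0 0 hx0), hC, mul_div_right_comm,
        ← MeasureTheory.integral_const_mul]
      apply MeasureTheory.integral_mono_ae ((nic_integrable 0 ν hx0).sub (nic_integrable 0 0 hx0))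
        ((base_integrable (by norm_num : (0 : ℝ) < 1 / 2) (2 * ν)).const_mul _)
      filter_upwards [muN_ae] with p hp
      have h1 := cosh_sub_one_bound hν hp
      have hq := ph_pos hp
      have h2 := pow_exp_bound hx0 2 hq.le
      simp only [Pi.sub_apply, pow_zero, one_mul, mul_zero, zero_mul, Real.cosh_zero, mul_one]
      calc Real.exp (-(x * ph p)) * Real.cosh (2 * ν * p.1) - Real.exp (-(x * ph p))
          = Real.exp (-(x * ph p)) * (Real.cosh (2 * ν * p.1) - 1) := by ring
        _ ≤ Real.exp (-(x * ph p)) * (ν ^ 2 / 2 * (ph p ^ 2 * Real.exp (2 * ν * p.1))) := by gcongr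
        _ = ν ^ 2 / 2 * Real.exp (2 * ν * p.1) * (ph p ^ 2 * Real.exp (-(x * ph p))) := by ring
        _ ≤ ν ^ 2 / 2 * Real.exp (2 * ν * p.1) * ((2 : ℕ).factorial * (2 / x) ^ 2 * Real.exp (-(x / 2 * ph p))) := by gcongr
        _ ≤ ν ^ 2 / 2 * Real.exp (2 * ν * p.1) * ((2 : ℕ).factorial * (2 / x) ^ 2 * Real.exp (-(1 / 2 * ph p))) := by gcongr
        _ = _ := by simp [Nat.factorial]; ring
    calc _ ≤ x * (C / x ^ 2) := by gcongr
      _ = _ := by field_simp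
  refine tendsto_of_tendsto_of_tendsto_of_le_of_le' tendsto_const_nhds (tendsto_const_nhds.div_atTop tendsto_id : Tendsto (fun x => C / x) atTop (𝓝 0)) ?_ ?_
  · filter_upwards [eventually_ge_atTop 1] with x hx
    have := nic0_mono le_rfl hν (by linarith : 0 < x)
    apply mul_nonneg <;> linarith
  · filter_upwards [eventually_ge_atTop 1] with x hx using hb x hx

lemma nic_half {x : ℝ} (hx : 0 < x) : nicF 0 (1 / 2) x + x * nicF 1 (1 / 2) x = 0 := by
  have i0 := nic_integrable 0 (1 / 2) hx
  have i1 := (nic_integrable 1 (1 / 2) hx).const_mul x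
  have h : ∫ p, ((-ph p) ^ 0 * Real.exp (-(x * ph p)) * Real.cosh (2 * (1 / 2) * p.1) +
      x * ((-ph p) ^ 1 * Real.exp (-(x * ph p)) * Real.cosh (2 * (1 / 2) * p.1))) ∂muN = 0 := by
    refine parts_t (F := fun p => Real.sinh p.1 * Real.exp (-(x * ph p))) ?_ (i0.add i1) ?_ (by intro w; simp)
    · refine (base_integrable hx 1).mono' (by fun_prop : Continuous _).aestronglyMeasurable ?_
      filter_upwards [muN_ae] with p hp
      have h1 := Real.sinh_pos_iff.mpr hp.1
      rw [Real.norm_eq_abs, abs_of_pos (by positivity)]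
      have : Real.sinh p.1 ≤ Real.exp (1 * p.1) := by
        rw [Real.sinh_eq, one_mul]
        have := Real.exp_pos p.1
        have := Real.exp_pos (-p.1)
        linarith
      gcongr
    · intro t w
      simp only [ph]
      have hE : HasDerivAt (fun t => Real.exp (-(x * (2 * Real.sinh t * Real.cosh w))))
          (Real.exp (-(x * (2 * Real.sinh t * Real.cosh w))) * (-(x * (2 * Real.cosh t * Real.cosh w)))) t :=
        ((((Real.hasDerivAt_sinh t).const_mul 2).mul_const _).const_mul x).fun_neg.exp
      refine ((Real.hasDerivAt_sinh t).fun_mul hE).congr_deriv ?_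
      rw [show 2 * (1 / 2) * t = t by ring]
      ring
  rw [MeasureTheory.integral_add i0 i1, MeasureTheory.integral_const_mul] at h
  exact h

/-- limit constant -/
noncomputable def ell : ℝ := nicF 0 (1 / 2) 1

lemma ell_pos : 0 < ell := nic0_pos _ one_pos

lemma nic_half_eq {x : ℝ} (hx : 0 < x) : x * nicF 0 (1 / 2) x = ell := by
  have h := const_Ioi (f := fun x => x * nicF 0 (1 / 2) x) (fun y hy => ?_) hx one_pos
  · simpa [ell] using h
  · refine ((hasDerivAt_id y).mul (nicF_deriv 0 (1 / 2) hy)).congr_deriv ?_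
    have := nic_half hy
    simp only [id]
    linarith

lemma nic0_lim {ν : ℝ} (hν : 0 ≤ ν) : Tendsto (fun x => x * nicF 0 ν x) atTop (𝓝 ell) := by
  have h1 := nic_diff_lim hν
  have h2 := nic_diff_lim (by norm_num : (0 : ℝ) ≤ 1 / 2)
  have h3 := (h1.sub h2).add (tendsto_const_nhds (x := ell))
  simp only [sub_zero, zero_add] at h3
  refine h3.congr' ?_
  filter_upwards [eventually_gt_atTop 0] with x hx
  rw [← nic_half_eq hx]; ring

lemma nic0_lim0 {ν : ℝ} (hν : 0 ≤ ν) : Tendsto (fun x => nicF 0 ν x) atTop (𝓝 0) := by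
  have h1 := (nic0_lim hν).mul (tendsto_inv_atTop_zero (𝕜 := ℝ))
  rw [mul_zero] at h1
  refine h1.congr' ?_
  filter_upwards [eventually_gt_atTop 0] with x hx
  field_simp

lemma nic_lim (n : ℕ) {ν : ℝ} (hν : 0 ≤ ν) : Tendsto (fun x => x ^ n * nicF n ν x) atTop (𝓝 0) := by
  have h1 : Tendsto (fun x => (n.factorial * 2 ^ n : ℝ) * nicF 0 ν (x / 2)) atTop (𝓝 0) := by
    have := ((nic0_lim0 hν).comp (tendsto_id.atTop_div_const (by norm_num : (0 : ℝ) < 2))).const_mul (n.factorial * 2 ^ n : ℝ)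
    simpa using this
  refine squeeze_zero_norm' ?_ h1
  filter_upwards [eventually_gt_atTop 0] with x hx
  have := nic_bound n ν hx
  rw [norm_mul, norm_pow, Real.norm_eq_abs, Real.norm_eq_abs, abs_of_pos hx]
  calc _ ≤ x ^ n * (n.factorial * (2 / x) ^ n * nicF 0 ν (x / 2)) := by gcongr
    _ = _ := by rw [div_pow]; field_simp



lemma zero_mul_bdd {f g : ℝ → ℝ} {K : ℝ} (hf : Tendsto f atTop (𝓝 0)) (hg : ∀ᶠ x in atTop, |g x| ≤ K) :
    Tendsto (fun x => f x * g x) atTop (𝓝 0) := by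
  have h1 : Tendsto (fun x => |f x| * K) atTop (𝓝 0) := by simpa using hf.abs.mul_const K
  refine squeeze_zero_norm' ?_ h1
  filter_upwards [hg] with x hx
  rw [norm_mul, Real.norm_eq_abs, Real.norm_eq_abs]
  gcongr

/-- the bilinear first integral -/
noncomputable def kk (ν : ℝ) (u u1 v v1 : ℝ → ℝ) (x : ℝ) : ℝ :=
  nicF 0 ν x * ((ν * u x - x * u1 x) * (ν * v x - x * v1 x)) -
    x * nicF 1 ν x / 2 * (u x * (ν * v x - x * v1 x) + v x * (ν * u x - x * u1 x)) +
    (x * nicF 1 ν x + x ^ 2 * nicF 2 ν x + 2 * (x ^ 2 - ν ^ 2) * nicF 0 ν x) / 2 * (u x * v x)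

lemma kk_deriv {ν : ℝ} (hν : 0 ≤ ν) {u u1 v v1 : ℝ → ℝ} {x : ℝ} (hx : 0 < x)
    (hu : HasDerivAt u (ν / x * u x - u1 x) x) (hu1 : HasDerivAt u1 (u x - (ν + 1) / x * u1 x) x)
    (hv : HasDerivAt v (ν / x * v x - v1 x) x) (hv1 : HasDerivAt v1 (v x - (ν + 1) / x * v1 x) x) :
    HasDerivAt (kk ν u u1 v v1) 0 x := by
  have h0 := nicF_deriv 0 ν hx
  have h1 := nicF_deriv 1 ν hx
  have h2 := nicF_deriv 2 ν hx
  have hX := hasDerivAt_id' x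
  have ha := (hu.const_mul ν).fun_sub (hX.fun_mul hu1)
  have hb := (hv.const_mul ν).fun_sub (hX.fun_mul hv1)
  have hX2 := hX.fun_pow 2
  have := ((h0.fun_mul (ha.fun_mul hb)).fun_sub
    (((hX.fun_mul h1).div_const 2).fun_mul ((hu.fun_mul hb).fun_add (hv.fun_mul ha)))).fun_add
    (((((hX.fun_mul h1).fun_add (hX2.fun_mul h2)).fun_add
      (((hX2.sub_const (ν ^ 2)).const_mul 2).fun_mul h0)).div_const 2).fun_mul (hu.fun_mul hv))
  refine this.congr_deriv ?_
  have ho := nic_ode hx hν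
  generalize nicF 0 ν x = A at *
  generalize nicF 1 ν x = F1 at *
  generalize nicF 2 ν x = F2 at *
  generalize nicF 3 ν x = F3 at *
  simp only [zero_add, one_mul, Nat.cast_ofNat, Nat.reduceSub, pow_one, mul_one] at *
  field_simp
  linear_combination u x * v x * ho

lemma kk_lim {ν : ℝ} (hν : 0 ≤ ν) {u u1 v v1 : ℝ → ℝ} {K L : ℝ}
    (hu : ∀ᶠ x in atTop, |√x * u x| ≤ K) (hu1 : ∀ᶠ x in atTop, |√x * u1 x| ≤ K)
    (hv : ∀ᶠ x in atTop, |√x * v x| ≤ K) (hv1 : ∀ᶠ x in atTop, |√x * v1 x| ≤ K)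
    (hL : Tendsto (fun x => (√x * u1 x) * (√x * v1 x) + (√x * u x) * (√x * v x)) atTop (𝓝 L)) :
    Tendsto (kk ν u u1 v v1) atTop (𝓝 (ell * L)) := by
  have hA := nic0_lim0 hν
  have hB : Tendsto (fun x => x * nicF 1 ν x) atTop (𝓝 0) := by simpa using nic_lim 1 hν
  have hC := nic_lim 2 hν
  have hp : ∀ᶠ x in atTop, |(√x * u x) * (√x * v x)| ≤ K * K := by
    filter_upwards [hu, hv] with x h1 h2
    rw [abs_mul]; have := abs_nonneg (√x * u x); gcongr; linarith
  have hq : ∀ᶠ x in atTop, |(√x * u x) * (√x * v1 x) + (√x * u1 x) * (√x * v x)| ≤ K * K + K * K := by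
    filter_upwards [hu, hv, hu1, hv1] with x h1 h2 h3 h4
    refine (abs_add_le _ _).trans ?_
    rw [abs_mul, abs_mul (√x * u1 x)]
    have := abs_nonneg (√x * u x)
    gcongr <;> linarith
  have hi := tendsto_inv_atTop_zero (𝕜 := ℝ)
  have t1 := (nic0_lim hν).mul hL
  have t2 := zero_mul_bdd (f := fun x => -ν * nicF 0 ν x) (by simpa using hA.const_mul (-ν)) hq
  have t3 := zero_mul_bdd (f := fun x => x * nicF 1 ν x / 2) (by simpa using hB.div_const 2) hq
  have t4 := zero_mul_bdd (f := fun x => (-(ν * (x * nicF 1 ν x)) + (x * nicF 1 ν x + x ^ 2 * nicF 2 ν x) / 2) * x⁻¹)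
    (by simpa using ((hB.const_mul ν).neg.add ((hB.add hC).div_const 2)).mul hi) hp
  have := ((t1.add t2).add t3).add t4
  simp only [add_zero] at this
  refine this.congr' ?_
  filter_upwards [eventually_gt_atTop 0] with x hx
  have hs := Real.mul_self_sqrt hx.le
  have e : ∀ a b : ℝ, √x * a * (√x * b) = x * a * b := fun a b => by linear_combination a * b * hs
  simp only [e, kk]
  field_simp
  ring

lemma asymp_bdd {u α : ℝ → ℝ} {c : ℝ} (hu : Tendsto (fun x => u x - α x) atTop (𝓝 0)) (hα : ∀ x, |α x| ≤ c) :
    ∀ᶠ x in atTop, |u x| ≤ c + 1 := by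
  have := hu.norm.eventually (gt_mem_nhds (by simp : ‖(0 : ℝ)‖ < 1))
  filter_upwards [this] with x hx
  rw [Real.norm_eq_abs] at hx
  have h1 := abs_add_le (u x - α x) (α x)
  rw [sub_add_cancel] at h1
  linarith [hα x]

lemma besselY_deriv1_NI {ν : ℝ} (h : NI ν) {x : ℝ} (hx : 0 < x) :
    HasDerivAt (besselY (ν + 1)) (besselY ν x - (ν + 1) / x * besselY (ν + 1) x) x := by
  refine (besselY_deriv_NI h.add_one hx).congr_deriv ?_
  have := besselY_rec_NI h hx
  rw [show ν + 1 + 1 = ν + 2 by ring]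
  linear_combination -this

lemma besselJ_deriv1 (ν : ℝ) {x : ℝ} (hx : 0 < x) :
    HasDerivAt (besselJ (ν + 1)) (besselJ ν x - (ν + 1) / x * besselJ (ν + 1) x) x := by
  have := besselJ_deriv' (ν + 1) hx
  simpa using this

lemma nicholson_NI {ν : ℝ} (hν : 0 ≤ ν) (h : NI ν) {x : ℝ} (hx : 0 < x) :
    besselJ ν x ^ 2 + besselY ν x ^ 2 = 2 / (π * ell) * nicF 0 ν x := by
  set c := √(2 / π) with hc
  have hc0 : 0 ≤ c := Real.sqrt_nonneg _
  have hcc : c * c = 2 / π := Real.mul_self_sqrt (by positivity)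
  set φ : ℝ → ℝ := fun x => x - ν * π / 2 - π / 4 with hφ
  have aJ : Tendsto (fun x => √x * besselJ ν x - c * Real.cos (φ x)) atTop (𝓝 0) := besselJ_asymp ν
  have aY : Tendsto (fun x => √x * besselY ν x - c * Real.sin (φ x)) atTop (𝓝 0) := besselY_asymp_NI h
  have aJ1 : Tendsto (fun x => √x * besselJ (ν + 1) x - c * Real.sin (φ x)) atTop (𝓝 0) := by
    refine (besselJ_asymp (ν + 1)).congr fun x => ?_
    rw [show x - (ν + 1) * π / 2 - π / 4 = φ x - π / 2 by simp only [hφ]; ring, Real.cos_sub_pi_div_two]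
  have aY1 : Tendsto (fun x => √x * besselY (ν + 1) x - c * -Real.cos (φ x)) atTop (𝓝 0) := by
    refine (besselY_asymp_NI h.add_one).congr fun x => ?_
    rw [show x - (ν + 1) * π / 2 - π / 4 = φ x - π / 2 by simp only [hφ]; ring, Real.sin_sub_pi_div_two]
  have bc : ∀ x, |c * Real.cos (φ x)| ≤ c := fun x => by
    rw [abs_mul, abs_of_nonneg hc0]; exact mul_le_of_le_one_right hc0 (Real.abs_cos_le_one _)
  have bs : ∀ x, |c * Real.sin (φ x)| ≤ c := fun x => by
    rw [abs_mul, abs_of_nonneg hc0]; exact mul_le_of_le_one_right hc0 (Real.abs_sin_le_one _)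
  have bn : ∀ x, |c * -Real.cos (φ x)| ≤ c := fun x => by
    rw [mul_neg, abs_neg]; exact bc x
  have kJJ : kk ν (besselJ ν) (besselJ (ν + 1)) (besselJ ν) (besselJ (ν + 1)) x = ell * (2 / π) := by
    refine const_Ioi_lim (fun y hy => kk_deriv hν hy (besselJ_deriv ν hy) (besselJ_deriv1 ν hy) (besselJ_deriv ν hy) (besselJ_deriv1 ν hy)) ?_ hx
    refine kk_lim hν (asymp_bdd aJ bc) (asymp_bdd aJ1 bs) (asymp_bdd aJ bc) (asymp_bdd aJ1 bs) ?_
    have := ((asymp_mul aJ1 aJ1 bs bs).add (asymp_mul aJ aJ bc bc)).add (tendsto_const_nhds (x := 2 / π))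
    simp only [zero_add] at this
    refine this.congr fun x => ?_
    linear_combination -hcc - c * c * Real.sin_sq_add_cos_sq (φ x)
  have kYY : kk ν (besselY ν) (besselY (ν + 1)) (besselY ν) (besselY (ν + 1)) x = ell * (2 / π) := by
    refine const_Ioi_lim (fun y hy => kk_deriv hν hy (besselY_deriv_NI h hy) (besselY_deriv1_NI h hy) (besselY_deriv_NI h hy) (besselY_deriv1_NI h hy)) ?_ hx
    refine kk_lim hν (asymp_bdd aY bs) (asymp_bdd aY1 bn) (asymp_bdd aY bs) (asymp_bdd aY1 bn) ?_
    have := ((asymp_mul aY1 aY1 bn bn).add (asymp_mul aY aY bs bs)).add (tendsto_const_nhds (x := 2 / π))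
    simp only [zero_add] at this
    refine this.congr fun x => ?_
    linear_combination -hcc - c * c * Real.sin_sq_add_cos_sq (φ x)
  have kJY : kk ν (besselJ ν) (besselJ (ν + 1)) (besselY ν) (besselY (ν + 1)) x = ell * 0 := by
    refine const_Ioi_lim (fun y hy => kk_deriv hν hy (besselJ_deriv ν hy) (besselJ_deriv1 ν hy) (besselY_deriv_NI h hy) (besselY_deriv1_NI h hy)) ?_ hx
    refine kk_lim hν (asymp_bdd aJ bc) (asymp_bdd aJ1 bs) (asymp_bdd aY bs) (asymp_bdd aY1 bn) ?_
    have := ((asymp_mul aJ1 aY1 bs bn).add (asymp_mul aJ aY bc bs))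
    simp only [zero_add] at this
    refine this.congr fun x => ?_
    ring
  have hW := wronskian_NI h hx
  have hW2 : x * (besselJ (ν + 1) x * besselY ν x - besselJ ν x * besselY (ν + 1) x) = 2 / π := by
    rw [hW]; field_simp
  unfold kk at kJJ kYY kJY
  generalize besselJ ν x = J at *
  generalize besselJ (ν + 1) x = J1 at *
  generalize besselY ν x = Y at *
  generalize besselY (ν + 1) x = Y1 at *
  have key : nicF 0 ν x * (x * (J1 * Y - J * Y1)) ^ 2 = ell * (2 / π) * (J ^ 2 + Y ^ 2) := by
    linear_combination Y ^ 2 * kJJ - 2 * J * Y * kJY + J ^ 2 * kYY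
  rw [hW2] at key
  have := ell_pos
  have := Real.pi_pos
  field_simp at key ⊢
  linear_combination -key



lemma besselY_lim_exists {ν : ℝ} (hν : 0 ≤ ν) {x : ℝ} (hx : 0 < x) :
    ∃ L, Tendsto (fun μ : ℝ => (besselJ μ x * Real.cos (μ * π) - besselJ (-μ) x) / Real.sin (μ * π))
      (𝓝[{μ : ℝ | ∀ n : ℤ, μ ≠ (n : ℝ)}] ν) (𝓝 L) := by
  have hd := besselJ_differentiable_order hx
  have hd2 : Differentiable ℝ fun μ => besselJ (-μ) x := hd.comp differentiable_neg
  by_cases h : NI ν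
  · refine ⟨_, Tendsto.mono_left (ContinuousAt.tendsto ?_) nhdsWithin_le_nhds⟩
    have := hd.continuous
    have := hd2.continuous
    refine ContinuousAt.div ?_ (by fun_prop) h.sin_ne
    exact (by fun_prop : Continuous _).continuousAt
  · unfold NI at h
    push Not at h
    obtain ⟨m, hm⟩ := h
    have hm0 : 0 ≤ m := by rw [hm] at hν; exact_mod_cast hν
    obtain ⟨n, rfl⟩ := Int.eq_ofNat_of_zero_le hm0
    have hn : ν = (n : ℝ) := by simpa using hm
    set g : ℝ → ℝ := fun μ => besselJ μ x * Real.cos (μ * π) - besselJ (-μ) x with hg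
    have hgd : Differentiable ℝ g := by
      have : Differentiable ℝ fun μ => Real.cos (μ * π) := by fun_prop
      exact (hd.mul this).sub hd2
    have g0 : g ν = 0 := by
      simp only [hg, hn, Real.cos_nat_mul_pi, besselJ_neg_nat n hx]; ring
    have s0 : Real.sin (ν * π) = 0 := by rw [hn]; exact Real.sin_nat_mul_pi n
    have hs : HasDerivAt (fun μ => Real.sin (μ * π)) (Real.cos (ν * π) * π) ν := by
      simpa using ((hasDerivAt_id' ν).mul_const π).sin
    have hs0 : Real.cos (ν * π) * π ≠ 0 := by
      rw [hn, Real.cos_nat_mul_pi]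
      exact mul_ne_zero (pow_ne_zero _ (by norm_num)) Real.pi_ne_zero
    have t1 := hasDerivAt_iff_tendsto_slope.mp (hgd ν).hasDerivAt
    have t2 := hasDerivAt_iff_tendsto_slope.mp hs
    have t3 := t1.div t2 hs0
    have hsub : {μ : ℝ | ∀ n : ℤ, μ ≠ (n : ℝ)} ⊆ {ν}ᶜ := fun μ h1 h2 => h1 n (by simpa [hn] using h2)
    refine ⟨_, (t3.mono_left (nhdsWithin_mono _ hsub)).congr' ?_⟩
    filter_upwards [self_mem_nhdsWithin] with μ hμ
    have hne : μ - ν ≠ 0 := sub_ne_zero.mpr fun h => hsub hμ h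
    simp only [Pi.div_apply, slope_def_field, g0, s0, sub_zero]
    have := NI.sin_ne (ν := μ) hμ
    field_simp
    rfl

lemma NI_ev (ν : ℝ) : ∀ᶠ μ in 𝓝[{μ : ℝ | ∀ n : ℤ, μ ≠ (n : ℝ)}] ν, NI μ := self_mem_nhdsWithin

lemma besselY_tendsto {ν : ℝ} (hν : 0 ≤ ν) {x : ℝ} (hx : 0 < x) :
    Tendsto (fun μ => besselY μ x) (𝓝[{μ : ℝ | ∀ n : ℤ, μ ≠ (n : ℝ)}] ν) (𝓝 (besselY ν x)) := by
  obtain ⟨L, hL⟩ := besselY_lim_exists hν hx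
  have : besselY ν x = L := hL.limUnder_eq
  rw [this]
  refine hL.congr' ?_
  filter_upwards [NI_ev ν] with μ hμ
  exact (besselY_eq hμ hx).symm

lemma NI_shift (ν : ℝ) : Tendsto (fun μ : ℝ => μ + 1) (𝓝[{μ : ℝ | ∀ n : ℤ, μ ≠ (n : ℝ)}] ν) (𝓝[{μ : ℝ | ∀ n : ℤ, μ ≠ (n : ℝ)}] (ν + 1)) := by
  refine tendsto_nhdsWithin_iff.mpr ⟨?_, ?_⟩
  · exact ((continuous_id.add continuous_const).tendsto ν).mono_left nhdsWithin_le_nhds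
  · filter_upwards [NI_ev ν] with μ hμ using NI.add_one hμ

lemma besselY_tendsto1 {ν : ℝ} (hν : 0 ≤ ν) {x : ℝ} (hx : 0 < x) :
    Tendsto (fun μ => besselY (μ + 1) x) (𝓝[{μ : ℝ | ∀ n : ℤ, μ ≠ (n : ℝ)}] ν) (𝓝 (besselY (ν + 1) x)) :=
  (besselY_tendsto (by linarith : 0 ≤ ν + 1) hx).comp (NI_shift ν)

lemma besselY_tendsto2 {ν : ℝ} (hν : 0 ≤ ν) {x : ℝ} (hx : 0 < x) :
    Tendsto (fun μ => besselY (μ + 2) x) (𝓝[{μ : ℝ | ∀ n : ℤ, μ ≠ (n : ℝ)}] ν) (𝓝 (besselY (ν + 2) x)) := by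
  have := (besselY_tendsto1 (by linarith : 0 ≤ ν + 1) hx).comp (NI_shift ν)
  rw [show ν + 1 + 1 = ν + 2 by ring] at this
  refine this.congr fun μ => ?_
  simp only [Function.comp]
  rw [show μ + 1 + 1 = μ + 2 by ring]

lemma NI_cont {f : ℝ → ℝ} (hf : Continuous f) (ν : ℝ) :
    Tendsto f (𝓝[{μ : ℝ | ∀ n : ℤ, μ ≠ (n : ℝ)}] ν) (𝓝 (f ν)) := (hf.tendsto ν).mono_left nhdsWithin_le_nhds

lemma besselY_rec {ν : ℝ} (hν : 0 ≤ ν) {x : ℝ} (hx : 0 < x) :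
    besselY ν x + besselY (ν + 2) x = 2 * (ν + 1) / x * besselY (ν + 1) x := by
  refine tendsto_nhds_unique ((besselY_tendsto hν hx).add (besselY_tendsto2 hν hx)) ?_
  have h1 := (NI_cont (f := fun μ => 2 * (μ + 1) / x) (by fun_prop) ν).mul (besselY_tendsto1 hν hx)
  refine h1.congr' ?_
  filter_upwards [NI_ev ν] with μ hμ
  exact (besselY_rec_NI hμ hx).symm

lemma wronskian {ν : ℝ} (hν : 0 ≤ ν) {x : ℝ} (hx : 0 < x) :
    besselJ (ν + 1) x * besselY ν x - besselJ ν x * besselY (ν + 1) x = 2 / (π * x) := by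
  have hc := (besselJ_differentiable_order hx).continuous
  have hc1 : Continuous fun μ => besselJ (μ + 1) x := hc.comp (continuous_id.add continuous_const)
  refine tendsto_nhds_unique (((NI_cont hc1 ν).mul (besselY_tendsto hν hx)).sub ((NI_cont hc ν).mul (besselY_tendsto1 hν hx))) ?_
  refine tendsto_const_nhds.congr' ?_
  filter_upwards [NI_ev ν] with μ hμ
  exact (wronskian_NI hμ hx).symm

lemma NI_pos {ν : ℝ} (hν : 0 < ν) : ∀ᶠ μ in 𝓝[{μ : ℝ | ∀ n : ℤ, μ ≠ (n : ℝ)}] ν, 0 < μ :=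
  nhdsWithin_le_nhds (lt_mem_nhds hν)

lemma nicholson {ν : ℝ} (hν : 0 < ν) {x : ℝ} (hx : 0 < x) :
    besselJ ν x ^ 2 + besselY ν x ^ 2 = 2 / (π * ell) * nicF 0 ν x := by
  have hc := (besselJ_differentiable_order hx).continuous
  refine tendsto_nhds_unique (((NI_cont hc ν).pow 2).add ((besselY_tendsto hν.le hx).pow 2)) ?_
  refine ((NI_cont (nic0_cont hx) ν).const_mul _).congr' ?_
  filter_upwards [NI_ev ν, NI_pos hν] with μ hμ h0
  exact (nicholson_NI h0.le hμ hx).symm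

lemma taylor2 {f f1 f2 : ℝ → ℝ} {a b K x y : ℝ} (h1 : ∀ t ∈ Icc a b, HasDerivAt f (f1 t) t)
    (h2 : ∀ t ∈ Icc a b, HasDerivAt f1 (f2 t) t) (hK : ∀ t ∈ Icc a b, |f2 t| ≤ K) (hx : x ∈ Icc a b) (hy : y ∈ Icc a b) :
    |f y - f x - f1 x * (y - x)| ≤ K * |y - x| ^ 2 := by
  have hK0 : 0 ≤ K := (abs_nonneg _).trans (hK x hx)
  have hsub : uIcc x y ⊆ Icc a b := uIcc_subset_Icc hx hy
  have m1 : ∀ t ∈ uIcc x y, ‖f1 t - f1 x‖ ≤ K * |y - x| := by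
    intro t ht
    have := (convex_Icc a b).norm_image_sub_le_of_norm_hasDerivWithin_le (fun s hs => (h2 s hs).hasDerivWithinAt) hK hx (hsub ht)
    refine this.trans ?_
    gcongr
    rw [Real.norm_eq_abs]
    exact abs_sub_left_of_mem_uIcc ht
  have := (convex_uIcc x y).norm_image_sub_le_of_norm_hasDerivWithin_le (f := fun t => f t - f1 x * t) (f' := fun t => f1 t - f1 x)
    (fun s hs => (((h1 s (hsub hs)).fun_sub ((hasDerivAt_id' s).const_mul (f1 x))).congr_deriv (by ring)).hasDerivWithinAt) m1 left_mem_uIcc right_mem_uIcc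
  rw [Real.norm_eq_abs, Real.norm_eq_abs] at this
  calc _ = |f y - f1 x * y - (f x - f1 x * x)| := by congr 1; ring
    _ ≤ _ := this
    _ = _ := by ring

lemma hasDerivAt_of_quad {f : ℝ → ℝ} {D K x a b : ℝ} (ha : a < x) (hb : x < b)
    (h : ∀ y ∈ Icc a b, |f y - f x - D * (y - x)| ≤ K * |y - x| ^ 2) : HasDerivAt f D x := by
  have h1 : (fun y => f y - f x - D * (y - x)) =O[𝓝 x] fun y => ‖y - x‖ ^ 2 := by
    refine Asymptotics.IsBigO.of_bound K ?_
    filter_upwards [Icc_mem_nhds ha hb] with y hy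
    simpa using h y hy
  have h2 := (h1.hasFDerivAt (𝕜 := ℝ) (by norm_num)).hasDerivAt
  have h3 := (h2.fun_add (((hasDerivAt_id' x).sub_const x).const_mul D)).add_const (f x)
  have e : (fun y => f y - f x - D * (y - x) + D * (y - x) + f x) = f := by ext y; ring
  rw [e] at h3
  simpa using h3

lemma Y_bound {ν a t : ℝ} (hν : 0 < ν) (ha : 0 < a) (hat : a ≤ t) {μ : ℝ} (h : ν ≤ μ) :
    |besselY ν t| ≤ √(2 / (π * ell) * nicF 0 μ a) := by
  apply Real.abs_le_sqrt
  have h1 := nicholson hν (ha.trans_le hat)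
  have h2 := nic0_mono hν.le h (ha.trans_le hat)
  have h3 := nic0_anti μ ha hat
  have := ell_pos
  have := Real.pi_pos
  have h4 : 2 / (π * ell) * nicF 0 ν t ≤ 2 / (π * ell) * nicF 0 μ a := by gcongr; linarith
  nlinarith [sq_nonneg (besselJ ν t)]

lemma besselY_deriv {ν : ℝ} (hν : 0 < ν) {x : ℝ} (hx : 0 < x) :
    HasDerivAt (besselY ν) (ν / x * besselY ν x - besselY (ν + 1) x) x := by
  set a := x / 2 with ha'
  have ha : 0 < a := half_pos hx
  set M := √(2 / (π * ell) * nicF 0 (ν + 2) a) with hM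
  have hM0 : 0 ≤ M := Real.sqrt_nonneg _
  set n := ν + 1 with hn
  have hn0 : 0 < n := by linarith
  refine hasDerivAt_of_quad (a := a) (b := 2 * x) (K := (n / a ^ 2 + n / a * (n / a + 1) + (1 + (n + 1) / a)) * M) (by linarith) (by linarith) ?_
  intro y hy
  have hy0 : 0 < y := ha.trans_le hy.1
  have lim := (((besselY_tendsto hν.le hy0).sub (besselY_tendsto hν.le hx)).sub
    ((((NI_cont (f := fun μ => μ / x) (by fun_prop) ν).mul (besselY_tendsto hν.le hx)).sub (besselY_tendsto1 hν.le hx)).mul_const (y - x))).abs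
  refine le_of_tendsto lim ?_
  filter_upwards [NI_ev ν, NI_pos hν, nhdsWithin_le_nhds (gt_mem_nhds (by linarith : ν < ν + 1))] with μ hμ h0 h1
  refine taylor2 (a := a) (b := 2 * x) (f := besselY μ) (f1 := fun t => μ / t * besselY μ t - besselY (μ + 1) t)
    (f2 := fun t => -(μ / t ^ 2) * besselY μ t + μ / t * (μ / t * besselY μ t - besselY (μ + 1) t) - (besselY μ t - (μ + 1) / t * besselY (μ + 1) t))
    ?_ ?_ ?_ ⟨by linarith, by linarith⟩ hy
  · intro t ht
    exact besselY_deriv_NI hμ (ha.trans_le ht.1)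
  · intro t ht
    have ht0 := ha.trans_le ht.1
    have hd : HasDerivAt (fun t => μ / t) (-(μ / t ^ 2)) t := by
      have := (hasDerivAt_const t μ).fun_div (hasDerivAt_id' t) ht0.ne'
      refine this.congr_deriv ?_
      field_simp; ring
    exact (hd.fun_mul (besselY_deriv_NI hμ ht0)).fun_sub (besselY_deriv1_NI hμ ht0)
  · intro t ht
    have ht0 := ha.trans_le ht.1
    have b1 : |besselY μ t| ≤ M := Y_bound h0 ha ht.1 (by linarith)
    have b2 : |besselY (μ + 1) t| ≤ M := Y_bound (by linarith) ha ht.1 (by linarith)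
    have c1 : μ / t ≤ n / a := by have := ht.1; gcongr
    have c2 : μ / t ^ 2 ≤ n / a ^ 2 := by have := ht.1; gcongr
    have c3 : (μ + 1) / t ≤ (n + 1) / a := by have := ht.1; gcongr
    have d1 : 0 ≤ μ / t := by positivity
    have d2 : 0 ≤ μ / t ^ 2 := by positivity
    have d3 : 0 ≤ (μ + 1) / t := by positivity
    generalize besselY μ t = A at *
    generalize besselY (μ + 1) t = B at *
    have e1 : |μ / t * A - B| ≤ (n / a + 1) * M := by
      refine (abs_sub _ _).trans ?_
      rw [abs_mul, abs_of_nonneg d1]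
      have : μ / t * |A| ≤ n / a * M := by gcongr
      linarith
    have e2 : |A - (μ + 1) / t * B| ≤ (1 + (n + 1) / a) * M := by
      refine (abs_sub _ _).trans ?_
      rw [abs_mul, abs_of_nonneg d3]
      have : (μ + 1) / t * |B| ≤ (n + 1) / a * M := by gcongr
      linarith
    refine (abs_sub _ _).trans ?_
    refine (add_le_add_left (abs_add_le _ _) _).trans ?_
    rw [abs_mul, abs_mul (μ / t), abs_neg, abs_of_nonneg d1, abs_of_nonneg d2]
    have f1 : μ / t ^ 2 * |A| ≤ n / a ^ 2 * M := by gcongr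
    have f2 : μ / t * |μ / t * A - B| ≤ n / a * ((n / a + 1) * M) := by gcongr
    linarith

lemma besselY_deriv1 {ν : ℝ} (hν : 0 < ν) {x : ℝ} (hx : 0 < x) :
    HasDerivAt (besselY (ν + 1)) (besselY ν x - (ν + 1) / x * besselY (ν + 1) x) x := by
  refine (besselY_deriv (by linarith) hx).congr_deriv ?_
  have := besselY_rec hν.le hx
  rw [show ν + 1 + 1 = ν + 2 by ring]
  linear_combination -this



lemma mono_lim_le {f : ℝ → ℝ} {b L : ℝ} (hb : 0 < b) (hm : MonotoneOn f (Ioc 0 b)) (hl : Tendsto f (𝓝[>] 0) (𝓝 L)) : L ≤ f b := by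
  refine le_of_tendsto hl ?_
  filter_upwards [Ioc_mem_nhdsGT hb] with y hy
  exact hm hy ⟨hb, le_rfl⟩ hy.2

lemma mono_of_hasDerivAt {f f' : ℝ → ℝ} {b : ℝ} (hc : ContinuousOn f (Ioc 0 b)) (hd : ∀ x ∈ Ioo 0 b, HasDerivAt f (f' x) x)
    (h0 : ∀ x ∈ Ioo 0 b, 0 ≤ f' x) : MonotoneOn f (Ioc 0 b) := by
  refine monotoneOn_of_deriv_nonneg (convex_Ioc 0 b) hc ?_ ?_
  · rw [interior_Ioc]; exact fun x hx => (hd x hx).differentiableAt.differentiableWithinAt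
  · rw [interior_Ioc]; intro x hx; rw [(hd x hx).deriv]; exact h0 x hx

lemma angle_compare {D Q a D2 Q2 a2 : ℝ → ℝ}
    (hD : ∀ x > 0, HasDerivAt D (a x * Q x) x) (hQ : ∀ x > 0, HasDerivAt Q (-(a x * D x)) x) (h1 : ∀ x > 0, D x ^ 2 + Q x ^ 2 = 1)
    (hQ2 : ∀ x > 0, HasDerivAt Q2 (-(a2 x * D2 x)) x) (h2 : ∀ x > 0, D2 x ^ 2 + Q2 x ^ 2 = 1)
    (ha : ∀ x > 0, 0 < a x) (ha2 : ∀ x > 0, a x ≤ a2 x) (l : Tendsto Q (𝓝[>] 0) (𝓝 1)) (l2 : Tendsto Q2 (𝓝[>] 0) (𝓝 1))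
    (hD2 : ∀ x > 0, 0 < D2 x) : ∀ x > 0, 0 < D x := by
  have lD : Tendsto D (𝓝[>] 0) (𝓝 0) := by
    have h3 : Tendsto (fun x => √(1 - Q x ^ 2)) (𝓝[>] 0) (𝓝 0) := by
      have := ((tendsto_const_nhds (x := (1 : ℝ))).sub (l.pow 2)).sqrt
      simpa using this
    refine squeeze_zero_norm' ?_ h3
    filter_upwards [self_mem_nhdsWithin] with x hx
    exact Real.abs_le_sqrt (by linarith [h1 x hx])
  obtain ⟨r, hr, hQr⟩ : ∃ r > 0, ∀ x ∈ Ioc 0 r, 0 < Q x := by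
    have := l.eventually (lt_mem_nhds one_pos)
    obtain ⟨r, hr, h⟩ := (mem_nhdsGT_iff_exists_Ioc_subset).mp this
    exact ⟨r, hr, fun x hx => h hx⟩
  have hDc : ContinuousOn D (Ioi 0) := fun x hx => (hD x hx).continuousAt.continuousWithinAt
  have hQc : ContinuousOn Q (Ioi 0) := fun x hx => (hQ x hx).continuousAt.continuousWithinAt
  have hQ2c : ContinuousOn Q2 (Ioi 0) := fun x hx => (hQ2 x hx).continuousAt.continuousWithinAt
  have hDr : ∀ x ∈ Ioc 0 r, 0 < D x := by
    intro x hx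
    have sm : StrictMonoOn D (Ioc 0 x) := by
      refine strictMonoOn_of_deriv_pos (convex_Ioc 0 x) (hDc.mono Ioc_subset_Ioi_self) ?_
      rw [interior_Ioc]
      intro y hy
      rw [(hD y hy.1).deriv]
      exact mul_pos (ha y hy.1) (hQr y ⟨hy.1, hy.2.le.trans hx.2⟩)
    have h3 := mono_lim_le (half_pos hx.1) (sm.monotoneOn.mono (Ioc_subset_Ioc_right (half_lt_self hx.1).le)) lD
    exact h3.trans_lt (sm ⟨half_pos hx.1, (half_lt_self hx.1).le⟩ ⟨hx.1, le_rfl⟩ (half_lt_self hx.1))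
  intro x0 hx0
  by_contra hneg
  push Not at hneg
  have hrx : r < x0 := by
    by_contra h
    push Not at h
    exact absurd (hDr x0 ⟨hx0, h⟩) (not_lt.mpr hneg)
  have hcomp : IsCompact (Icc r x0 ∩ {x | D x ≤ 0}) := by
    have hc : ContinuousOn D (Icc r x0) := hDc.mono fun y hy => lt_of_lt_of_le hr hy.1
    exact isCompact_Icc.of_isClosed_subset (hc.preimage_isClosed_of_isClosed isClosed_Icc isClosed_Iic) inter_subset_left
  obtain ⟨x1, hx1, hleast⟩ := hcomp.exists_isLeast ⟨x0, ⟨hrx.le, le_rfl⟩, hneg⟩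
  have hx1p : 0 < x1 := lt_of_lt_of_le hr hx1.1.1
  have hpos : ∀ x ∈ Ioo 0 x1, 0 < D x := by
    intro x hx
    by_contra h
    push Not at h
    rcases le_or_gt x r with h3 | h3
    · exact absurd (hDr x ⟨hx.1, h3⟩) (not_lt.mpr h)
    · exact absurd (hleast ⟨⟨h3.le, hx.2.le.trans hx1.1.2⟩, h⟩) (not_le.mpr hx.2)
  have hD0 : D x1 = 0 := by
    refine le_antisymm hx1.2 ?_
    have : Tendsto D (𝓝[<] x1) (𝓝 (D x1)) := (hD x1 hx1p).continuousAt.tendsto.mono_left nhdsWithin_le_nhds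
    refine ge_of_tendsto this ?_
    filter_upwards [Ioo_mem_nhdsLT hx1p] with y hy using (hpos y hy).le
  have hQne : ∀ x > 0, 0 < D x → Q x ≠ -1 ∧ Q x ≠ 1 := by
    intro x hx hd
    constructor <;> intro h <;> · have := h1 x hx; rw [h] at this; nlinarith
  have hQ2ne : ∀ x > 0, Q2 x ≠ -1 ∧ Q2 x ≠ 1 := by
    intro x hx
    have hd := hD2 x hx
    constructor <;> intro h <;> · have := h2 x hx; rw [h] at this; nlinarith
  have dα : ∀ x > 0, 0 < D x → HasDerivAt (fun x => Real.arccos (Q x)) (a x) x := by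
    intro x hx hd
    have := (Real.hasDerivAt_arccos (hQne x hx hd).1 (hQne x hx hd).2).comp x (hQ x hx)
    refine this.congr_deriv ?_
    rw [show 1 - Q x ^ 2 = D x ^ 2 by linarith [h1 x hx], Real.sqrt_sq hd.le]
    field_simp
  have dα2 : ∀ x > 0, HasDerivAt (fun x => Real.arccos (Q2 x)) (a2 x) x := by
    intro x hx
    have hd := hD2 x hx
    have := (Real.hasDerivAt_arccos (hQ2ne x hx).1 (hQ2ne x hx).2).comp x (hQ2 x hx)
    refine this.congr_deriv ?_
    rw [show 1 - Q2 x ^ 2 = D2 x ^ 2 by linarith [h2 x hx], Real.sqrt_sq hd.le]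
    field_simp
  have cα : ContinuousOn (fun x => Real.arccos (Q x)) (Ioc 0 x1) :=
    Real.continuous_arccos.comp_continuousOn (hQc.mono Ioc_subset_Ioi_self)
  have cα2 : ContinuousOn (fun x => Real.arccos (Q2 x)) (Ioc 0 x1) :=
    Real.continuous_arccos.comp_continuousOn (hQ2c.mono Ioc_subset_Ioi_self)
  have m1 := mono_of_hasDerivAt cα (fun x hx => dα x hx.1 (hpos x hx)) fun x hx => (ha x hx.1).le
  have m2 := mono_of_hasDerivAt (cα2.sub cα) (fun x hx => (dα2 x hx.1).sub (dα x hx.1 (hpos x hx))) fun x hx => sub_nonneg.mpr (ha2 x hx.1)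
  have lα : Tendsto (fun x => Real.arccos (Q x)) (𝓝[>] 0) (𝓝 0) := by
    have := (Real.continuous_arccos.tendsto 1).comp l
    rwa [Real.arccos_one] at this
  have lα2 : Tendsto (fun x => Real.arccos (Q2 x)) (𝓝[>] 0) (𝓝 0) := by
    have := (Real.continuous_arccos.tendsto 1).comp l2
    rwa [Real.arccos_one] at this
  have l3 := lα2.sub lα
  rw [sub_zero] at l3
  have e1 := mono_lim_le hx1p m2 l3
  have hh := half_pos hx1p
  have hh' := half_lt_self hx1p
  have e2 : Real.arccos (Q (x1 / 2)) ≤ Real.arccos (Q x1) := m1 ⟨hh, hh'.le⟩ ⟨hx1p, le_rfl⟩ hh'.le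
  have e3 : 0 < Real.arccos (Q (x1 / 2)) := by
    rw [Real.arccos_pos]
    have := h1 _ hh
    have := hpos _ ⟨hh, hh'⟩
    nlinarith
  have e4 : Q x1 = -1 := by
    have h3 := h1 x1 hx1p
    rw [hD0] at h3
    have h4 : Q x1 ≠ 1 := by
      intro h; rw [h, Real.arccos_one] at e2; linarith
    have : (Q x1 - 1) * (Q x1 + 1) = 0 := by linarith
    rcases mul_eq_zero.mp this with h | h
    · exact absurd (by linarith) h4
    · linarith
  have e5 : Real.arccos (Q2 x1) = π := by
    refine le_antisymm (Real.arccos_le_pi _) ?_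
    simp only [Pi.sub_apply, e4, Real.arccos_neg_one] at e1
    linarith
  rw [Real.arccos_eq_pi] at e5
  have := h2 x1 hx1p
  have := hD2 x1 hx1p
  nlinarith

/-- modulus squared -/
noncomputable def NN (ν x : ℝ) : ℝ := besselJ ν x ^ 2 + besselY ν x ^ 2

lemma NN_eq {ν : ℝ} (hν : 0 < ν) {x : ℝ} (hx : 0 < x) : NN ν x = 2 / (π * ell) * nicF 0 ν x := nicholson hν hx

lemma kap_pos : 0 < 2 / (π * ell) := by have := ell_pos; have := Real.pi_pos; positivity

lemma NN_pos {ν : ℝ} (hν : 0 < ν) {x : ℝ} (hx : 0 < x) : 0 < NN ν x := by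
  rw [NN_eq hν hx]; exact mul_pos kap_pos (nic0_pos ν hx)

lemma NN_strict {ν μ : ℝ} (hν : 0 < ν) (h : ν < μ) {x : ℝ} (hx : 0 < x) : NN ν x < NN μ x := by
  rw [NN_eq hν hx, NN_eq (hν.trans h) hx]
  exact mul_lt_mul_of_pos_left (nic0_strict hν.le h hx) kap_pos

lemma NN_mono {ν μ : ℝ} (hν : 0 < ν) (h : ν ≤ μ) {x : ℝ} (hx : 0 < x) : NN ν x ≤ NN μ x := by
  rw [NN_eq hν hx, NN_eq (hν.trans_le h) hx]
  exact mul_le_mul_of_nonneg_left (nic0_mono hν.le h hx) kap_pos.le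

lemma NN_anti {ν : ℝ} (hν : 0 < ν) {x y : ℝ} (hx : 0 < x) (h : x ≤ y) : NN ν y ≤ NN ν x := by
  rw [NN_eq hν hx, NN_eq hν (hx.trans_le h)]
  exact mul_le_mul_of_nonneg_left (nic0_anti ν hx h) kap_pos.le

/-- normalised J -/
noncomputable def cJ (ν x : ℝ) : ℝ := besselJ ν x / √(NN ν x)
/-- normalised Y -/
noncomputable def sY (ν x : ℝ) : ℝ := besselY ν x / √(NN ν x)
/-- phase derivative -/
noncomputable def th (ν x : ℝ) : ℝ := 2 / (π * x) / NN ν x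

lemma NN_deriv {ν : ℝ} (hν : 0 < ν) {x : ℝ} (hx : 0 < x) :
    HasDerivAt (NN ν) (2 * besselJ ν x * (ν / x * besselJ ν x - besselJ (ν + 1) x) + 2 * besselY ν x * (ν / x * besselY ν x - besselY (ν + 1) x)) x := by
  have := ((besselJ_deriv ν hx).fun_pow 2).fun_add ((besselY_deriv hν hx).fun_pow 2)
  refine this.congr_deriv ?_
  simp

lemma cJ_deriv {ν : ℝ} (hν : 0 < ν) {x : ℝ} (hx : 0 < x) : HasDerivAt (cJ ν) (-(th ν x * sY ν x)) x := by
  have hN := NN_pos hν hx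
  have hW := wronskian hν.le hx
  have := (besselJ_deriv ν hx).fun_div ((NN_deriv hν hx).sqrt hN.ne') (Real.sqrt_pos.mpr hN).ne'
  refine this.congr_deriv ?_
  unfold th sY
  rw [← hW]
  have hs := Real.sq_sqrt hN.le
  have hs0 := Real.sqrt_pos.mpr hN
  have hdef : √(NN ν x) ^ 2 = besselJ ν x ^ 2 + besselY ν x ^ 2 := by rw [hs]; rfl
  generalize √(NN ν x) = s at *
  rw [← hs]
  field_simp
  linear_combination (ν * besselJ ν x - x * besselJ (ν + 1) x) * hdef

lemma sY_deriv {ν : ℝ} (hν : 0 < ν) {x : ℝ} (hx : 0 < x) : HasDerivAt (sY ν) (th ν x * cJ ν x) x := by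
  have hN := NN_pos hν hx
  have hW := wronskian hν.le hx
  have := (besselY_deriv hν hx).fun_div ((NN_deriv hν hx).sqrt hN.ne') (Real.sqrt_pos.mpr hN).ne'
  refine this.congr_deriv ?_
  unfold th cJ
  rw [← hW]
  have hs := Real.sq_sqrt hN.le
  have hs0 := Real.sqrt_pos.mpr hN
  have hdef : √(NN ν x) ^ 2 = besselJ ν x ^ 2 + besselY ν x ^ 2 := by rw [hs]; rfl
  generalize √(NN ν x) = s at *
  rw [← hs]
  field_simp
  linear_combination (ν * besselY ν x - x * besselY (ν + 1) x) * hdef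

lemma cs_sq {ν : ℝ} (hν : 0 < ν) {x : ℝ} (hx : 0 < x) : cJ ν x ^ 2 + sY ν x ^ 2 = 1 := by
  have hN := NN_pos hν hx
  unfold cJ sY
  rw [div_pow, div_pow, Real.sq_sqrt hN.le, ← add_div]
  exact div_self hN.ne'

lemma J_pos_near {ν : ℝ} (hν : 0 < ν) : ∀ᶠ x in 𝓝[>] 0, 0 < besselJ ν x := by
  have h := besselJ_zero_lim ν
  have hG : 0 < (Real.Gamma (ν + 1))⁻¹ := inv_pos.mpr (Real.Gamma_pos_of_pos (by linarith))
  filter_upwards [h.eventually (lt_mem_nhds hG), self_mem_nhdsWithin] with x hx h0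
  have h0 : 0 < x := h0
  exact pos_of_mul_pos_right hx (by positivity)

lemma J_lim_zero {ν : ℝ} (hν : 0 < ν) : Tendsto (besselJ ν) (𝓝[>] 0) (𝓝 0) := by
  have h := besselJ_zero_lim ν
  have h2 : Tendsto (fun x : ℝ => (x / 2) ^ ν) (𝓝[>] 0) (𝓝 0) := by
    have : ContinuousAt (fun x : ℝ => (x / 2) ^ ν) 0 := (by fun_prop : ContinuousAt (fun x : ℝ => x / 2) 0).rpow_const (Or.inr hν.le)
    have := this.tendsto
    simp only [zero_div, Real.zero_rpow hν.ne'] at this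
    exact this.mono_left nhdsWithin_le_nhds
  have := h2.mul h
  rw [zero_mul] at this
  refine this.congr' ?_
  filter_upwards [self_mem_nhdsWithin] with x h0
  have h0 : 0 < x := h0
  rw [← mul_assoc, ← Real.rpow_add (by positivity)]
  simp

lemma YJ_lim {ν : ℝ} (hν : 0 < ν) : Tendsto (fun x => besselY ν x / besselJ ν x) (𝓝[>] 0) atBot := by
  obtain ⟨r, hr, h⟩ : ∃ r > 0, ∀ x ∈ Ioc 0 r, 0 < besselJ ν x ∧ besselJ ν x < 1 := by
    have := (J_pos_near hν).and ((J_lim_zero hν).eventually (gt_mem_nhds one_pos))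
    obtain ⟨r, hr, h⟩ := (mem_nhdsGT_iff_exists_Ioc_subset).mp this
    exact ⟨r, hr, fun x hx => h hx⟩
  have hd : ∀ x ∈ Ioc 0 r, HasDerivAt (fun x => besselY ν x / besselJ ν x - 2 / π * Real.log x)
      (2 / (π * x) / besselJ ν x ^ 2 - 2 / π * x⁻¹) x := by
    intro x hx
    have hJ := (h x hx).1
    have := ((besselY_deriv hν hx.1).fun_div (besselJ_deriv ν hx.1) hJ.ne').fun_sub ((Real.hasDerivAt_log hx.1.ne').const_mul (2 / π))
    refine this.congr_deriv ?_
    rw [← wronskian hν.le hx.1]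
    congr 2
    ring
  have hm := mono_of_hasDerivAt (b := r) (fun x hx => (hd x hx).continuousAt.continuousWithinAt) (fun x hx => hd x ⟨hx.1, hx.2.le⟩) ?_
  · have hl : Tendsto (fun x => 2 / π * Real.log x + (besselY ν r / besselJ ν r - 2 / π * Real.log r)) (𝓝[>] 0) atBot :=
      tendsto_atBot_add_const_right _ _ ((Real.tendsto_log_nhdsGT_zero).const_mul_atBot (by positivity))
    refine tendsto_atBot_mono' _ ?_ hl
    filter_upwards [Ioc_mem_nhdsGT hr] with x hx
    have := hm hx ⟨hr, le_rfl⟩ hx.2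
    simp only at this
    linarith
  · intro x hx
    have hJ := h x ⟨hx.1, hx.2.le⟩
    have hx0 := hx.1
    have hp := Real.pi_pos
    have : 2 / π * x⁻¹ = 2 / (π * x) := by field_simp
    rw [this, sub_nonneg, le_div_iff₀ (by have := hJ.1; positivity)]
    have h1 : besselJ ν x ^ 2 ≤ 1 := by nlinarith [hJ.1, hJ.2]
    have : 0 < 2 / (π * x) := by positivity
    nlinarith

lemma Y_neg_near {ν : ℝ} (hν : 0 < ν) : ∀ᶠ x in 𝓝[>] 0, besselY ν x < 0 := by
  filter_upwards [(YJ_lim hν).eventually (eventually_lt_atBot 0), J_pos_near hν] with x h1 h2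
  by_contra h
  push Not at h
  have := div_nonneg h h2.le
  linarith

lemma cJ_lim {ν : ℝ} (hν : 0 < ν) : Tendsto (cJ ν) (𝓝[>] 0) (𝓝 0) := by
  have h := (tendsto_inv_atBot_zero.comp (YJ_lim hν)).abs
  rw [abs_zero] at h
  refine squeeze_zero_norm' ?_ h
  filter_upwards [J_pos_near hν, Y_neg_near hν, self_mem_nhdsWithin] with x h1 h2 h0
  have hN := NN_pos hν h0
  simp only [Function.comp, inv_div, cJ]
  rw [norm_div, abs_div, Real.norm_eq_abs, Real.norm_eq_abs, abs_of_nonneg (Real.sqrt_nonneg (NN ν x))]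
  have : |besselY ν x| ≤ √(NN ν x) := Real.abs_le_sqrt (by unfold NN; nlinarith)
  have : 0 < |besselY ν x| := abs_pos.mpr h2.ne
  gcongr

lemma sY_lim {ν : ℝ} (hν : 0 < ν) : Tendsto (sY ν) (𝓝[>] 0) (𝓝 (-1)) := by
  have h := (((tendsto_const_nhds (x := (1 : ℝ))).sub ((cJ_lim hν).pow 2)).sqrt).neg
  simp only [ne_eq, OfNat.ofNat_ne_zero, not_false_eq_true, zero_pow, sub_zero, Real.sqrt_one] at h
  refine h.congr' ?_
  filter_upwards [Y_neg_near hν, self_mem_nhdsWithin] with x h2 h0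
  have hs : sY ν x < 0 := div_neg_of_neg_of_pos h2 (Real.sqrt_pos.mpr (NN_pos hν h0))
  rw [show 1 - cJ ν x ^ 2 = (-sY ν x) ^ 2 by linarith [cs_sq hν h0], Real.sqrt_sq (by linarith)]
  ring

lemma cross_two {ν : ℝ} (hν : 0 < ν) {x : ℝ} (hx : 0 < x) :
    0 < besselJ (ν + 2) x * besselY ν x - besselJ ν x * besselY (ν + 2) x := by
  have h1 := besselJ_rec2 ν hx
  have h2 := besselY_rec hν.le hx
  have hW := wronskian hν.le hx
  have : besselJ (ν + 2) x * besselY ν x - besselJ ν x * besselY (ν + 2) x = 2 * (ν + 1) / x * (2 / (π * x)) := by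
    linear_combination besselY ν x * h1 - besselJ ν x * h2 + 2 * (ν + 1) / x * hW
  rw [this]
  have := Real.pi_pos
  positivity

lemma cross_pos {ν μ : ℝ} (hν : 0 < ν) (h1 : ν < μ) (h2 : μ ≤ ν + 2) {x : ℝ} (hx : 0 < x) :
    0 < besselJ μ x * besselY ν x - besselJ ν x * besselY μ x := by
  have gD : ∀ μ > 0, ∀ x > 0, HasDerivAt (fun x => cJ μ x * sY ν x - cJ ν x * sY μ x)
      ((th ν x - th μ x) * (cJ ν x * cJ μ x + sY ν x * sY μ x)) x := by
    intro μ hμ x hx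
    have := ((cJ_deriv hμ hx).fun_mul (sY_deriv hν hx)).fun_sub ((cJ_deriv hν hx).fun_mul (sY_deriv hμ hx))
    refine this.congr_deriv ?_
    ring
  have gQ : ∀ μ > 0, ∀ x > 0, HasDerivAt (fun x => cJ ν x * cJ μ x + sY ν x * sY μ x)
      (-((th ν x - th μ x) * (cJ μ x * sY ν x - cJ ν x * sY μ x))) x := by
    intro μ hμ x hx
    have := ((cJ_deriv hν hx).fun_mul (cJ_deriv hμ hx)).fun_add ((sY_deriv hν hx).fun_mul (sY_deriv hμ hx))
    refine this.congr_deriv ?_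
    ring
  have g1 : ∀ μ > 0, ∀ x > 0, (cJ μ x * sY ν x - cJ ν x * sY μ x) ^ 2 + (cJ ν x * cJ μ x + sY ν x * sY μ x) ^ 2 = 1 := by
    intro μ hμ x hx
    have a := cs_sq hν hx
    have b := cs_sq hμ hx
    linear_combination (cJ μ x ^ 2 + sY μ x ^ 2) * a + b
  have gl : ∀ μ > 0, Tendsto (fun x => cJ ν x * cJ μ x + sY ν x * sY μ x) (𝓝[>] 0) (𝓝 1) := by
    intro μ hμ
    have := ((cJ_lim hν).mul (cJ_lim hμ)).add ((sY_lim hν).mul (sY_lim hμ))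
    simpa using this
  have gP : ∀ μ > 0, ∀ x > 0, cJ μ x * sY ν x - cJ ν x * sY μ x = (besselJ μ x * besselY ν x - besselJ ν x * besselY μ x) / (√(NN ν x) * √(NN μ x)) := by
    intro μ hμ x hx
    have := Real.sqrt_pos.mpr (NN_pos hν hx)
    have := Real.sqrt_pos.mpr (NN_pos hμ hx)
    unfold cJ sY
    field_simp
  have hμ : 0 < μ := hν.trans h1
  have hν2 : 0 < ν + 2 := by linarith
  have key := angle_compare (gD μ hμ) (gQ μ hμ) (g1 μ hμ) (gQ (ν + 2) hν2) (g1 (ν + 2) hν2) ?_ ?_ (gl μ hμ) (gl (ν + 2) hν2) ?_ x hx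
  · rw [gP μ hμ x hx] at key
    have h3 := mul_pos (Real.sqrt_pos.mpr (NN_pos hν hx)) (Real.sqrt_pos.mpr (NN_pos hμ hx))
    exact (div_pos_iff_of_pos_right h3).mp key
  · intro y hy
    rw [sub_pos]
    unfold th
    have := NN_pos hν hy
    have := NN_strict hν h1 hy
    have := Real.pi_pos
    gcongr
  · intro y hy
    have : th (ν + 2) y ≤ th μ y := by
      unfold th
      have := NN_pos hμ hy
      have := NN_mono hμ h2 hy
      have := Real.pi_pos
      gcongr
    linarith
  · intro y hy
    rw [gP (ν + 2) hν2 y hy]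
    exact div_pos (cross_two hν hy) (mul_pos (Real.sqrt_pos.mpr (NN_pos hν hy)) (Real.sqrt_pos.mpr (NN_pos hν2 hy)))


lemma pos_right_of_deriv {f : ℝ → ℝ} {m a : ℝ} (h : HasDerivAt f m a) (hm : 0 < m) (h0 : f a = 0) :
    ∀ᶠ x in 𝓝[>] a, 0 < f x := by
  have h1 := hasDerivAt_iff_tendsto_slope.mp h
  have h2 : Tendsto (slope f a) (𝓝[>] a) (𝓝 m) := h1.mono_left (nhdsWithin_mono a fun x hx => ne_of_gt hx)
  filter_upwards [h2.eventually (lt_mem_nhds hm), self_mem_nhdsWithin] with x hx hxa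
  have hxa : a < x := hxa
  rw [slope_def_field, h0, sub_zero] at hx
  exact (div_pos_iff_of_pos_right (by linarith)).mp hx

lemma neg_left_of_deriv {f : ℝ → ℝ} {m a : ℝ} (h : HasDerivAt f m a) (hm : 0 < m) (h0 : f a = 0) :
    ∀ᶠ x in 𝓝[<] a, f x < 0 := by
  have h1 := hasDerivAt_iff_tendsto_slope.mp h
  have h2 : Tendsto (slope f a) (𝓝[<] a) (𝓝 m) := h1.mono_left (nhdsWithin_mono a fun x hx => ne_of_lt hx)
  filter_upwards [h2.eventually (lt_mem_nhds hm), self_mem_nhdsWithin] with x hx hxa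
  have hxa : x < a := hxa
  rw [slope_def_field, h0, sub_zero] at hx
  by_contra hc
  push Not at hc
  exact absurd hx (not_lt.mpr (div_nonpos_of_nonneg_of_nonpos hc (by linarith)))

lemma deriv_nonneg_of_pos_right {f : ℝ → ℝ} {m a b : ℝ} (hab : a < b) (h : HasDerivAt f m a) (h0 : f a = 0)
    (hp : ∀ x ∈ Ioo a b, 0 < f x) : 0 ≤ m := by
  by_contra hc
  push Not at hc
  have h1 := pos_right_of_deriv h.fun_neg (neg_pos.mpr hc) (by simp [h0])
  obtain ⟨x, hx, hx2⟩ := (h1.and (Ioo_mem_nhdsGT hab)).exists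
  linarith [hp x hx2]

lemma deriv_nonpos_of_pos_left {f : ℝ → ℝ} {m a b : ℝ} (hab : a < b) (h : HasDerivAt f m b) (h0 : f b = 0)
    (hp : ∀ x ∈ Ioo a b, 0 < f x) : m ≤ 0 := by
  by_contra hc
  push Not at hc
  have h1 := neg_left_of_deriv h hc h0
  obtain ⟨x, hx, hx2⟩ := (h1.and (Ioo_mem_nhdsLT hab)).exists
  linarith [hp x hx2]

lemma no_two_zeros {g g' : ℝ → ℝ} {c d : ℝ} (hcd : c < d) (hg : ∀ x ∈ Icc c d, HasDerivAt g (g' x) x)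
    (hc : g c = 0) (hd : g d = 0) (hz : ∀ x ∈ Icc c d, g x = 0 → 0 < g' x) : False := by
  have hcm : c ∈ Icc c d := ⟨le_rfl, hcd.le⟩
  obtain ⟨e, he, he2⟩ := ((pos_right_of_deriv (hg c hcm) (hz c hcm hc) hc).and (Ioo_mem_nhdsGT hcd)).exists
  have hcont : ContinuousOn g (Icc e d) := fun x hx =>
    (hg x ⟨he2.1.le.trans hx.1, hx.2⟩).continuousAt.continuousWithinAt
  have hcl : IsClosed {x | x ∈ Icc e d ∧ g x ≤ 0} := by
    have := hcont.preimage_isClosed_of_isClosed isClosed_Icc (isClosed_Iic (a := (0:ℝ)))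
    exact this
  have hcomp : IsCompact {x | x ∈ Icc e d ∧ g x ≤ 0} :=
    isCompact_Icc.of_isClosed_subset hcl fun x hx => hx.1
  obtain ⟨w, hw, hleast⟩ := hcomp.exists_isLeast ⟨d, ⟨⟨he2.2.le, le_rfl⟩, hd.le⟩⟩
  have hew : e < w := by
    rcases hw.1.1.lt_or_eq with h | h
    · exact h
    · exfalso; have := hw.2; rw [← h] at this; linarith
  have hpos : ∀ x ∈ Ioo e w, 0 < g x := by
    intro x hx
    by_contra h
    push Not at h
    exact absurd (hleast ⟨⟨hx.1.le, hx.2.le.trans hw.1.2⟩, h⟩) (not_le.mpr hx.2)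
  have hwm : w ∈ Icc c d := ⟨he2.1.le.trans hw.1.1, hw.1.2⟩
  have hw0 : g w = 0 := by
    refine le_antisymm hw.2 ?_
    have : Tendsto g (𝓝[<] w) (𝓝 (g w)) := (hg w hwm).continuousAt.tendsto.mono_left nhdsWithin_le_nhds
    refine ge_of_tendsto this ?_
    filter_upwards [Ioo_mem_nhdsLT hew] with y hy using (hpos y hy).le
  have := deriv_nonpos_of_pos_left hew (hg w hwm) hw0 hpos
  linarith [hz w hwm hw0]

lemma half_aux {f g f' g' : ℝ → ℝ} {a b : ℝ} (ha : 0 < a) (hab : a < b)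
    (hf : ∀ x > 0, HasDerivAt f (f' x) x) (hg : ∀ x > 0, HasDerivAt g (g' x) x)
    (h1 : ∀ x > 0, f x = 0 → f' x * g x < 0) (h2 : ∀ x > 0, g x = 0 → 0 < g' x * f x)
    (fa : f a = 0) (fb : f b = 0) (hp : ∀ x ∈ Ioo a b, 0 < f x) :
    ∃! x, x ∈ Ioo a b ∧ g x = 0 := by
  have hb := ha.trans hab
  have da := deriv_nonneg_of_pos_right hab (hf a ha) fa hp
  have db := deriv_nonpos_of_pos_left hab (hf b hb) fb hp
  have ga : g a < 0 := by
    by_contra h; push Not at h; have := mul_nonneg da h; linarith [h1 a ha fa]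
  have gb : 0 < g b := by
    by_contra h; push Not at h; have := mul_nonneg_of_nonpos_of_nonpos db h; linarith [h1 b hb fb]
  have hcont : ContinuousOn g (Icc a b) := fun x hx =>
    (hg x (ha.trans_le hx.1)).continuousAt.continuousWithinAt
  obtain ⟨x, hx, hx0⟩ := intermediate_value_Ioo hab.le hcont (show (0:ℝ) ∈ Ioo (g a) (g b) from ⟨ga, gb⟩)
  have key : ∀ c d, c ∈ Ioo a b → d ∈ Ioo a b → g c = 0 → g d = 0 → ¬ c < d := by
    intro c d hc hd gc gd hcd
    refine no_two_zeros hcd (fun x hx => hg x ((ha.trans hc.1).trans_le hx.1)) gc gd ?_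
    intro x hx gx
    have hxp : 0 < x := (ha.trans hc.1).trans_le hx.1
    exact pos_of_mul_pos_left (h2 x hxp gx) (hp x ⟨hc.1.trans_le hx.1, hx.2.trans_lt hd.2⟩).le
  refine ⟨x, ⟨hx, hx0⟩, ?_⟩
  rintro y ⟨hy, hy0⟩
  exact le_antisymm (not_lt.mp (key x y hx hy hx0 hy0)) (not_lt.mp (key y x hy hx hy0 hx0))

lemma half_main {f g f' g' : ℝ → ℝ}
    (hf : ∀ x > 0, HasDerivAt f (f' x) x) (hg : ∀ x > 0, HasDerivAt g (g' x) x)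
    (h1 : ∀ x > 0, f x = 0 → f' x * g x < 0) (h2 : ∀ x > 0, g x = 0 → 0 < g' x * f x) :
    InterlaceHalf f g (Ioi 0) := by
  intro a ha b hb hab fa fb hne
  have ha : 0 < a := ha
  have hcont : ContinuousOn f (Ioo a b) := fun x hx =>
    (hf x (ha.trans hx.1)).continuousAt.continuousWithinAt
  have hsign : (∀ x ∈ Ioo a b, 0 < f x) ∨ (∀ x ∈ Ioo a b, f x < 0) := by
    by_contra hc
    push Not at hc
    obtain ⟨⟨x, hx, hx1⟩, y, hy, hy1⟩ := hc
    have := isPreconnected_Ioo.intermediate_value hx hy hcont ⟨hx1, hy1⟩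
    obtain ⟨z, hz, hz0⟩ := this
    exact hne z hz hz0
  rcases hsign with hp | hp
  · exact half_aux ha hab hf hg h1 h2 fa fb hp
  · have := half_aux (f := fun x => -f x) (g := fun x => -g x) (f' := fun x => -f' x) (g' := fun x => -g' x)
      ha hab (fun x hx => (hf x hx).fun_neg) (fun x hx => (hg x hx).fun_neg)
      (fun x hx h => by have := h1 x hx (neg_eq_zero.mp h); linarith)
      (fun x hx h => by have := h2 x hx (neg_eq_zero.mp h); linarith)
      (by simp [fa]) (by simp [fb]) (fun x hx => neg_pos.mpr (hp x hx))
    simpa only [neg_eq_zero] using this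

lemma interlaced_main {f g f' g' : ℝ → ℝ}
    (hf : ∀ x > 0, HasDerivAt f (f' x) x) (hg : ∀ x > 0, HasDerivAt g (g' x) x)
    (h1 : ∀ x > 0, f x = 0 → f' x * g x < 0) (h2 : ∀ x > 0, g x = 0 → 0 < g' x * f x) :
    InterlacedOn f g (Ioi 0) := by
  refine ⟨half_main hf hg h1 h2, ?_⟩
  have := half_main (f := g) (f' := g') (g := fun x => -f x) (g' := fun x => -f' x) hg
    (fun x hx => (hf x hx).fun_neg) (fun x hx h => by have := h2 x hx h; linarith)
    (fun x hx h => by have := h1 x hx (neg_eq_zero.mp h); linarith)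
  unfold InterlaceHalf at this ⊢
  simpa only [neg_eq_zero] using this

/-! cylinder functions -/

lemma cyl_deriv (δ : ℝ) {ν : ℝ} (hν : 0 < ν) {x : ℝ} (hx : 0 < x) :
    HasDerivAt (cylinder δ ν) (ν / x * cylinder δ ν x - cylinder δ (ν + 1) x) x := by
  have := ((besselJ_deriv ν hx).const_mul (Real.cos δ)).fun_sub ((besselY_deriv hν hx).const_mul (Real.sin δ))
  refine this.congr_deriv ?_
  unfold cylinder; ring

lemma cyl_lam (δ : ℝ) {ν : ℝ} {x : ℝ} (h : cylinder δ ν x = 0) :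
    ∃ l : ℝ, besselJ ν x = l * Real.sin δ ∧ besselY ν x = l * Real.cos δ := by
  unfold cylinder at h
  have hs := Real.sin_sq_add_cos_sq δ
  refine ⟨Real.sin δ * besselJ ν x + Real.cos δ * besselY ν x, ?_, ?_⟩
  · linear_combination (-besselJ ν x) * hs + Real.cos δ * h
  · linear_combination (-besselY ν x) * hs - Real.sin δ * h

lemma cyl_A (δ : ℝ) {ν μ : ℝ} (hν : 0 < ν) (h1 : ν < μ) (h2 : μ ≤ ν + 2) {x : ℝ} (hx : 0 < x)
    (h : cylinder δ ν x = 0) : (ν / x * cylinder δ ν x - cylinder δ (ν + 1) x) * cylinder δ μ x < 0 := by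
  obtain ⟨l, hJ, hY⟩ := cyl_lam δ h
  have hP := cross_pos hν h1 h2 hx
  have hW := wronskian hν.le hx
  have hW0 : 0 < 2 / (π * x) := by have := Real.pi_pos; positivity
  rw [← hW] at hW0
  rw [h, mul_zero, zero_sub]
  rw [hJ, hY] at hP hW0
  have e1 : 0 < l * cylinder δ (ν + 1) x := by unfold cylinder; nlinarith
  have e2 : 0 < l * cylinder δ μ x := by unfold cylinder; nlinarith
  have := mul_pos e1 e2
  have e3 : 0 < l ^ 2 * (cylinder δ (ν + 1) x * cylinder δ μ x) := by nlinarith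
  have := pos_of_mul_pos_right e3 (sq_nonneg l)
  linarith

lemma cyl_B (δ : ℝ) {ν μ : ℝ} (hν : 0 < ν) (h1 : ν < μ) (h2 : μ ≤ ν + 2) {x : ℝ} (hx : 0 < x)
    (h : cylinder δ μ x = 0) : 0 < (μ / x * cylinder δ μ x - cylinder δ (μ + 1) x) * cylinder δ ν x := by
  obtain ⟨l, hJ, hY⟩ := cyl_lam δ h
  have hP := cross_pos hν h1 h2 hx
  have hW := wronskian (hν.trans h1).le hx
  have hW0 : 0 < 2 / (π * x) := by have := Real.pi_pos; positivity
  rw [← hW] at hW0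
  rw [h, mul_zero, zero_sub]
  rw [hJ, hY] at hP hW0
  have e1 : 0 < l * cylinder δ (μ + 1) x := by unfold cylinder; nlinarith
  have e2 : 0 < -(l * cylinder δ ν x) := by unfold cylinder; nlinarith
  have := mul_pos e1 e2
  have e3 : 0 < l ^ 2 * (-(cylinder δ (μ + 1) x * cylinder δ ν x)) := by nlinarith
  have := pos_of_mul_pos_right e3 (sq_nonneg l)
  linarith

lemma part_i (δ : ℝ) {ν μ : ℝ} (hν : 0 < ν) (h1 : ν < μ) (h2 : μ ≤ ν + 2) :
    InterlacedOn (cylinder δ ν) (cylinder δ μ) (Ioi 0) :=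
  interlaced_main (fun _ hx => cyl_deriv δ hν hx) (fun _ hx => cyl_deriv δ (hν.trans h1) hx)
    (fun _ hx h => cyl_A δ hν h1 h2 hx h) (fun _ hx h => cyl_B δ hν h1 h2 hx h)

lemma cyl_J (ν : ℝ) : cylinder 0 ν = besselJ ν := by
  funext x; simp [cylinder]

lemma cyl_Y (ν : ℝ) : cylinder (-(π / 2)) ν = besselY ν := by
  funext x; simp [cylinder]

/-! Bessel equation -/

/-- `u` solves the Bessel equation of order `ν`, with derivative `u'`. -/
def Sol (ν : ℝ) (u u' : ℝ → ℝ) : Prop :=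
  ∀ x > 0, HasDerivAt u (u' x) x ∧ HasDerivAt u' (-(u' x) / x + (ν ^ 2 / x ^ 2 - 1) * u x) x

lemma cyl_deriv1 (δ : ℝ) {ν : ℝ} (hν : 0 < ν) {x : ℝ} (hx : 0 < x) :
    HasDerivAt (cylinder δ (ν + 1)) (cylinder δ ν x - (ν + 1) / x * cylinder δ (ν + 1) x) x := by
  have := ((besselJ_deriv1 ν hx).const_mul (Real.cos δ)).fun_sub ((besselY_deriv1 hν hx).const_mul (Real.sin δ))
  refine this.congr_deriv ?_
  unfold cylinder; ring

/-- derivative of the cylinder function -/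
noncomputable def cyl' (δ ν x : ℝ) : ℝ := ν / x * cylinder δ ν x - cylinder δ (ν + 1) x

lemma cyl_sol (δ : ℝ) {ν : ℝ} (hν : 0 < ν) : Sol ν (cylinder δ ν) (cyl' δ ν) := by
  intro x hx
  refine ⟨cyl_deriv δ hν hx, ?_⟩
  have := ((((hasDerivAt_const x ν).fun_div (hasDerivAt_id' x) hx.ne').fun_mul (cyl_deriv δ hν hx))).fun_sub (cyl_deriv1 δ hν hx)
  refine this.congr_deriv ?_
  unfold cyl'
  field_simp
  ring

lemma Sol.xder {ν : ℝ} {u u' : ℝ → ℝ} (h : Sol ν u u') {x : ℝ} (hx : 0 < x) :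
    HasDerivAt (fun x => x * u' x) ((ν ^ 2 / x - x) * u x) x := by
  have := (hasDerivAt_id' x).fun_mul (h x hx).2
  refine this.congr_deriv ?_
  field_simp
  ring

lemma Sol.neg {ν : ℝ} {u u' : ℝ → ℝ} (h : Sol ν u u') : Sol ν (fun x => -u x) (fun x => -u' x) := by
  intro x hx
  refine ⟨(h x hx).1.fun_neg, ((h x hx).2.fun_neg).congr_deriv ?_⟩
  ring

lemma le_of_hasDerivAt_nonpos {f f' : ℝ → ℝ} {a : ℝ} (hd : ∀ x, a ≤ x → HasDerivAt f (f' x) x)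
    (h0 : ∀ x, a ≤ x → f' x ≤ 0) {x y : ℝ} (hx : a ≤ x) (hxy : x ≤ y) : f y ≤ f x := by
  have : AntitoneOn f (Ici a) := by
    refine antitoneOn_of_deriv_nonpos (convex_Ici a) (fun x hx => (hd x hx).continuousAt.continuousWithinAt)
      (fun x hx => (hd x (interior_subset hx)).differentiableAt.differentiableWithinAt) ?_
    intro x hx
    rw [(hd x (interior_subset hx)).deriv]
    exact h0 x (interior_subset hx)
  exact this hx (hx.trans hxy) hxy

lemma osc_aux {ν : ℝ} (hν : 0 < ν) {u u' : ℝ → ℝ} (h : Sol ν u u') {X : ℝ} (hX : 0 < X)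
    (hp : ∀ x > X, 0 < u x) : False := by
  obtain ⟨a, ha1, ha2⟩ : ∃ a, X < a ∧ ν + 1 ≤ a :=
    ⟨max X ν + 1, by linarith [le_max_left X ν], by linarith [le_max_right X ν]⟩
  have ha : 0 < a := hX.trans ha1
  have hb : ∀ x, a ≤ x → ν ^ 2 / x - x ≤ -1 := by
    intro x hx
    have hx0 : 0 < x := ha.trans_le hx
    have : ν ^ 2 / x ≤ x - 1 := by
      rw [div_le_iff₀ hx0]; nlinarith
    linarith
  have panti : ∀ x y, a ≤ x → x ≤ y → y * u' y ≤ x * u' x := by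
    intro x y hx hxy
    refine le_of_hasDerivAt_nonpos (f := fun x => x * u' x) (fun x hx => h.xder (ha.trans_le hx)) ?_ hx hxy
    intro x hx
    have := hb x hx
    have := hp x (ha1.trans_le hx)
    exact mul_nonpos_of_nonpos_of_nonneg (by linarith) this.le
  by_cases hc : ∃ x0, a ≤ x0 ∧ x0 * u' x0 < 0
  · obtain ⟨x0, hx0, hq⟩ := hc
    have hx00 : 0 < x0 := ha.trans_le hx0
    set q := x0 * u' x0 with hqd
    have hu0 := hp x0 (ha1.trans_le hx0)
    have key : ∀ y, x0 ≤ y → u y - q * Real.log y ≤ u x0 - q * Real.log x0 := by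
      intro y hy
      refine le_of_hasDerivAt_nonpos (a := x0) (f := fun x => u x - q * Real.log x)
        (fun x hx => (h x (hx00.trans_le hx)).1.fun_sub ((Real.hasDerivAt_log (hx00.trans_le hx).ne').const_mul q)) ?_ le_rfl hy
      intro x hx
      have hxp := hx00.trans_le hx
      have := panti x0 x hx0 hx
      have : u' x ≤ q * x⁻¹ := by
        rw [← div_eq_mul_inv, le_div_iff₀ hxp]; linarith
      linarith
    have hy : x0 ≤ x0 * Real.exp (u x0 / (-q)) := by
      have : 1 ≤ Real.exp (u x0 / (-q)) := Real.one_le_exp (div_nonneg hu0.le (by linarith))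
      nlinarith
    have k := key _ hy
    rw [Real.log_mul hx00.ne' (Real.exp_pos _).ne', Real.log_exp] at k
    have e : q * (u x0 / -q) = - u x0 := by
      have := hq.ne
      rw [div_neg, mul_neg, mul_div_cancel₀ _ this]
    have := hp _ (ha1.trans_le (hx0.trans hy))
    nlinarith
  · push Not at hc
    have hu' : ∀ x, a ≤ x → 0 ≤ u' x := fun x hx => nonneg_of_mul_nonneg_right (hc x hx) (ha.trans_le hx)
    have hua := hp a ha1
    have hum : ∀ x, a ≤ x → u a ≤ u x := by
      intro x hx
      have := le_of_hasDerivAt_nonpos (a := a) (f := fun x => -u x) (fun x hx => (h x (ha.trans_le hx)).1.fun_neg)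
        (fun x hx => by have := hu' x hx; linarith) le_rfl hx
      linarith
    have key : ∀ y, a ≤ y → y * u' y + u a * y ≤ a * u' a + u a * a := by
      intro y hy
      refine le_of_hasDerivAt_nonpos (a := a) (f := fun x => x * u' x + u a * x)
        (fun x hx => (h.xder (ha.trans_le hx)).fun_add ((hasDerivAt_id' x).const_mul (u a))) ?_ le_rfl hy
      intro x hx
      have := hb x hx
      have := hum x hx
      nlinarith
    have hca := hc a le_rfl
    have hy : a ≤ a + (a * u' a + 1) / u a := by
      have : 0 ≤ (a * u' a + 1) / u a := by positivity
      linarith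
    have k := key _ hy
    have e : u a * (a + (a * u' a + 1) / u a) = u a * a + (a * u' a + 1) := by field_simp
    have := hc _ hy
    linarith

lemma osc {ν : ℝ} (hν : 0 < ν) {u u' : ℝ → ℝ} (h : Sol ν u u') {X : ℝ} (hX : 0 < X) :
    ∃ x > X, u x = 0 := by
  by_contra hc
  push Not at hc
  have hcont : ContinuousOn u (Ioi X) := fun x hx =>
    (h x (hX.trans hx)).1.continuousAt.continuousWithinAt
  have hsign : (∀ x > X, 0 < u x) ∨ (∀ x > X, u x < 0) := by
    by_contra hc2
    push Not at hc2
    obtain ⟨⟨x, hx, hx1⟩, y, hy, hy1⟩ := hc2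
    obtain ⟨z, hz, hz0⟩ := isPreconnected_Ioi.intermediate_value hx hy hcont ⟨hx1, hy1⟩
    exact hc z hz hz0
  rcases hsign with hp | hp
  · exact osc_aux hν h hX hp
  · exact osc_aux hν h.neg hX fun x hx => neg_pos.mpr (hp x hx)

lemma cross_deriv {ν μ : ℝ} {u u' v v' : ℝ → ℝ} (hu : Sol ν u u') (hv : Sol μ v v') {x : ℝ} (hx : 0 < x) :
    HasDerivAt (fun x => x * v' x * u x - x * u' x * v x) ((μ ^ 2 - ν ^ 2) / x * (u x * v x)) x := by
  have := ((hv.xder hx).fun_mul (hu x hx).1).fun_sub ((hu.xder hx).fun_mul (hv x hx).1)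
  refine this.congr_deriv ?_
  field_simp
  ring

lemma cross_pos_of {ν μ : ℝ} (hν : 0 < ν) (h1 : ν < μ) {u u' v v' : ℝ → ℝ} (hu : Sol ν u u') (hv : Sol μ v v')
    (hA : ∀ x > 0, u x = 0 → u' x * v x < 0) (hB : ∀ x > 0, v x = 0 → 0 < v' x * u x)
    {z : ℝ} (hz : 0 < z) (hIz : 0 < z * v' z * u z - z * u' z * v z) {x : ℝ} (hx : z ≤ x) :
    0 < x * v' x * u x - x * u' x * v x := by
  set I : ℝ → ℝ := fun x => x * v' x * u x - x * u' x * v x with hI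
  have hI0 : ∀ x > 0, u x * v x = 0 → 0 < I x := by
    intro x hx h
    simp only [hI]
    rcases mul_eq_zero.mp h with h | h
    · have := mul_pos hx (neg_pos.mpr (hA x hx h)); rw [h]; linarith
    · have := mul_pos hx (hB x hx h); rw [h]; linarith
  obtain ⟨w, hw, hw0⟩ := osc hν hu (hz.trans_le hx)
  have hcont : ContinuousOn I (Icc z w) := fun y hy =>
    (cross_deriv hu hv (hz.trans_le hy.1)).continuousAt.continuousWithinAt
  obtain ⟨m, hm, hmin⟩ := isCompact_Icc.exists_isMinOn ⟨x, hx, le_of_lt hw⟩ hcont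
  have hm0 : 0 < m := hz.trans_le hm.1
  have hIm : 0 < I m := by
    rcases hm.1.eq_or_lt with h | h
    · rw [← h]; exact hIz
    rcases hm.2.eq_or_lt with h2 | h2
    · exact hI0 m hm0 (by rw [h2, hw0, zero_mul])
    have hl : IsLocalMin I m := hmin.isLocalMin (Icc_mem_nhds h h2)
    have := hl.hasDerivAt_eq_zero (cross_deriv hu hv hm0)
    have hne : (μ ^ 2 - ν ^ 2) / m ≠ 0 := (div_pos (by nlinarith) hm0).ne'
    exact hI0 m hm0 ((mul_eq_zero.mp this).resolve_left hne)
  exact hIm.trans_le (hmin ⟨hx, le_of_lt hw⟩)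

lemma interlaced_deriv {ν μ : ℝ} (hν : 0 < ν) (h1 : ν < μ) {u u' v v' : ℝ → ℝ} (hu : Sol ν u u') (hv : Sol μ v v')
    (hA : ∀ x > 0, u' x = 0 → ν < x ∧ 0 < x * v' x * u x - x * u' x * v x)
    (hB : ∀ x > 0, v' x = 0 → μ < x ∧ 0 < x * v' x * u x - x * u' x * v x) :
    InterlacedOn u' v' (Ioi 0) := by
  refine interlaced_main (fun x hx => (hu x hx).2) (fun x hx => (hv x hx).2) ?_ ?_
  · intro x hx h
    obtain ⟨a, b⟩ := hA x hx h
    have hc : ν ^ 2 / x ^ 2 - 1 < 0 := by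
      rw [sub_neg, div_lt_one (by positivity)]; nlinarith
    rw [h] at b ⊢
    have e : 0 < x * (v' x * u x) := by linarith
    have := pos_of_mul_pos_right e hx.le
    have := mul_neg_of_neg_of_pos hc this
    rw [neg_zero, zero_div, zero_add]
    linarith
  · intro x hx h
    obtain ⟨a, b⟩ := hB x hx h
    have hc : μ ^ 2 / x ^ 2 - 1 < 0 := by
      rw [sub_neg, div_lt_one (by positivity)]; nlinarith [hν.trans h1]
    rw [h] at b ⊢
    have e : 0 < x * (-(u' x * v x)) := by linarith
    have := pos_of_mul_pos_right e hx.le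
    have := mul_neg_of_neg_of_pos hc this
    rw [neg_zero, zero_div, zero_add]
    linarith

lemma interlaced_congr {f g f2 g2 : ℝ → ℝ} (hf : ∀ x > 0, f x = f2 x) (hg : ∀ x > 0, g x = g2 x)
    (h : InterlacedOn f2 g2 (Ioi 0)) : InterlacedOn f g (Ioi 0) := by
  have aux : ∀ {f g f2 g2 : ℝ → ℝ}, (∀ x > 0, f x = f2 x) → (∀ x > 0, g x = g2 x) →
      InterlaceHalf f2 g2 (Ioi 0) → InterlaceHalf f g (Ioi 0) := by
    intro f g f2 g2 hf hg h a ha b hb hab fa fb hne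
    obtain ⟨x, ⟨hx, hx0⟩, hu⟩ := h a ha b hb hab (by rw [← hf a ha]; exact fa) (by rw [← hf b hb]; exact fb)
      (fun x hx => by rw [← hf x (lt_trans ha hx.1)]; exact hne x hx)
    refine ⟨x, ⟨hx, by rw [hg x (lt_trans ha hx.1)]; exact hx0⟩, ?_⟩
    rintro y ⟨hy, hy0⟩
    exact hu y ⟨hy, by rw [← hg y (lt_trans ha hy.1)]; exact hy0⟩
  exact ⟨aux hf hg h.1, aux hg hf h.2⟩


/-- derivative of J -/
noncomputable def dJ (ν x : ℝ) : ℝ := ν / x * besselJ ν x - besselJ (ν + 1) x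
/-- derivative of Y -/
noncomputable def dY (ν x : ℝ) : ℝ := ν / x * besselY ν x - besselY (ν + 1) x

lemma cyl'_J (ν : ℝ) : cyl' 0 ν = dJ ν := by
  funext x; simp only [cyl', dJ, cyl_J]

lemma cyl'_Y (ν : ℝ) : cyl' (-(π / 2)) ν = dY ν := by
  funext x; simp only [cyl', dY, cyl_Y]

lemma solJ {ν : ℝ} (hν : 0 < ν) : Sol ν (besselJ ν) (dJ ν) := by
  rw [← cyl_J, ← cyl'_J]; exact cyl_sol 0 hν

lemma solY {ν : ℝ} (hν : 0 < ν) : Sol ν (besselY ν) (dY ν) := by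
  rw [← cyl_Y, ← cyl'_Y]; exact cyl_sol _ hν

lemma xdJ_lim {ν : ℝ} (hν : 0 < ν) : Tendsto (fun x => x * dJ ν x) (𝓝[>] 0) (𝓝 0) := by
  have hid : Tendsto (fun x : ℝ => x) (𝓝[>] 0) (𝓝 0) := tendsto_id.mono_left nhdsWithin_le_nhds
  have h := ((J_lim_zero hν).const_mul ν).sub (hid.mul (J_lim_zero (by linarith : 0 < ν + 1)))
  simp only [mul_zero, sub_zero] at h
  refine h.congr' ?_
  filter_upwards [self_mem_nhdsWithin] with x hx
  have hx : 0 < x := hx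
  unfold dJ
  field_simp

lemma coef_nonneg {ν x : ℝ} (hx : 0 < x) (h : x ≤ ν) : 0 ≤ ν ^ 2 / x - x := by
  rw [sub_nonneg, le_div_iff₀ hx]; nlinarith

lemma J_pos_le {ν : ℝ} (hν : 0 < ν) {x : ℝ} (hx : 0 < x) (hxν : x ≤ ν) : 0 < besselJ ν x := by
  obtain ⟨r, hr, hr2⟩ := mem_nhdsGT_iff_exists_Ioc_subset.mp (J_pos_near hν)
  have hr : 0 < r := hr
  by_contra hneg
  push Not at hneg
  have hrx : r < x := by
    by_contra h; push Not at h
    have : 0 < besselJ ν x := hr2 ⟨hx, h⟩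
    linarith
  have hcont : ContinuousOn (besselJ ν) (Icc r x) := fun y hy =>
    (besselJ_deriv ν (hr.trans_le hy.1)).continuousAt.continuousWithinAt
  have hcl : IsClosed {y | y ∈ Icc r x ∧ besselJ ν y ≤ 0} :=
    hcont.preimage_isClosed_of_isClosed isClosed_Icc (isClosed_Iic (a := (0:ℝ)))
  have hcomp : IsCompact {y | y ∈ Icc r x ∧ besselJ ν y ≤ 0} :=
    isCompact_Icc.of_isClosed_subset hcl fun x hx => hx.1
  obtain ⟨w, hw, hleast⟩ := hcomp.exists_isLeast ⟨x, ⟨⟨hrx.le, le_rfl⟩, hneg⟩⟩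
  have hw0 : 0 < w := hr.trans_le hw.1.1
  have hpos : ∀ y ∈ Ioo 0 w, 0 < besselJ ν y := by
    intro y hy
    by_contra h
    push Not at h
    rcases le_or_gt y r with h3 | h3
    · have : 0 < besselJ ν y := hr2 ⟨hy.1, h3⟩
      linarith
    · exact absurd (hleast ⟨⟨h3.le, hy.2.le.trans hw.1.2⟩, h⟩) (not_le.mpr hy.2)
  have hS := solJ hν
  have m1 : MonotoneOn (fun x => x * dJ ν x) (Ioc 0 w) := by
    refine mono_of_hasDerivAt (fun y hy => (hS.xder hy.1).continuousAt.continuousWithinAt) (fun y hy => hS.xder hy.1) ?_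
    intro y hy
    exact mul_nonneg (coef_nonneg hy.1 (hy.2.le.trans (hw.1.2.trans hxν))) (hpos y hy).le
  have hd : ∀ y ∈ Ioo 0 w, 0 ≤ dJ ν y := by
    intro y hy
    have := mono_lim_le hy.1 (m1.mono (Ioc_subset_Ioc_right hy.2.le)) (xdJ_lim hν)
    exact nonneg_of_mul_nonneg_right this hy.1
  have m2 : MonotoneOn (besselJ ν) (Ioc 0 w) :=
    mono_of_hasDerivAt (fun y hy => (hS y hy.1).1.continuousAt.continuousWithinAt) (fun y hy => (hS y hy.1).1) hd
  have h1 := m2 ⟨half_pos hw0, (half_lt_self hw0).le⟩ ⟨hw0, le_rfl⟩ (half_lt_self hw0).le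
  have h2 := hpos (w / 2) ⟨half_pos hw0, half_lt_self hw0⟩
  linarith [hw.2]

lemma dJ_pos_le {ν : ℝ} (hν : 0 < ν) {x : ℝ} (hx : 0 < x) (hxν : x ≤ ν) : 0 < dJ ν x := by
  have hS := solJ hν
  have m1 : MonotoneOn (fun x => x * dJ ν x) (Ioc 0 x) := by
    refine mono_of_hasDerivAt (fun y hy => (hS.xder hy.1).continuousAt.continuousWithinAt) (fun y hy => hS.xder hy.1) ?_
    intro y hy
    exact mul_nonneg (coef_nonneg hy.1 (hy.2.le.trans hxν)) (J_pos_le hν hy.1 (hy.2.le.trans hxν)).le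
  have h2 := half_pos hx
  have h3 := half_lt_self hx
  have l := mono_lim_le h2 (m1.mono (Ioc_subset_Ioc_right h3.le)) (xdJ_lim hν)
  have sm : StrictMonoOn (fun x => x * dJ ν x) (Icc (x / 2) x) := by
    refine strictMonoOn_of_deriv_pos (convex_Icc _ _)
      (fun y hy => (hS.xder (h2.trans_le hy.1)).continuousAt.continuousWithinAt) ?_
    intro y hy
    rw [interior_Icc] at hy
    have hy0 := h2.trans hy.1
    rw [(hS.xder hy0).deriv]
    refine mul_pos ?_ (J_pos_le hν hy0 (hy.2.le.trans hxν))
    rw [sub_pos, lt_div_iff₀ hy0]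
    have : y < ν := hy.2.trans_le hxν
    nlinarith
  have := sm ⟨le_rfl, h3.le⟩ ⟨h3.le, le_rfl⟩ h3
  have e : 0 < x * dJ ν x := lt_of_le_of_lt l this
  exact pos_of_mul_pos_right e hx.le

lemma dJ_zero_gt {ν : ℝ} (hν : 0 < ν) {x : ℝ} (hx : 0 < x) (h : dJ ν x = 0) : ν < x := by
  by_contra hc
  push Not at hc
  linarith [dJ_pos_le hν hx hc]

lemma IJ_pos {ν μ : ℝ} (hν : 0 < ν) (h1 : ν < μ) (h2 : μ ≤ ν + 2) {x : ℝ} (hx : 0 < x) :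
    0 < x * dJ μ x * besselJ ν x - x * dJ ν x * besselJ μ x := by
  have hμ := hν.trans h1
  have hA : ∀ x > 0, besselJ ν x = 0 → dJ ν x * besselJ μ x < 0 := by
    intro x hx h
    have := cyl_A 0 hν h1 h2 hx (by rw [cyl_J]; exact h)
    simp only [cyl_J] at this
    exact this
  have hB : ∀ x > 0, besselJ μ x = 0 → 0 < dJ μ x * besselJ ν x := by
    intro x hx h
    have := cyl_B 0 hν h1 h2 hx (by rw [cyl_J]; exact h)
    simp only [cyl_J] at this
    exact this
  have hSν := solJ hν
  have hSμ := solJ hμ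
  -- positivity near zero
  obtain ⟨z, hz0, hzx, hzν⟩ : ∃ z, 0 < z ∧ z ≤ x ∧ z ≤ ν := ⟨min x ν, lt_min hx hν, min_le_left _ _, min_le_right _ _⟩
  have hd : ∀ y, 0 < y → y ≤ z → 0 < (μ ^ 2 - ν ^ 2) / y * (besselJ ν y * besselJ μ y) := by
    intro y hy hyz
    have a := J_pos_le hν hy (hyz.trans hzν)
    have b := J_pos_le hμ hy ((hyz.trans hzν).trans h1.le)
    have c : 0 < μ ^ 2 - ν ^ 2 := by nlinarith
    positivity
  have m1 : MonotoneOn (fun x => x * dJ μ x * besselJ ν x - x * dJ ν x * besselJ μ x) (Ioc 0 z) :=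
    mono_of_hasDerivAt (fun y hy => (cross_deriv hSν hSμ hy.1).continuousAt.continuousWithinAt)
      (fun y hy => cross_deriv hSν hSμ hy.1) (fun y hy => (hd y hy.1 hy.2.le).le)
  have lim : Tendsto (fun x => x * dJ μ x * besselJ ν x - x * dJ ν x * besselJ μ x) (𝓝[>] 0) (𝓝 0) := by
    have := ((xdJ_lim hμ).mul (J_lim_zero hν)).sub ((xdJ_lim hν).mul (J_lim_zero hμ))
    simpa only [mul_zero, sub_zero] using this
  have hz2 := half_pos hz0
  have hz3 := half_lt_self hz0
  have l := mono_lim_le hz2 (m1.mono (Ioc_subset_Ioc_right hz3.le)) lim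
  have sm : StrictMonoOn (fun x => x * dJ μ x * besselJ ν x - x * dJ ν x * besselJ μ x) (Icc (z / 2) z) := by
    refine strictMonoOn_of_deriv_pos (convex_Icc _ _)
      (fun y hy => (cross_deriv hSν hSμ (hz2.trans_le hy.1)).continuousAt.continuousWithinAt) ?_
    intro y hy
    rw [interior_Icc] at hy
    rw [(cross_deriv hSν hSμ (hz2.trans hy.1)).deriv]
    exact hd y (hz2.trans hy.1) hy.2.le
  have hs := sm ⟨le_rfl, hz3.le⟩ ⟨hz3.le, le_rfl⟩ hz3
  exact cross_pos_of hν h1 hSν hSμ hA hB hz0 (lt_of_le_of_lt l hs) hzx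

lemma part_ii {ν μ : ℝ} (hν : 0 < ν) (h1 : ν < μ) (h2 : μ ≤ ν + 2) :
    InterlacedOn (deriv (besselJ ν)) (deriv (besselJ μ)) (Ioi 0) := by
  have hμ := hν.trans h1
  refine interlaced_congr (fun x hx => (besselJ_deriv ν hx).deriv) (fun x hx => (besselJ_deriv μ hx).deriv) ?_
  exact interlaced_deriv hν h1 (solJ hν) (solJ hμ)
    (fun x hx h => ⟨dJ_zero_gt hν hx h, IJ_pos hν h1 h2 hx⟩)
    (fun x hx h => ⟨dJ_zero_gt hμ hx h, IJ_pos hν h1 h2 hx⟩)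

lemma YdY_neg {ν : ℝ} (hν : 0 < ν) {x : ℝ} (hx : 0 < x) (hxν : x ≤ ν) : besselY ν x * dY ν x < 0 := by
  have h1 := NN_deriv hν hx
  have h2 : 2 * besselJ ν x * dJ ν x + 2 * besselY ν x * dY ν x ≤ 0 := by
    have hs := (hasDerivAt_iff_tendsto_slope.mp h1).mono_left
      (nhdsWithin_mono x fun y (hy : y ∈ Ioi x) => ne_of_gt hy)
    refine le_of_tendsto hs ?_
    filter_upwards [self_mem_nhdsWithin] with y hy
    have hy : x < y := hy
    rw [slope_def_field]
    exact div_nonpos_of_nonpos_of_nonneg (by linarith [NN_anti hν hx hy.le]) (by linarith)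
  have := mul_pos (J_pos_le hν hx hxν) (dJ_pos_le hν hx hxν)
  linarith

lemma dY_zero {ν : ℝ} (hν : 0 < ν) {x : ℝ} (hx : 0 < x) (h : dY ν x = 0) :
    ν < x ∧ ∃ z, 0 < z ∧ z ≤ x ∧ besselY ν z = 0 := by
  have hνx : ν < x := by
    by_contra hc
    push Not at hc
    have := YdY_neg hν hx hc
    rw [h, mul_zero] at this
    exact lt_irrefl _ this
  refine ⟨hνx, ?_⟩
  by_contra hc
  push Not at hc
  have hS := solY hν
  have hneg : ∀ y, 0 < y → y ≤ x → besselY ν y < 0 := by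
    intro y hy hyx
    by_contra hn
    push Not at hn
    obtain ⟨r, hr, hr2⟩ := ((Y_neg_near hν).and (Ioo_mem_nhdsGT hy)).exists
    have hcont : ContinuousOn (besselY ν) (Icc r y) := fun w hw =>
      (hS w (hr2.1.trans_le hw.1)).1.continuousAt.continuousWithinAt
    obtain ⟨w, hw, hw0⟩ := intermediate_value_Icc hr2.2.le hcont (show (0:ℝ) ∈ Icc _ _ from ⟨hr.le, hn⟩)
    exact hc w (hr2.1.trans_le hw.1) (hw.2.trans hyx) hw0
  have hY := YdY_neg hν hν le_rfl
  have hd : 0 < dY ν ν := by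
    have := hneg ν hν hνx.le
    by_contra hn
    push Not at hn
    have := mul_nonneg_of_nonpos_of_nonpos this.le hn
    linarith
  have m : MonotoneOn (fun x => x * dY ν x) (Icc ν x) := by
    refine monotoneOn_of_deriv_nonneg (convex_Icc _ _)
      (fun y hy => (hS.xder (hν.trans_le hy.1)).continuousAt.continuousWithinAt)
      (fun y hy => (hS.xder (hν.trans_le (interior_subset hy).1)).differentiableAt.differentiableWithinAt) ?_
    intro y hy
    have hy := interior_subset hy
    have hy0 := hν.trans_le hy.1
    rw [(hS.xder hy0).deriv]
    refine mul_nonneg_of_nonpos_of_nonpos ?_ (hneg y hy0 hy.2).le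
    rw [sub_nonpos, div_le_iff₀ hy0]
    nlinarith [hy.1]
  have := m ⟨le_rfl, hνx.le⟩ ⟨hνx.le, le_rfl⟩ hνx.le
  simp only [h, mul_zero] at this
  linarith [mul_pos hν hd]

lemma part_iii {ν μ : ℝ} (hν : 0 < ν) (h1 : ν < μ) (h2 : μ ≤ ν + 2) :
    InterlacedOn (deriv (besselY ν)) (deriv (besselY μ)) (Ioi 0) := by
  have hμ := hν.trans h1
  have hA : ∀ x > 0, besselY ν x = 0 → dY ν x * besselY μ x < 0 := by
    intro x hx h
    have := cyl_A (-(π / 2)) hν h1 h2 hx (by rw [cyl_Y]; exact h)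
    simp only [cyl_Y] at this
    exact this
  have hB : ∀ x > 0, besselY μ x = 0 → 0 < dY μ x * besselY ν x := by
    intro x hx h
    have := cyl_B (-(π / 2)) hν h1 h2 hx (by rw [cyl_Y]; exact h)
    simp only [cyl_Y] at this
    exact this
  refine interlaced_congr (fun x hx => (besselY_deriv hν hx).deriv) (fun x hx => (besselY_deriv hμ hx).deriv) ?_
  refine interlaced_deriv hν h1 (solY hν) (solY hμ) (fun x hx h => ?_) (fun x hx h => ?_)
  · obtain ⟨a, z, hz, hzx, hz0⟩ := dY_zero hν hx h
    refine ⟨a, cross_pos_of hν h1 (solY hν) (solY hμ) hA hB hz ?_ hzx⟩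
    have := mul_pos hz (neg_pos.mpr (hA z hz hz0))
    rw [hz0]; linarith
  · obtain ⟨a, z, hz, hzx, hz0⟩ := dY_zero hμ hx h
    refine ⟨a, cross_pos_of hν h1 (solY hν) (solY hμ) hA hB hz ?_ hzx⟩
    have := mul_pos hz (hB z hz hz0)
    rw [hz0]; linarith

/-- For `ν > 0` and `0 < ε ≤ 2`: the positive zeros of `C_ν` and `C_{ν+ε}` are
interlaced on `(0,∞)`, and likewise for `J_ν′`, `J_{ν+ε}′` and for `Y_ν′`, `Y_{ν+ε}′`. -/
theorem interlaced_add_eps (δ ν ε : ℝ) (hν : 0 < ν) (hε : 0 < ε) (hε2 : ε ≤ 2) :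
    InterlacedOn (cylinder δ ν) (cylinder δ (ν + ε)) (Set.Ioi 0) ∧
      InterlacedOn (deriv (besselJ ν)) (deriv (besselJ (ν + ε))) (Set.Ioi 0) ∧
      InterlacedOn (deriv (besselY ν)) (deriv (besselY (ν + ε))) (Set.Ioi 0) := by
  have h1 : ν < ν + ε := by linarith
  have h2 : ν + ε ≤ ν + 2 := by linarith
  exact ⟨part_i δ hν h1 h2, part_ii hν h1 h2, part_iii hν h1 h2⟩
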